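/- Fix ξ > 0 and s ∈ (0,1). There exist constants c₁ > 0, β₀ < ∞ (independent of n and W) such that for all sufficiently large n and W the following holds. Let z ∈ ℝ with |z| ≤ √W, let X_n := log‖G(1,n;z)‖, and suppose 𝔼[e^{(s/2)·X_n}] ≥ e^{−ξ n}. Then for every q ∈ (s/2, s), setting α := c₁·√(n/W³) and X̄_n := X_n − 𝔼_q[X_n], one has ℙ_q[ |X̄_n| ≤ α ] ≤ β₀ · √( ℙ_q[ X̄_n ≥ 2α ] · ℙ_q[ X̄_n ≤ −2α ] ) + 1/2. -/

import Mathlib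

open MeasureTheory Matrix
open scoped ENNReal NNReal

noncomputable section

namespace RBM

abbrev Mat (W : ℕ) := Matrix (Fin W) (Fin W) ℂ
abbrev MatP (W : ℕ) := Fin W → Fin W → ℂ

abbrev HermParam (W : ℕ) := (Fin W → ℝ) × ({ p : Fin W × Fin W // p.1 < p.2 } → ℂ)

/-- Parametrization of Hermitian matrices by diagonal (real) and
above-diagonal (complex) entries. -/
def toHerm {W : ℕ} (x : HermParam W) : Mat W :=
  Matrix.of fun i j =>
    if h : i = j then (x.1 i : ℂ)
    else if h2 : i < j then x.2 ⟨(i, j), h2⟩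
    else (starRingEnd ℂ) (x.2 ⟨(j, i), lt_of_le_of_ne (not_lt.mp h2) (Ne.symm h)⟩)

/-- Sample space of the Wegner orbital model: `n` Hermitian matrices `V_j`
(given by their parameters) and `n-1` complex matrices `T_j`. -/
abbrev ΩW (n W : ℕ) := (Fin n → HermParam W) × (Fin (n - 1) → MatP W)

/-- The (unnormalized) density `exp(-W tr(Σ V_j^2 + Σ T_j* T_j))`. -/
def wegnerDensity (n W : ℕ) (ω : ΩW n W) : ℝ≥0∞ :=
  ENNReal.ofReal <| Real.exp <| -(W : ℝ) *
    ((∑ j : Fin n, (Matrix.trace (toHerm (ω.1 j) * toHerm (ω.1 j))).re) +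
     (∑ j : Fin (n - 1), (Matrix.trace ((Matrix.of (ω.2 j))ᴴ * Matrix.of (ω.2 j))).re))

/-- Unnormalized Wegner orbital measure: the above density with respect to
Lebesgue (additive Haar) measure on the parameter space. -/
def wegnerRaw (n W : ℕ) : Measure (ΩW n W) := volume.withDensity (wegnerDensity n W)

/-- The Wegner orbital probability measure. -/
def wegner (n W : ℕ) : Measure (ΩW n W) := (wegnerRaw n W Set.univ)⁻¹ • wegnerRaw n W

def Vm {n W : ℕ} (ω : ΩW n W) (j : ℕ) : Mat W :=
  if h : j < n then toHerm (ω.1 ⟨j, h⟩) else 0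

def Tm {n W : ℕ} (ω : ΩW n W) (j : ℕ) : Mat W :=
  if h : j < n - 1 then Matrix.of (ω.2 ⟨j, h⟩) else 0

/-- The block tridiagonal Hamiltonian with diagonal blocks `V_j`,
subdiagonal blocks `-T_j` and superdiagonal blocks `-T_j*`, acting on
`ℂ^(n·W)` whose coordinates are indexed by pairs (block, inner index). -/
def ham (n W : ℕ) (V T : ℕ → Mat W) : Matrix (Fin n × Fin W) (Fin n × Fin W) ℂ :=
  Matrix.of fun p q =>
    if (p.1 : ℕ) = (q.1 : ℕ) then V (p.1 : ℕ) p.2 q.2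
    else if (p.1 : ℕ) = (q.1 : ℕ) + 1 then (-T (q.1 : ℕ)) p.2 q.2
    else if (q.1 : ℕ) = (p.1 : ℕ) + 1 then (-(T (p.1 : ℕ))ᴴ) p.2 q.2
    else 0

def hamOf {n W : ℕ} (ω : ΩW n W) : Matrix (Fin n × Fin W) (Fin n × Fin W) ℂ :=
  ham n W (Vm ω) (Tm ω)

/-- The resolvent `(H - z)⁻¹`. -/
def resolvent {n W : ℕ} (ω : ΩW n W) (z : ℂ) : Matrix (Fin n × Fin W) (Fin n × Fin W) ℂ :=
  (hamOf ω - z • 1)⁻¹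

/-- The `W×W` block of the resolvent at block position `(x,y)`. -/
def Gblock {n W : ℕ} (ω : ΩW n W) (z : ℂ) (x y : Fin n) : Mat W :=
  Matrix.of fun a b => resolvent ω z (x, a) (y, b)

/-- Operator norm (ℓ²→ℓ² norm) of a complex square matrix. -/
def opNorm {ι : Type*} [Fintype ι] [DecidableEq ι] (M : Matrix ι ι ℂ) : ℝ :=
  ‖Matrix.toEuclideanCLM (𝕜 := ℂ) M‖

/-- The scalar index in `{0, …, nW-1}` of an entry index. -/
def idx {n W : ℕ} (p : Fin n × Fin W) : ℝ := (p.1 : ℕ) * W + (p.2 : ℕ)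

end RBM

namespace RBM

/-- Expectation of `Z` under the `q`-tilted measure with tilt variable `X`. -/
def tiltExp {α : Type*} [MeasurableSpace α] (μ : Measure α) (X : α → ℝ) (q : ℝ)
    (Z : α → ℝ) : ℝ :=
  (∫ ω, Z ω * Real.exp (q * X ω) ∂μ) / (∫ ω, Real.exp (q * X ω) ∂μ)

/-- Probability of the event `E` under the `q`-tilted measure with tilt variable `X`. -/
def tiltProb {α : Type*} [MeasurableSpace α] (μ : Measure α) (X : α → ℝ) (q : ℝ)
    (E : Set α) : ℝ :=
  (∫ ω in E, Real.exp (q * X ω) ∂μ) / (∫ ω, Real.exp (q * X ω) ∂μ)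

section

instance measurableSpaceMatrix {m n : Type*} : MeasurableSpace (Matrix m n ℂ) :=
  inferInstanceAs (MeasurableSpace (m → n → ℂ))

instance borelSpaceMatrix {m n : Type*} [Countable m] [Countable n] :
    BorelSpace (Matrix m n ℂ) := inferInstanceAs (BorelSpace (m → n → ℂ))

instance secondCountableMatrix {m n : Type*} [Countable m] [Countable n] :
    SecondCountableTopology (Matrix m n ℂ) :=
  inferInstanceAs (SecondCountableTopology (m → n → ℂ))

instance isAddHaarMeasureMatP {W : ℕ} : (volume : Measure (MatP W)).IsAddHaarMeasure :=
  Measure.instIsAddHaarMeasureForallVolumeOfMeasurableAddOfSigmaFinite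

instance isAddHaarMeasureHermParam {W : ℕ} :
    (volume : Measure (HermParam W)).IsAddHaarMeasure :=
  Measure.prod.instIsAddHaarMeasure (volume : Measure (Fin W → ℝ))
    (volume : Measure ({ p : Fin W × Fin W // p.1 < p.2 } → ℂ))

instance measurableAddHermParam {W : ℕ} : MeasurableAdd (HermParam W) :=
  have : MeasurableAdd₂ (HermParam W) := ContinuousAdd.measurableMul₂
  inferInstance

instance isAddHaarMeasurePiHermParam {n W : ℕ} :
    (volume : Measure (Fin n → HermParam W)).IsAddHaarMeasure :=
  Measure.instIsAddHaarMeasureForallVolumeOfMeasurableAddOfSigmaFinite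

instance isAddHaarMeasurePiMatP {n W : ℕ} :
    (volume : Measure (Fin n → MatP W)).IsAddHaarMeasure :=
  Measure.instIsAddHaarMeasureForallVolumeOfMeasurableAddOfSigmaFinite

instance isAddHaarMeasureΩW {n W : ℕ} : (volume : Measure (ΩW n W)).IsAddHaarMeasure :=
  Measure.prod.instIsAddHaarMeasure (volume : Measure (Fin n → HermParam W))
    (volume : Measure (Fin (n - 1) → MatP W))

instance isAddHaarMeasureHermParamProd {W : ℕ} :
    (volume : Measure (HermParam W × HermParam W)).IsAddHaarMeasure :=
  Measure.prod.instIsAddHaarMeasure (volume : Measure (HermParam W))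
    (volume : Measure (HermParam W))

section frobenius

variable {m n k : Type*} [Fintype m] [Fintype n] [Fintype k]

/-- Squared Frobenius norm. -/
def fsq (M : Matrix m n ℂ) : ℝ := ∑ i, ∑ j, ‖M i j‖ ^ 2

/-- Real Frobenius inner product. -/
def finr (M N : Matrix m n ℂ) : ℝ := ∑ i, ∑ j, (M i j * star (N i j)).re

lemma fsq_nonneg (M : Matrix m n ℂ) : 0 ≤ fsq M := by unfold fsq; positivity

lemma normSq_add_eq (a b : ℂ) : ‖a + b‖ ^ 2 = ‖a‖ ^ 2 + ‖b‖ ^ 2 + 2 * (a * star b).re := by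
  simp only [← Complex.normSq_eq_norm_sq, Complex.normSq_add]; rfl

lemma fsq_add (M N : Matrix m n ℂ) : fsq (M + N) = fsq M + fsq N + 2 * finr M N := by
  simp only [fsq, finr, Matrix.add_apply, normSq_add_eq, Finset.sum_add_distrib, Finset.mul_sum]

lemma fsq_real_smul (c : ℝ) (M : Matrix m n ℂ) : fsq (c • M) = c ^ 2 * fsq M := by
  simp only [fsq, Matrix.smul_apply, norm_smul, mul_pow, Finset.mul_sum, Real.norm_eq_abs, sq_abs]

lemma fsq_neg (M : Matrix m n ℂ) : fsq (-M) = fsq M := by simp [fsq]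

lemma fsq_zero : fsq (0 : Matrix m n ℂ) = 0 := by simp [fsq]

lemma fsq_eq_zero {M : Matrix m n ℂ} : fsq M = 0 ↔ M = 0 := by
  constructor
  · intro h
    ext i j
    have h1 := (Finset.sum_eq_zero_iff_of_nonneg (fun i _ => by positivity)).1 h i
      (Finset.mem_univ _)
    have h2 := (Finset.sum_eq_zero_iff_of_nonneg (fun i _ => by positivity)).1 h1 j
      (Finset.mem_univ _)
    simpa using h2
  · rintro rfl; exact fsq_zero

lemma finr_smul_left (c : ℝ) (M N : Matrix m n ℂ) : finr (c • M) N = c * finr M N := by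
  simp only [finr, Matrix.smul_apply, smul_mul_assoc, Complex.smul_re, smul_eq_mul,
    Finset.mul_sum]

lemma finr_comm (M N : Matrix m n ℂ) : finr M N = finr N M := by
  simp only [finr]
  refine Finset.sum_congr rfl fun i _ => Finset.sum_congr rfl fun j _ => ?_
  simp [Complex.mul_re]; ring

lemma finr_add_left (M M' N : Matrix m n ℂ) : finr (M + M') N = finr M N + finr M' N := by
  simp only [finr, Matrix.add_apply, add_mul, Complex.add_re, Finset.sum_add_distrib]

lemma finr_add_right (M N N' : Matrix m n ℂ) : finr M (N + N') = finr M N + finr M N' := by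
  rw [finr_comm, finr_add_left, finr_comm N, finr_comm N']

lemma finr_smul_right (c : ℝ) (M N : Matrix m n ℂ) : finr M (c • N) = c * finr M N := by
  rw [finr_comm, finr_smul_left, finr_comm]

lemma finr_neg_left (M N : Matrix m n ℂ) : finr (-M) N = - finr M N := by
  have := finr_smul_left (-1) M N; simpa using this

lemma finr_sub_left (M M' N : Matrix m n ℂ) : finr (M - M') N = finr M N - finr M' N := by
  rw [sub_eq_add_neg, finr_add_left, finr_neg_left]; ring

lemma finr_self (M : Matrix m n ℂ) : finr M M = fsq M := by
  simp only [finr, fsq, ← Complex.normSq_eq_norm_sq]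
  refine Finset.sum_congr rfl fun i _ => Finset.sum_congr rfl fun j _ => ?_
  simp [Complex.mul_re, Complex.normSq_apply]

lemma fsq_sub (M N : Matrix m n ℂ) : fsq (M - N) = fsq M + fsq N - 2 * finr M N := by
  rw [sub_eq_add_neg, fsq_add, fsq_neg, finr_comm, finr_neg_left, finr_comm]; ring

lemma two_finr_le (M N : Matrix m n ℂ) : 2 * finr M N ≤ fsq M + fsq N := by
  have := fsq_nonneg (M - N); rw [fsq_sub] at this; linarith

lemma fsq_add_le (M N : Matrix m n ℂ) : fsq (M + N) ≤ 2 * fsq M + 2 * fsq N := by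
  rw [fsq_add]; linarith [two_finr_le M N]

lemma fsq_conjTranspose (M : Matrix m n ℂ) : fsq Mᴴ = fsq M := by
  simp only [fsq, conjTranspose_apply, norm_star]
  exact Finset.sum_comm

lemma fsq_mul_le (M : Matrix m n ℂ) (N : Matrix n k ℂ) : fsq (M * N) ≤ fsq M * fsq N := by
  have h : ∀ i j, ‖(M * N) i j‖ ^ 2 ≤ (∑ a, ‖M i a‖ ^ 2) * ∑ a, ‖N a j‖ ^ 2 := by
    intro i j
    calc ‖(M * N) i j‖ ^ 2 ≤ (∑ a, ‖M i a‖ * ‖N a j‖) ^ 2 := by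
          gcongr
          rw [Matrix.mul_apply]
          exact (norm_sum_le _ _).trans (by simp)
      _ ≤ _ := Finset.sum_mul_sq_le_sq_mul_sq _ _ _
  calc fsq (M * N) ≤ ∑ i, ∑ j, (∑ a, ‖M i a‖ ^ 2) * ∑ a, ‖N a j‖ ^ 2 :=
        Finset.sum_le_sum fun i _ => Finset.sum_le_sum fun j _ => h i j
    _ = (∑ i, ∑ a, ‖M i a‖ ^ 2) * ∑ j, ∑ a, ‖N a j‖ ^ 2 := by
        rw [Finset.sum_mul_sum]
    _ = fsq M * fsq N := by rw [fsq, fsq, Finset.sum_comm (f := fun j a => ‖N a j‖ ^ 2)]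

lemma trace_mul_conjTranspose_re (M N : Matrix m n ℂ) : (trace (M * Nᴴ)).re = finr M N := by
  simp [trace, finr, Matrix.mul_apply]

lemma trace_conjTranspose_mul_re (M : Matrix m n ℂ) : (trace (Mᴴ * M)).re = fsq M := by
  rw [trace_mul_comm, trace_mul_conjTranspose_re, finr_self]

lemma norm_sq_le_fsq (M : Matrix m n ℂ) (i : m) (j : n) : ‖M i j‖ ^ 2 ≤ fsq M := by
  refine le_trans ?_ (Finset.single_le_sum (f := fun i => ∑ j, ‖M i j‖ ^ 2)
    (fun i _ => by positivity) (Finset.mem_univ i))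
  exact Finset.single_le_sum (f := fun j => ‖M i j‖ ^ 2)
    (fun i _ => by positivity) (Finset.mem_univ j)

lemma continuous_fsq : Continuous (fsq : Matrix m n ℂ → ℝ) := by
  unfold fsq
  fun_prop

@[fun_prop]
lemma measurable_fsq : Measurable (fsq : Matrix m n ℂ → ℝ) := continuous_fsq.measurable

@[fun_prop]
lemma continuous_finr : Continuous fun p : Matrix m n ℂ × Matrix m n ℂ => finr p.1 p.2 := by
  unfold finr
  fun_prop

end frobenius

section herm

variable {W : ℕ}

lemma toHerm_diag (x : HermParam W) (i : Fin W) : toHerm x i i = (x.1 i : ℂ) := by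
  simp [toHerm]

lemma toHerm_lt (x : HermParam W) {i j : Fin W} (h : i < j) :
    toHerm x i j = x.2 ⟨(i, j), h⟩ := by
  simp [toHerm, h, h.ne]

lemma toHerm_gt (x : HermParam W) {i j : Fin W} (h : j < i) :
    toHerm x i j = star (x.2 ⟨(j, i), h⟩) := by
  simp [toHerm, h.not_gt, h.ne']

lemma toHerm_isHermitian (x : HermParam W) : (toHerm x).IsHermitian := by
  ext i j
  rw [conjTranspose_apply]
  rcases lt_trichotomy i j with h | rfl | h
  · rw [toHerm_lt x h, toHerm_gt x h, star_star]
  · rw [toHerm_diag]; exact Complex.conj_ofReal _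
  · rw [toHerm_lt x h, toHerm_gt x h]

/-- Inverse of `toHerm`. -/
def fromHerm (M : Mat W) : HermParam W := (fun i => (M i i).re, fun p => M p.1.1 p.1.2)

lemma fromHerm_toHerm (x : HermParam W) : fromHerm (toHerm x) = x := by
  refine Prod.ext ?_ ?_
  · ext i; simp [fromHerm, toHerm_diag]
  · ext ⟨⟨i, j⟩, h⟩; simp [fromHerm, toHerm_lt x h]

lemma toHerm_fromHerm {M : Mat W} (hM : M.IsHermitian) : toHerm (fromHerm M) = M := by
  ext i j
  rcases lt_trichotomy i j with h | rfl | h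
  · rw [toHerm_lt _ h]; rfl
  · rw [toHerm_diag]
    exact hM.coe_re_apply_self i
  · rw [toHerm_gt _ h]; exact hM.apply i j

lemma toHerm_add (x y : HermParam W) : toHerm (x + y) = toHerm x + toHerm y := by
  ext i j
  rw [Matrix.add_apply]
  rcases lt_trichotomy i j with h | rfl | h
  · simp [toHerm_lt _ h]
  · simp [toHerm_diag]
  · simp [toHerm_gt _ h]

lemma toHerm_smul (c : ℝ) (x : HermParam W) : toHerm (c • x) = c • toHerm x := by
  ext i j
  rw [Matrix.smul_apply]
  rcases lt_trichotomy i j with h | rfl | h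
  · simp [toHerm_lt _ h]
  · simp [toHerm_diag]
  · simp [toHerm_gt _ h]

lemma toHerm_neg (x : HermParam W) : toHerm (-x) = -toHerm x := by
  have := toHerm_smul (-1) x; simpa using this

lemma toHerm_sub (x y : HermParam W) : toHerm (x - y) = toHerm x - toHerm y := by
  rw [sub_eq_add_neg, toHerm_add, toHerm_neg, sub_eq_add_neg]

lemma toHerm_zero : toHerm (0 : HermParam W) = 0 := by
  have := toHerm_smul 0 (0 : HermParam W); simpa using this

lemma fromHerm_add (M N : Mat W) : fromHerm (M + N) = fromHerm M + fromHerm N := by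
  refine Prod.ext ?_ ?_ <;> ext i <;> simp [fromHerm]

lemma fromHerm_real_smul (c : ℝ) (M : Mat W) : fromHerm (c • M) = c • fromHerm M := by
  refine Prod.ext ?_ ?_ <;> ext i <;> simp [fromHerm]

lemma continuous_toHerm : Continuous (toHerm : HermParam W → Mat W) := by
  refine continuous_matrix fun i j => ?_
  rcases lt_trichotomy i j with h | rfl | h
  · simp only [toHerm_lt _ h]; fun_prop
  · simp only [toHerm_diag]; fun_prop
  · simp only [toHerm_gt _ h]; fun_prop

@[fun_prop]
lemma measurable_toHerm : Measurable (toHerm : HermParam W → Mat W) :=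
  continuous_toHerm.measurable

lemma continuous_fromHerm : Continuous (fromHerm : Mat W → HermParam W) := by
  unfold fromHerm
  fun_prop

@[fun_prop]
lemma measurable_fromHerm : Measurable (fromHerm : Mat W → HermParam W) :=
  continuous_fromHerm.measurable

@[fun_prop]
lemma measurable_of : Measurable (fun T : MatP W => (Matrix.of T : Mat W)) := measurable_id

@[fun_prop]
lemma measurable_matrix_det {n : Type*} [Fintype n] [DecidableEq n] :
    Measurable (fun M : Matrix n n ℂ => M.det) :=
  (Continuous.matrix_det continuous_id).measurable

@[fun_prop]
lemma measurable_matrix_inv {n : Type*} [Fintype n] [DecidableEq n] :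
    Measurable (fun M : Matrix n n ℂ => M⁻¹) := by
  simp only [Matrix.inv_def, Ring.inverse_eq_inv']
  have : Measurable (fun M : Matrix n n ℂ => M.adjugate) :=
    (Continuous.matrix_adjugate continuous_id).measurable
  fun_prop

@[fun_prop]
lemma measurable_matrix_conjTranspose {m n : Type*} [Countable m] [Countable n] :
    Measurable (fun M : Matrix m n ℂ => Mᴴ) :=
  (Continuous.matrix_conjTranspose continuous_id).measurable

lemma measurable_matrix_apply {m n : Type*} (i : m) (j : n) :
    Measurable (fun M : Matrix m n ℂ => M i j) :=
  (measurable_pi_apply j).comp (measurable_pi_apply i)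

/-- Quadratic form of the Gaussian weight of a Hermitian block. -/
def hq (x : HermParam W) : ℝ := fsq (toHerm x)

/-- Quadratic form of the Gaussian weight of a Ginibre block. -/
def mq (T : MatP W) : ℝ := fsq (Matrix.of T : Mat W)

@[fun_prop] lemma measurable_hq : Measurable (hq : HermParam W → ℝ) :=
  measurable_fsq.comp measurable_toHerm

@[fun_prop] lemma measurable_mq : Measurable (mq : MatP W → ℝ) :=
  measurable_fsq.comp measurable_of

lemma hq_nonneg (x : HermParam W) : 0 ≤ hq x := fsq_nonneg _
lemma mq_nonneg (x : MatP W) : 0 ≤ mq x := fsq_nonneg _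

lemma trace_toHerm_sq (x : HermParam W) : (trace (toHerm x * toHerm x)).re = hq x := by
  have := trace_conjTranspose_mul_re (toHerm x)
  rwa [(toHerm_isHermitian x).eq] at this

lemma wegnerDensity_eq (n W : ℕ) (ω : ΩW n W) : wegnerDensity n W ω =
    ENNReal.ofReal (Real.exp (-(W : ℝ) * ((∑ j, hq (ω.1 j)) + ∑ j, mq (ω.2 j)))) := by
  unfold wegnerDensity
  simp only [trace_toHerm_sq, trace_conjTranspose_mul_re]
  rfl

end herm

end

section

section gauss

/-- The Gaussian weight attached to a quadratic form. -/
def gw {E : Type*} (q : E → ℝ) (x : E) : ℝ≥0∞ := ENNReal.ofReal (Real.exp (-q x))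

@[fun_prop]
lemma measurable_gw {E : Type*} [MeasurableSpace E] {q : E → ℝ} (hq : Measurable q) :
    Measurable (gw q) := by unfold gw; fun_prop

lemma gw_ne_top {E : Type*} (q : E → ℝ) (x : E) : gw q x ≠ ∞ := ENNReal.ofReal_ne_top

lemma gw_pos {E : Type*} (q : E → ℝ) (x : E) : gw q x ≠ 0 := by
  simp [gw, Real.exp_pos]

section group
variable {E : Type*} [AddCommGroup E] [MeasurableSpace E] [MeasurableAdd E]
  (μ : Measure E) [μ.IsAddLeftInvariant]

lemma lintegral_gw_le_shift {q : E → ℝ} (hqm : Measurable q) {v : E}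
    (hq : ∀ x, q (x + v) + q (x - v) = 2 * q x + 2 * q v) {f : E → ℝ≥0∞} (hf : Measurable f) :
    ∫⁻ x, f x * gw q x ∂μ ≤ ENNReal.ofReal (Real.exp (q v)) *
      (2⁻¹ * (∫⁻ x, f (x + v) * gw q x ∂μ + ∫⁻ x, f (x - v) * gw q x ∂μ)) := by
  have h1 : ∫⁻ x, f (x + v) * gw q x ∂μ = ∫⁻ x, f x * gw q (x - v) ∂μ := by
    rw [← lintegral_add_right_eq_self (μ := μ) (fun x => f x * gw q (x - v)) v]
    simp
  have h2 : ∫⁻ x, f (x - v) * gw q x ∂μ = ∫⁻ x, f x * gw q (x + v) ∂μ := by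
    rw [← lintegral_add_right_eq_self (μ := μ) (fun x => f x * gw q (x + v)) (-v)]
    simp [sub_eq_add_neg]
  have hm : Measurable fun x => x - v := by
    simp only [sub_eq_add_neg]; fun_prop
  have hm2 : Measurable fun x => f x * gw q (x - v) := hf.mul ((measurable_gw hqm).comp hm)
  rw [h1, h2, ← lintegral_add_left hm2,
    ← lintegral_const_mul' _ _ (by norm_num), ← lintegral_const_mul' _ _ (by simp)]
  refine lintegral_mono fun x => ?_
  simp only
  rw [← mul_add, mul_left_comm 2⁻¹, mul_left_comm (ENNReal.ofReal _)]
  refine mul_le_mul_right ?_ _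
  have h22 : (2 : ℝ≥0∞)⁻¹ = ENNReal.ofReal (2⁻¹) := by
    rw [ENNReal.ofReal_inv_of_pos (by norm_num)]; norm_num
  simp only [gw]
  rw [h22, ← ENNReal.ofReal_add (by positivity) (by positivity),
    ← ENNReal.ofReal_mul (by positivity), ← ENNReal.ofReal_mul (by positivity)]
  apply ENNReal.ofReal_le_ofReal
  have h3 : Real.exp (-q x) = Real.exp (q v) * Real.exp ((-q (x - v) + -q (x + v)) / 2) := by
    rw [← Real.exp_add]; congr 1; linarith [hq x]
  rw [h3]
  gcongr
  have h4 : Real.exp ((-q (x - v) + -q (x + v)) / 2) =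
      Real.exp (-q (x - v) / 2) * Real.exp (-q (x + v) / 2) := by
    rw [← Real.exp_add]; congr 1; ring
  have h5 : Real.exp (-q (x - v)) = Real.exp (-q (x - v) / 2) ^ 2 := by
    rw [← Real.exp_nat_mul]; congr 1; push_cast; ring
  have h6 : Real.exp (-q (x + v)) = Real.exp (-q (x + v) / 2) ^ 2 := by
    rw [← Real.exp_nat_mul]; congr 1; push_cast; ring
  rw [h4, h5, h6]
  nlinarith [sq_nonneg (Real.exp (-q (x - v) / 2) - Real.exp (-q (x + v) / 2))]

/-- A set whose translates by `v` and `-v` are disjoint has bounded Gaussian mass. -/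
lemma lintegral_gw_disjoint_shift {q : E → ℝ} (hqm : Measurable q) {v : E}
    (hq : ∀ x, q (x + v) + q (x - v) = 2 * q x + 2 * q v) {S : Set E} (hS : MeasurableSet S)
    (hd : ∀ x, x + v ∈ S → x - v ∉ S) :
    ∫⁻ x in S, gw q x ∂μ ≤ ENNReal.ofReal (Real.exp (q v)) * (2⁻¹ * ∫⁻ x, gw q x ∂μ) := by
  have h := lintegral_gw_le_shift μ hqm hq (f := S.indicator 1) (measurable_one.indicator hS)
  have e : ∀ x, S.indicator 1 x * gw q x = S.indicator (gw q) x := by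
    intro x; by_cases hx : x ∈ S <;> simp [hx]
  simp only [e] at h
  rw [lintegral_indicator hS] at h
  refine h.trans ?_
  gcongr
  have hm1 : Measurable fun x : E => x + v := by fun_prop
  have hm2 : Measurable fun x => S.indicator (1 : E → ℝ≥0∞) (x + v) * gw q x :=
    ((measurable_one.indicator hS).comp hm1).mul (measurable_gw hqm)
  rw [← lintegral_add_left hm2]
  refine lintegral_mono fun x => ?_
  simp only [Set.indicator, Pi.one_apply]
  by_cases h1 : x + v ∈ S
  · simp [h1, hd x h1]
  · by_cases h2 : x - v ∈ S <;> simp [h1, h2]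

lemma lintegral_exp_linear {q ℓ : E → ℝ} {v : E} {σ : ℝ}
    (h : ∀ x, q (x - v) = q x - ℓ x + σ) :
    ∫⁻ x, ENNReal.ofReal (Real.exp (ℓ x)) * gw q x ∂μ =
      ENNReal.ofReal (Real.exp σ) * ∫⁻ x, gw q x ∂μ := by
  rw [← lintegral_add_right_eq_self (μ := μ) (fun x => gw q x) (-v),
    ← lintegral_const_mul' _ _ (by simp)]
  refine lintegral_congr fun x => ?_
  rw [gw, gw, ← sub_eq_add_neg, h x, ← ENNReal.ofReal_mul (by positivity),
    ← ENNReal.ofReal_mul (by positivity), ← Real.exp_add, ← Real.exp_add]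
  congr 2
  ring

/-- `ℓ` is a Gaussian linear functional represented by `v`, of variance proxy `σ`. -/
structure GaussLin [Module ℝ E] (q ℓ : E → ℝ) (v : E) (σ : ℝ) : Prop where
  eq : ∀ (t : ℝ) (x : E), q (x - t • v) = q x - t * ℓ x + t ^ 2 * σ
  nonneg : ∀ x, 0 ≤ q x
  meas : Measurable q
  measℓ : Measurable ℓ

variable {μ}
variable [Module ℝ E] {q ℓ : E → ℝ} {v : E} {σ : ℝ}

lemma GaussLin.lintegral_exp (h : GaussLin q ℓ v σ) (t : ℝ) :
    ∫⁻ x, ENNReal.ofReal (Real.exp (t * ℓ x)) * gw q x ∂μ =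
      ENNReal.ofReal (Real.exp (t ^ 2 * σ)) * ∫⁻ x, gw q x ∂μ :=
  lintegral_exp_linear μ (h.eq t)

lemma GaussLin.eq_zero {E : Type*} [AddCommGroup E] [MeasurableSpace E] [Module ℝ E]
    {q ℓ : E → ℝ} {v : E} {σ : ℝ} (h : GaussLin q ℓ v σ) (hσ : σ ≤ 0) (x : E) : ℓ x = 0 := by
  by_contra hne
  have h1 := h.eq ((q x + 1) / ℓ x) x
  rw [div_mul_cancel₀ _ hne] at h1
  have h2 := h.nonneg (x - ((q x + 1) / ℓ x) • v)
  have h3 : ((q x + 1) / ℓ x) ^ 2 * σ ≤ 0 := mul_nonpos_of_nonneg_of_nonpos (sq_nonneg _) hσ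
  linarith

lemma exp_add_exp_neg_ge (y : ℝ) : 1 + y ^ 2 / 2 + y ^ 4 / 24 ≤ (Real.exp y + Real.exp (-y)) / 2 := by
  wlog hy : 0 ≤ y
  · have := this (-y) (by linarith)
    simp only [neg_neg] at this
    linarith [show (-y)^2 = y^2 by ring, show (-y)^4 = y^4 by ring]
  have h1 := Real.cosh_eq y
  rw [← h1]
  have h2 := Real.hasSum_cosh y
  have h3 := sum_le_hasSum (Finset.range 3) (fun i _ => by positivity) h2
  simp [Finset.sum_range_succ, Nat.factorial] at h3
  linarith

/-- Second and fourth moments of a Gaussian linear functional. -/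
lemma GaussLin.moments (h : GaussLin q ℓ v σ) :
    (∫⁻ x, ENNReal.ofReal (ℓ x ^ 2) * gw q x ∂μ ≤ ENNReal.ofReal (6 * σ) * ∫⁻ x, gw q x ∂μ) ∧
    (∫⁻ x, ENNReal.ofReal (ℓ x ^ 4) * gw q x ∂μ ≤
      ENNReal.ofReal (72 * σ ^ 2) * ∫⁻ x, gw q x ∂μ) := by
  rcases le_or_gt σ 0 with hσ | hσ
  · simp [h.eq_zero hσ]
  set t : ℝ := (Real.sqrt σ)⁻¹ with ht
  have ht2 : t ^ 2 = σ⁻¹ := by rw [ht, inv_pow, Real.sq_sqrt hσ.le]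
  have ht2' : t ^ 2 * σ = 1 := by rw [ht2]; field_simp
  have hg := measurable_gw h.meas
  have hmℓ := h.measℓ
  have he : Real.exp 1 ≤ 3 := by linarith [Real.exp_one_lt_d9]
  have key : ∀ (c : ℝ) (φ : ℝ → ℝ), 0 ≤ c →
      (∀ y, φ y ≤ c * (Real.exp (t * y) + Real.exp (-t * y))) →
      ∫⁻ x, ENNReal.ofReal (φ (ℓ x)) * gw q x ∂μ ≤ ENNReal.ofReal (6 * c) * ∫⁻ x, gw q x ∂μ := by
    intro c φ hc hφ
    calc ∫⁻ x, ENNReal.ofReal (φ (ℓ x)) * gw q x ∂μ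
        ≤ ∫⁻ x, ENNReal.ofReal c * (ENNReal.ofReal (Real.exp (t * ℓ x)) * gw q x +
            ENNReal.ofReal (Real.exp (-t * ℓ x)) * gw q x) ∂μ := by
          refine lintegral_mono fun x => ?_
          rw [← add_mul, ← mul_assoc, ← ENNReal.ofReal_add (by positivity) (by positivity),
            ← ENNReal.ofReal_mul hc]
          gcongr
          exact hφ _
      _ = ENNReal.ofReal c * (ENNReal.ofReal (Real.exp 1) * ∫⁻ x, gw q x ∂μ +
            ENNReal.ofReal (Real.exp 1) * ∫⁻ x, gw q x ∂μ) := by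
          rw [lintegral_const_mul' _ _ (by simp), lintegral_add_left (by fun_prop),
            h.lintegral_exp, h.lintegral_exp, neg_sq, ht2']
      _ = ENNReal.ofReal (c * (Real.exp 1 + Real.exp 1)) * ∫⁻ x, gw q x ∂μ := by
          rw [← add_mul, ← mul_assoc, ← ENNReal.ofReal_add (by positivity) (by positivity),
            ← ENNReal.ofReal_mul hc]
      _ ≤ _ := by
          refine mul_le_mul_left (ENNReal.ofReal_le_ofReal ?_) _
          nlinarith
  constructor
  · refine key σ (fun y => y ^ 2) hσ.le fun y => ?_
    have := exp_add_exp_neg_ge (t * y)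
    have h1 : y ^ 2 = σ * (t * y) ^ 2 := by rw [mul_pow, ht2]; field_simp
    rw [h1, neg_mul]
    gcongr
    nlinarith [sq_nonneg ((t * y) ^ 2)]
  · have := key (12 * σ ^ 2) (fun y => y ^ 4) (by positivity) fun y => ?_
    · refine this.trans (le_of_eq ?_)
      congr 2; ring
    have := exp_add_exp_neg_ge (t * y)
    have h1 : y ^ 4 = σ ^ 2 * (t * y) ^ 4 := by
      rw [mul_pow, show t ^ 4 = (t ^ 2) ^ 2 by ring, ht2]; field_simp
    rw [h1, neg_mul, mul_comm 12, mul_assoc]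
    gcongr
    nlinarith [sq_nonneg (t * y)]

/-- Gaussian tail of a linear functional. -/
lemma GaussLin.tail (h : GaussLin q ℓ v σ) {L t : ℝ} (ht : 0 ≤ t) :
    ∫⁻ x in {x | L ≤ |ℓ x|}, gw q x ∂μ ≤
      ENNReal.ofReal (2 * Real.exp (t ^ 2 * σ - t * L)) * ∫⁻ x, gw q x ∂μ := by
  have hmℓ := h.measℓ
  have hg := measurable_gw h.meas
  have hS : MeasurableSet {x | L ≤ |ℓ x|} := measurableSet_le measurable_const (by fun_prop)
  rw [← lintegral_indicator hS]
  calc ∫⁻ x, Set.indicator {x | L ≤ |ℓ x|} (gw q) x ∂μ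
      ≤ ∫⁻ x, ENNReal.ofReal (Real.exp (-(t * L))) *
        (ENNReal.ofReal (Real.exp (t * ℓ x)) * gw q x +
            ENNReal.ofReal (Real.exp (-t * ℓ x)) * gw q x) ∂μ := by
        refine lintegral_mono fun x => ?_
        simp only [Set.indicator]
        split_ifs with hx
        · change L ≤ |ℓ x| at hx
          rw [← add_mul, ← mul_assoc, ← ENNReal.ofReal_add (by positivity) (by positivity),
            ← ENNReal.ofReal_mul (by positivity)]
          refine le_mul_of_one_le_left (zero_le) ?_
          rw [ENNReal.one_le_ofReal, mul_add, ← Real.exp_add, ← Real.exp_add]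
          rcases abs_cases (ℓ x) with ⟨h1, h2⟩ | ⟨h1, h2⟩
          · have : 0 ≤ -(t * L) + t * ℓ x := by rw [h1] at hx; nlinarith
            linarith [Real.one_le_exp this, Real.exp_pos (-(t * L) + -t * ℓ x)]
          · have : 0 ≤ -(t * L) + -t * ℓ x := by rw [h1] at hx; nlinarith
            linarith [Real.one_le_exp this, Real.exp_pos (-(t * L) + t * ℓ x)]
        · exact zero_le
    _ = _ := by
        rw [lintegral_const_mul' _ _ (by simp), lintegral_add_left (by fun_prop),
            h.lintegral_exp, h.lintegral_exp, neg_sq, ← add_mul, ← mul_assoc,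
            ← ENNReal.ofReal_add (by positivity) (by positivity),
            ← ENNReal.ofReal_mul (by positivity)]
        congr 2
        rw [mul_add, ← Real.exp_add, ← two_mul]
        ring_nf

/-- A measurable set meeting every line in a fixed direction in a null set is null. -/
lemma measure_eq_zero_of_lines [SFinite μ] [MeasurableAdd₂ E] [MeasurableSMul₂ ℝ E] {N : Set E}
    (hN : MeasurableSet N) (v : E) (h : ∀ x, volume {t : ℝ | x + t • v ∈ N} = 0) : μ N = 0 := by
  have hmeas : Measurable fun p : E × ℝ => N.indicator (1 : E → ℝ≥0∞) (p.1 + p.2 • v) :=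
    (measurable_one.indicator hN).comp (by fun_prop)
  have h1 : ∫⁻ x, ∫⁻ t in Set.Icc (0:ℝ) 1, N.indicator (1 : E → ℝ≥0∞) (x + t • v) ∂volume ∂μ = 0 := by
    rw [lintegral_eq_zero_iff' (Measurable.lintegral_prod_right' hmeas).aemeasurable]
    refine Filter.Eventually.of_forall fun x => ?_
    have hle : ∫⁻ t in Set.Icc (0:ℝ) 1, N.indicator (1 : E → ℝ≥0∞) (x + t • v) ≤
        ∫⁻ t : ℝ, N.indicator (1 : E → ℝ≥0∞) (x + t • v) := setLIntegral_le_lintegral _ _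
    have hs : MeasurableSet {t : ℝ | x + t • v ∈ N} := by
      have : Measurable fun t : ℝ => x + t • v := by fun_prop
      exact this hN
    have : ∫⁻ t : ℝ, N.indicator (1 : E → ℝ≥0∞) (x + t • v) = 0 := by
      have : (fun t : ℝ => N.indicator (1 : E → ℝ≥0∞) (x + t • v)) =
        {t : ℝ | x + t • v ∈ N}.indicator 1 := by
        ext t; simp [Set.indicator]
      rw [this, lintegral_indicator_one hs, h x]
    simpa [this] using hle
  rw [lintegral_lintegral_swap hmeas.aemeasurable] at h1
  have h2 : ∀ t : ℝ, ∫⁻ x : E, N.indicator (1 : E → ℝ≥0∞) (x + t • v) ∂μ = μ N := by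
    intro t
    rw [lintegral_add_right_eq_self (μ := μ) (fun x : E => N.indicator (1 : E → ℝ≥0∞) x),
      lintegral_indicator_one hN]
  simpa [h2] using h1

end group

section fin
variable {E : Type*} [NormedAddCommGroup E] [NormedSpace ℝ E] [MeasurableSpace E] [BorelSpace E]
  [FiniteDimensional ℝ E] (μ : Measure E) [μ.IsAddHaarMeasure]

/-- A linear automorphism preserving the quadratic form preserves Gaussian integrals. -/
lemma lintegral_gw_comp_linear {q : E → ℝ} (hqm : Measurable q) (L : E →ₗ[ℝ] E)
    (hinj : Function.Injective L) (hq : ∀ x, q (L x) = q x)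
    (h0 : ∫⁻ x, gw q x ∂μ ≠ 0) (htop : ∫⁻ x, gw q x ∂μ ≠ ∞) {f : E → ℝ≥0∞}
    (hf : Measurable f) :
    ∫⁻ x, f (L x) * gw q x ∂μ = ∫⁻ x, f x * gw q x ∂μ := by
  have hdet : LinearMap.det L ≠ 0 := by
    have : LinearMap.ker L = ⊥ := LinearMap.ker_eq_bot.2 hinj
    have hu : IsUnit L := (LinearMap.isUnit_iff_ker_eq_bot L).2 this
    exact (hu.map (LinearMap.det)).ne_zero
  have hmap := Measure.map_linearMap_addHaar_eq_smul_addHaar μ hdet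
  have hLm : Measurable L := (LinearMap.continuous_of_finiteDimensional L).measurable
  set c := ENNReal.ofReal |(LinearMap.det L)⁻¹|
  have hcv : ∀ g : E → ℝ≥0∞, Measurable g → ∫⁻ x, g (L x) ∂μ = c * ∫⁻ x, g x ∂μ := by
    intro g hg
    rw [← lintegral_map hg hLm, hmap, lintegral_smul_measure, smul_eq_mul]
  have hgw : ∀ x, gw q (L x) = gw q x := fun x => by simp [gw, hq]
  have hc : c = 1 := by
    have := hcv (gw q) (measurable_gw hqm)
    simp only [hgw] at this
    have h2 : 1 * ∫⁻ x, gw q x ∂μ = c * ∫⁻ x, gw q x ∂μ := by rw [one_mul]; exact this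
    exact ((ENNReal.mul_left_inj h0 htop).1 h2).symm
  have := hcv (fun x => f x * gw q x) (hf.mul (measurable_gw hqm))
  simp only [hgw, hc, one_mul] at this
  exact this

/-- Exponential moment of the quadratic form. -/
lemma lintegral_exp_half_quadratic {q : E → ℝ} (hqm : Measurable q)
    (hq : ∀ (c : ℝ) x, q (c • x) = c ^ 2 * q x) :
    ∫⁻ x, ENNReal.ofReal (Real.exp (q x / 2)) * gw q x ∂μ ≤
      2 ^ Module.finrank ℝ E * ∫⁻ x, gw q x ∂μ := by
  have hr : Real.sqrt (1 / 2) ≠ 0 := by positivity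
  have hmap := Measure.map_addHaar_smul μ hr
  have hm : Measurable fun x : E => Real.sqrt (1 / 2) • x := by fun_prop
  have h1 : ∀ x, ENNReal.ofReal (Real.exp (q x / 2)) * gw q x =
      gw q (Real.sqrt (1 / 2) • x) := by
    intro x
    rw [gw, gw, ← ENNReal.ofReal_mul (by positivity), ← Real.exp_add, hq,
      Real.sq_sqrt (by norm_num)]
    congr 2; ring
  simp only [h1]
  rw [← lintegral_map (measurable_gw hqm) hm, hmap, lintegral_smul_measure, smul_eq_mul]
  gcongr
  have h2 : |(Real.sqrt (1 / 2) ^ Module.finrank ℝ E)⁻¹| ≤ 2 ^ Module.finrank ℝ E := by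
    rw [abs_of_pos (by positivity), ← inv_pow]
    gcongr
    rw [inv_le_comm₀ (by positivity) (by norm_num)]
    apply Real.le_sqrt_of_sq_le
    norm_num
  calc ENNReal.ofReal _ ≤ ENNReal.ofReal (2 ^ Module.finrank ℝ E) := ENNReal.ofReal_le_ofReal h2
    _ = _ := by rw [ENNReal.ofReal_pow (by norm_num)]; norm_num

end fin

end gauss

end

section

section calculus

lemma lintegral_Ioc_rpow_neg {r : ℝ} (hr1 : r < 1) :
    ∫⁻ t in Set.Ioc (0:ℝ) 1, ENNReal.ofReal (|t| ^ (-r)) ≤ ENNReal.ofReal (1 / (1 - r)) := by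
  have hintg := intervalIntegral.intervalIntegrable_rpow' (a := 0) (b := 1) (r := -r) (by linarith)
  have h1 := integral_rpow (a := 0) (b := 1) (r := -r) (Or.inl (by linarith))
  rw [intervalIntegral.integral_of_le zero_le_one] at h1
  have h2 := ofReal_integral_eq_lintegral_ofReal (μ := volume.restrict (Set.Ioc (0:ℝ) 1))
    ((intervalIntegrable_iff_integrableOn_Ioc_of_le zero_le_one).1 hintg)
    ((ae_restrict_iff' measurableSet_Ioc).2 (Filter.Eventually.of_forall fun x hx =>
      Real.rpow_nonneg hx.1.le _))
  have h3 : ∫⁻ t in Set.Ioc (0:ℝ) 1, ENNReal.ofReal (|t| ^ (-r)) =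
      ∫⁻ t in Set.Ioc (0:ℝ) 1, ENNReal.ofReal (t ^ (-r)) := by
    refine setLIntegral_congr_fun measurableSet_Ioc fun x hx => ?_
    simp only [abs_of_pos hx.1]
  rw [h3, ← h2, h1]
  apply ENNReal.ofReal_le_ofReal
  rw [Real.one_rpow, Real.zero_rpow (by linarith), sub_zero, neg_add_eq_sub]

lemma lintegral_Icc_rpow_neg {r : ℝ} (hr1 : r < 1) :
    ∫⁻ t in Set.Icc (-1:ℝ) 1, ENNReal.ofReal (|t| ^ (-r)) ≤ ENNReal.ofReal (2 / (1 - r)) := by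
  have hm : Measurable fun t : ℝ => ENNReal.ofReal (|t| ^ (-r)) := by fun_prop
  have hneg : ∫⁻ t in Set.Ico (-1:ℝ) 0, ENNReal.ofReal (|t| ^ (-r)) =
      ∫⁻ t in Set.Ioc (0:ℝ) 1, ENNReal.ofReal (|t| ^ (-r)) := by
    rw [← lintegral_indicator measurableSet_Ico, ← lintegral_indicator measurableSet_Ioc,
      ← lintegral_neg_eq_self]
    refine lintegral_congr fun x => ?_
    simp only [Set.indicator, abs_neg, Set.mem_Ico, Set.mem_Ioc]
    congr 1
    rw [eq_iff_iff]
    constructor <;> rintro ⟨h1, h2⟩ <;> constructor <;> linarith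
  have hsub : Set.Icc (-1:ℝ) 1 = (Set.Ico (-1:ℝ) 0 ∪ {0}) ∪ Set.Ioc 0 1 := by
    ext x
    simp only [Set.mem_Icc, Set.mem_union, Set.mem_Ico, Set.mem_singleton_iff, Set.mem_Ioc]
    constructor
    · rintro ⟨h1, h2⟩
      rcases lt_trichotomy x 0 with h | h | h
      · exact Or.inl (Or.inl ⟨h1, h⟩)
      · exact Or.inl (Or.inr h)
      · exact Or.inr ⟨h, h2⟩
    · rintro ((⟨h1, h2⟩ | rfl) | ⟨h1, h2⟩) <;> constructor <;> linarith
  rw [hsub]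
  refine (lintegral_union_le _ _ _).trans ?_
  refine (add_le_add_left (lintegral_union_le _ _ _) _).trans ?_
  rw [hneg]
  have h0 : ∫⁻ t in ({0} : Set ℝ), ENNReal.ofReal (|t| ^ (-r)) = 0 := by simp
  rw [h0, add_zero]
  refine (add_le_add (lintegral_Ioc_rpow_neg hr1) (lintegral_Ioc_rpow_neg hr1)).trans ?_
  have : 0 < 1 - r := by linarith
  rw [← ENNReal.ofReal_add (by positivity) (by positivity)]
  apply le_of_eq; congr 1; ring

/-- Uniform integrability of a negative power of the distance to a point. -/
lemma lintegral_abs_sub_rpow_neg {r : ℝ} (hr0 : 0 < r) (hr1 : r < 1) (a : ℝ) :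
    ∫⁻ t in Set.Icc (-1:ℝ) 1, ENNReal.ofReal (|t - a| ^ (-r)) ≤
      ENNReal.ofReal (2 + 2 / (1 - r)) := by
  have hle : ∀ t : ℝ, (Set.Icc (-1:ℝ) 1).indicator (fun t => ENNReal.ofReal (|t - a| ^ (-r))) t ≤
      (Set.Icc (-1:ℝ) 1).indicator 1 t +
        (Set.Icc (-1:ℝ) 1).indicator (fun t => ENNReal.ofReal (|t| ^ (-r))) (t - a) := by
    intro t
    by_cases ht : t ∈ Set.Icc (-1:ℝ) 1
    · simp only [Set.indicator_of_mem ht, Pi.one_apply]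
      by_cases hta : t - a ∈ Set.Icc (-1:ℝ) 1
      · rw [Set.indicator_of_mem hta]
        exact le_add_of_nonneg_left (by simp)
      · refine le_add_of_le_of_nonneg ?_ (by simp)
        rw [ENNReal.ofReal_le_one]
        apply Real.rpow_le_one_of_one_le_of_nonpos _ (by linarith)
        rw [Set.mem_Icc, ← abs_le] at hta
        linarith
    · simp [Set.indicator_of_notMem ht]
  have : 0 < 1 - r := by linarith
  rw [← lintegral_indicator measurableSet_Icc]
  refine (lintegral_mono hle).trans ?_
  rw [lintegral_add_left (measurable_one.indicator measurableSet_Icc),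
    lintegral_indicator_one measurableSet_Icc, Real.volume_Icc]
  rw [lintegral_sub_right_eq_self (μ := volume)
    (fun t : ℝ => (Set.Icc (-1:ℝ) 1).indicator (fun t => ENNReal.ofReal (|t| ^ (-r))) t),
    lintegral_indicator measurableSet_Icc]
  rw [ENNReal.ofReal_add (by norm_num) (by positivity)]
  exact add_le_add (by norm_num) (lintegral_Icc_rpow_neg hr1)

/-- `√‖c‖` as an extended nonnegative real. -/
def sqn (c : ℂ) : ℝ≥0∞ := ENNReal.ofReal (Real.sqrt ‖c‖)

@[fun_prop] lemma measurable_sqn : Measurable sqn := by unfold sqn; fun_prop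

lemma sqrt_add_le_add_sqrt {a b : ℝ} (ha : 0 ≤ a) (hb : 0 ≤ b) :
    Real.sqrt (a + b) ≤ Real.sqrt a + Real.sqrt b := by
  rw [Real.sqrt_le_left (by positivity)]
  nlinarith [Real.sq_sqrt ha, Real.sq_sqrt hb, Real.sqrt_nonneg a, Real.sqrt_nonneg b,
    mul_nonneg (Real.sqrt_nonneg a) (Real.sqrt_nonneg b)]

lemma sqn_add_le (a b : ℂ) : sqn (a + b) ≤ sqn a + sqn b := by
  unfold sqn
  rw [← ENNReal.ofReal_add (by positivity) (by positivity)]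
  apply ENNReal.ofReal_le_ofReal
  exact (Real.sqrt_le_sqrt (norm_add_le a b)).trans
    (sqrt_add_le_add_sqrt (norm_nonneg _) (norm_nonneg _))

lemma sqn_mul (a b : ℂ) : sqn (a * b) = sqn a * sqn b := by
  unfold sqn
  rw [← ENNReal.ofReal_mul (by positivity), norm_mul, Real.sqrt_mul (norm_nonneg _)]

lemma sqn_zero : sqn 0 = 0 := by simp [sqn]

lemma lintegral_sqn_inv_sub (w : ℂ) :
    ∫⁻ t in Set.Icc (-1:ℝ) 1, sqn (1 / ((t : ℂ) - w)) ≤ 6 := by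
  have h := lintegral_abs_sub_rpow_neg (r := 1 / 2) (by norm_num) (by norm_num) w.re
  have h6 : ENNReal.ofReal (2 + 2 / (1 - 1 / 2)) = 6 := by norm_num
  rw [h6] at h
  refine le_trans (lintegral_mono_ae ?_) h
  have hne : ∀ᵐ t : ℝ ∂(volume.restrict (Set.Icc (-1:ℝ) 1)), t ≠ w.re :=
    Measure.ae_ne _ _
  filter_upwards [hne] with t ht
  unfold sqn
  apply ENNReal.ofReal_le_ofReal
  have hpos : 0 < |t - w.re| := abs_pos.2 (sub_ne_zero.2 ht)
  have h1 : |t - w.re| ≤ ‖(t : ℂ) - w‖ := by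
    have := Complex.abs_re_le_norm ((t : ℂ) - w)
    simpa using this
  rw [Real.sqrt_eq_rpow, Real.rpow_neg hpos.le, ← Real.inv_rpow hpos.le]
  apply Real.rpow_le_rpow (norm_nonneg _) _ (by norm_num)
  rw [norm_div, norm_one, one_div]
  exact inv_anti₀ hpos h1

lemma lintegral_sqn_logDeriv (p : Polynomial ℂ) :
    ∫⁻ t in Set.Icc (-1:ℝ) 1, sqn ((Polynomial.derivative p).eval (t : ℂ) / p.eval (t : ℂ)) ≤
      6 * p.natDegree := by
  have hs : ∀ s : Multiset ℂ, ∫⁻ t in Set.Icc (-1:ℝ) 1,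
      (s.map (fun z => sqn (1 / ((t : ℂ) - z)))).sum ≤ 6 * Multiset.card s := by
    intro s
    induction s using Multiset.induction_on with
    | empty => simp
    | cons a s ih =>
      simp only [Multiset.map_cons, Multiset.sum_cons, Multiset.card_cons]
      rw [lintegral_add_left (by fun_prop)]
      push_cast
      rw [mul_add, mul_one, add_comm]
      exact add_le_add ih (lintegral_sqn_inv_sub a)
  refine le_trans (lintegral_mono fun t => ?_) ((hs p.roots).trans ?_)
  · by_cases h0 : p.eval (t : ℂ) = 0
    · simp [h0, sqn]
    · rw [(IsAlgClosed.splits p).eval_derivative_div_eval_of_ne_zero h0]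
      refine (Multiset.le_sum_of_subadditive sqn sqn_zero.le sqn_add_le _).trans ?_
      rw [Multiset.map_map]
      rfl
  · gcongr
    exact Polynomial.card_roots' p

end calculus

end

section

section ranktwo

variable {ι : Type*} [Fintype ι] [DecidableEq ι]

lemma det_one_add_two_vecMulVec (x a y b : ι → ℂ) :
    (1 + (vecMulVec x a + vecMulVec y b)).det =
      (1 + a ⬝ᵥ x) * (1 + b ⬝ᵥ y) - (a ⬝ᵥ y) * (b ⬝ᵥ x) := by
  let U : Matrix ι (Fin 2) ℂ := Matrix.of fun i k => ![x i, y i] k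
  let V : Matrix (Fin 2) ι ℂ := Matrix.of ![a, b]
  have h : vecMulVec x a + vecMulVec y b = U * V := by
    ext i j
    simp [U, V, Matrix.mul_apply, Fin.sum_univ_two, vecMulVec_apply]
  have e00 : (V * U) 0 0 = a ⬝ᵥ x := by simp only [Matrix.mul_apply, dotProduct]; rfl
  have e01 : (V * U) 0 1 = a ⬝ᵥ y := by simp only [Matrix.mul_apply, dotProduct]; rfl
  have e10 : (V * U) 1 0 = b ⬝ᵥ x := by simp only [Matrix.mul_apply, dotProduct]; rfl
  have e11 : (V * U) 1 1 = b ⬝ᵥ y := by simp only [Matrix.mul_apply, dotProduct]; rfl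
  rw [h, det_one_add_mul_comm, det_fin_two]
  simp [Matrix.add_apply, e00, e01, e10, e11]

lemma det_add_two_vecMulVec {M : Matrix ι ι ℂ} (hM : IsUnit M.det) (x a y b : ι → ℂ) :
    (M + (vecMulVec x a + vecMulVec y b)).det = M.det *
      ((1 + a ⬝ᵥ M⁻¹ *ᵥ x) * (1 + b ⬝ᵥ M⁻¹ *ᵥ y) - (a ⬝ᵥ M⁻¹ *ᵥ y) * (b ⬝ᵥ M⁻¹ *ᵥ x)) := by
  have h : M + (vecMulVec x a + vecMulVec y b) =
      M * (1 + (vecMulVec (M⁻¹ *ᵥ x) a + vecMulVec (M⁻¹ *ᵥ y) b)) := by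
    rw [mul_add, mul_one, ← mul_vecMulVec, ← mul_vecMulVec, ← mul_add, ← mul_assoc,
      mul_nonsing_inv M hM, one_mul]
  rw [h, det_mul, det_one_add_two_vecMulVec]

/-- Projection of a matrix onto its part touching the direction `φ`. -/
def pm (φ : ι → ℂ) (V : Matrix ι ι ℂ) : Matrix ι ι ℂ :=
  vecMulVec φ (star φ) * V + V * vecMulVec φ (star φ) -
    vecMulVec φ (star φ) * V * vecMulVec φ (star φ)

lemma pm_eq {ι : Type*} [Fintype ι] (φ : ι → ℂ) (V : Matrix ι ι ℂ) :
    pm φ V = vecMulVec φ (star φ ᵥ* V - (star φ ⬝ᵥ V *ᵥ φ) • star φ) +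
      vecMulVec (V *ᵥ φ) (star φ) := by
  unfold pm
  rw [vecMulVec_mul, mul_vecMulVec, vecMulVec_mul_vecMulVec, vecMulVec_sub,
    dotProduct_mulVec]
  abel

lemma pm_add (φ : ι → ℂ) (V V' : Matrix ι ι ℂ) : pm φ (V + V') = pm φ V + pm φ V' := by
  simp only [pm, mul_add, add_mul]; abel

lemma pm_real_smul (φ : ι → ℂ) (c : ℝ) (V : Matrix ι ι ℂ) : pm φ (c • V) = c • pm φ V := by
  simp only [pm, mul_smul_comm, smul_mul_assoc, smul_add, smul_sub]

lemma vecMulVec_star_isHermitian {ι : Type*} (φ : ι → ℂ) : (vecMulVec φ (star φ)).IsHermitian := by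
  ext i j
  simp [conjTranspose_apply, vecMulVec_apply, mul_comm]

lemma pm_conjTranspose {ι : Type*} [Fintype ι] (φ : ι → ℂ) (V : Matrix ι ι ℂ) :
    (pm φ V)ᴴ = pm φ Vᴴ := by
  unfold pm
  rw [conjTranspose_sub, conjTranspose_add, conjTranspose_mul, conjTranspose_mul,
    conjTranspose_mul, conjTranspose_mul, (vecMulVec_star_isHermitian φ).eq, mul_assoc]
  abel

lemma pm_isHermitian {ι : Type*} [Fintype ι] (φ : ι → ℂ) {V : Matrix ι ι ℂ}
    (hV : V.IsHermitian) :
    (pm φ V).IsHermitian := by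
  rw [IsHermitian, pm_conjTranspose, hV.eq]

lemma proj_mul_proj {ι : Type*} [Fintype ι] {φ : ι → ℂ} (hφ : star φ ⬝ᵥ φ = 1) :
    vecMulVec φ (star φ) * vecMulVec φ (star φ) = vecMulVec φ (star φ) := by
  rw [vecMulVec_mul_vecMulVec, hφ, one_smul]

lemma pm_pm {φ : ι → ℂ} (hφ : star φ ⬝ᵥ φ = 1) (V : Matrix ι ι ℂ) :
    pm φ (pm φ V) = pm φ V := by
  have h := proj_mul_proj hφ
  unfold pm
  set P := vecMulVec φ (star φ)
  have h1 : ∀ X : Matrix ι ι ℂ, P * (P * X) = P * X := fun X => by rw [← mul_assoc, h]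
  simp only [mul_add, mul_sub, add_mul, sub_mul, mul_assoc, h, h1]
  abel

lemma trace_pm_mul (φ : ι → ℂ) (V N : Matrix ι ι ℂ) :
    trace (pm φ V * N) = trace (V * pm φ N) := by
  unfold pm
  set P := vecMulVec φ (star φ)
  simp only [mul_add, mul_sub, add_mul, sub_mul, trace_add, trace_sub, mul_assoc]
  rw [trace_mul_comm P (V * N), trace_mul_comm P (V * (P * N))]
  simp only [mul_assoc]
  ring

lemma finr_pm_left (φ : ι → ℂ) (V N : Matrix ι ι ℂ) : finr (pm φ V) N = finr V (pm φ N) := by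
  rw [← trace_mul_conjTranspose_re, trace_pm_mul, ← pm_conjTranspose, trace_mul_conjTranspose_re]

/-- The determinant along the two-parameter family `M + u·P(V) + v·P(V')` is quadratic. -/
lemma det_add_pm_quadratic {M : Matrix ι ι ℂ} (hM : IsUnit M.det) (φ : ι → ℂ)
    (V V' : Matrix ι ι ℂ) : ∃ α β A B C : ℂ, ∀ u v : ℂ,
      (M + (u • pm φ V + v • pm φ V')).det =
        M.det * (1 + α * u + β * v + A * u ^ 2 + B * (u * v) + C * v ^ 2) := by
  set a := star φ ᵥ* V - (star φ ⬝ᵥ V *ᵥ φ) • star φ with ha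
  set a' := star φ ᵥ* V' - (star φ ⬝ᵥ V' *ᵥ φ) • star φ with ha'
  set b := V *ᵥ φ with hb
  set b' := V' *ᵥ φ with hb'
  set R := M⁻¹
  have key : ∀ u v : ℂ, (M + (u • pm φ V + v • pm φ V')).det = M.det *
      ((1 + (u * (a ⬝ᵥ R *ᵥ φ) + v * (a' ⬝ᵥ R *ᵥ φ))) *
        (1 + (u * (star φ ⬝ᵥ R *ᵥ b) + v * (star φ ⬝ᵥ R *ᵥ b'))) -
       (u * (u * (a ⬝ᵥ R *ᵥ b)) + u * (v * (a ⬝ᵥ R *ᵥ b')) + v * (u * (a' ⬝ᵥ R *ᵥ b)) +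
        v * (v * (a' ⬝ᵥ R *ᵥ b'))) * (star φ ⬝ᵥ R *ᵥ φ)) := by
    intro u v
    have h1 : u • pm φ V + v • pm φ V' =
        vecMulVec φ (u • a + v • a') + vecMulVec (u • b + v • b') (star φ) := by
      rw [pm_eq, pm_eq, vecMulVec_add, add_vecMulVec, vecMulVec_smul, vecMulVec_smul,
        smul_vecMulVec, smul_vecMulVec, smul_add, smul_add]
      abel
    rw [h1, det_add_two_vecMulVec hM]
    simp only [mulVec_add, mulVec_smul, dotProduct_add, add_dotProduct, dotProduct_smul,
      smul_dotProduct, smul_eq_mul]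
    ring
  refine ⟨a ⬝ᵥ R *ᵥ φ + star φ ⬝ᵥ R *ᵥ b, a' ⬝ᵥ R *ᵥ φ + star φ ⬝ᵥ R *ᵥ b',
    (a ⬝ᵥ R *ᵥ φ) * (star φ ⬝ᵥ R *ᵥ b) - (a ⬝ᵥ R *ᵥ b) * (star φ ⬝ᵥ R *ᵥ φ),
    (a ⬝ᵥ R *ᵥ φ) * (star φ ⬝ᵥ R *ᵥ b') + (a' ⬝ᵥ R *ᵥ φ) * (star φ ⬝ᵥ R *ᵥ b) -
      (a ⬝ᵥ R *ᵥ b' + a' ⬝ᵥ R *ᵥ b) * (star φ ⬝ᵥ R *ᵥ φ),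
    (a' ⬝ᵥ R *ᵥ φ) * (star φ ⬝ᵥ R *ᵥ b') - (a' ⬝ᵥ R *ᵥ b') * (star φ ⬝ᵥ R *ᵥ φ), ?_⟩
  intro u v
  rw [key]
  ring

/-- First-order coefficient of a determinant. -/
lemma trace_inv_mul_of_det_quadratic {M K : Matrix ι ι ℂ} {f₀ f₁ f₂ : ℂ} (hM : IsUnit M.det)
    (h : ∀ ε : ℂ, (M + ε • K).det = f₀ + f₁ * ε + f₂ * ε ^ 2) :
    f₀ = M.det ∧ f₁ = M.det * trace (M⁻¹ * K) := by
  have h0 : f₀ = M.det := by have := h 0; simpa using this.symm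
  refine ⟨h0, ?_⟩
  set N := M⁻¹ * K
  have h1 : ∀ ε : ℂ, M + ε • K = M * (1 + ε • N) := by
    intro ε
    rw [mul_add, mul_one, mul_smul_comm, ← mul_assoc, mul_nonsing_inv M hM, one_mul]
  have hpoly : Polynomial.C f₀ + Polynomial.C f₁ * Polynomial.X + Polynomial.C f₂ * Polynomial.X ^ 2 =
      Polynomial.C M.det * (1 + (Polynomial.X : Polynomial ℂ) • N.map Polynomial.C).det := by
    refine Polynomial.funext fun ε => ?_
    have h2 := h ε
    rw [h1, det_mul] at h2
    simp only [Polynomial.eval_add, Polynomial.eval_mul, Polynomial.eval_C, Polynomial.eval_X,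
      Polynomial.eval_pow]
    rw [← h2]
    congr 1
    rw [← Polynomial.coe_evalRingHom, RingHom.map_det]
    congr 1
    ext i j
    by_cases hij : i = j <;> simp [hij] <;> ring
  have h2 := congrArg (fun p => Polynomial.eval 0 (Polynomial.derivative p)) hpoly
  have h3 : Polynomial.eval 0 (Polynomial.derivative (Polynomial.C f₀ +
      Polynomial.C f₁ * Polynomial.X + Polynomial.C f₂ * Polynomial.X ^ 2)) = f₁ := by
    simp
  have h4 : Polynomial.eval 0 (Polynomial.derivative (Polynomial.C M.det *
      (1 + (Polynomial.X : Polynomial ℂ) • N.map Polynomial.C).det)) = M.det * trace N := by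
    rw [Polynomial.derivative_C_mul, Polynomial.eval_mul, Polynomial.eval_C,
      derivative_det_one_add_X_smul]
  exact h3.symm.trans (h2.trans h4)

end ranktwo

end

section

section rotation

variable {ι : Type*} [Fintype ι] [DecidableEq ι]

lemma volume_det_add_smul_one_eq_zero (M : Matrix ι ι ℂ) :
    volume {t : ℝ | (M + t • (1 : Matrix ι ι ℂ)).det = 0} = 0 := by
  refine Set.Finite.measure_zero ?_ _
  have hfin : {w : ℂ | (-M).charpoly.IsRoot w}.Finite :=
    Polynomial.finite_setOfPred_isRoot (charpoly_monic _).ne_zero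
  refine Set.Finite.subset (hfin.preimage (f := fun t : ℝ => (t : ℂ))
    Complex.ofReal_injective.injOn) ?_
  intro t ht
  change (M + t • (1 : Matrix ι ι ℂ)).det = 0 at ht
  change (-M).charpoly.eval (t : ℂ) = 0
  rw [eval_charpoly, ← ht]
  congr 1
  ext i j
  by_cases hij : i = j
  · subst hij; simp; ring
  · simp [hij]

lemma sqn_trace_rotation {M : Matrix ι ι ℂ} (hM : IsUnit M.det) (φ : ι → ℂ)
    (V V' : Matrix ι ι ℂ) :
    ∫⁻ t in Set.Icc (-1 : ℝ) 1,
      sqn (trace ((M + (((1 - t ^ 2) / (1 + t ^ 2) - 1 : ℝ) • pm φ V +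
        (2 * t / (1 + t ^ 2) : ℝ) • pm φ V'))⁻¹ *
        (((1 - t ^ 2) / (1 + t ^ 2) : ℝ) • pm φ V' - (2 * t / (1 + t ^ 2) : ℝ) • pm φ V)))
      ≤ 28 := by
  obtain ⟨α, β, A, B, C, h⟩ := det_add_pm_quadratic hM φ V V'
  set P : Polynomial ℂ := Polynomial.C (1 - 2 * α + 4 * A) * Polynomial.X ^ 4 +
    Polynomial.C (2 * β - 4 * B) * Polynomial.X ^ 3 +
    Polynomial.C (2 - 2 * α + 4 * C) * Polynomial.X ^ 2 +
    Polynomial.C (2 * β) * Polynomial.X + Polynomial.C 1 with hP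
  have hdeg : P.natDegree ≤ 4 := by rw [hP]; compute_degree
  have hev : ∀ t : ℂ, P.eval t = (1 - 2 * α + 4 * A) * t ^ 4 + (2 * β - 4 * B) * t ^ 3 +
      (2 - 2 * α + 4 * C) * t ^ 2 + 2 * β * t + 1 := by
    intro t; simp [hP]
  have hev' : ∀ t : ℂ, (Polynomial.derivative P).eval t = (1 - 2 * α + 4 * A) * (4 * t ^ 3) +
      (2 * β - 4 * B) * (3 * t ^ 2) + (2 - 2 * α + 4 * C) * (2 * t) + 2 * β := by
    intro t
    simp only [hP, Polynomial.derivative_add, Polynomial.derivative_C_mul,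
      Polynomial.derivative_X_pow, Polynomial.derivative_X, Polynomial.derivative_C,
      Polynomial.eval_add, Polynomial.eval_mul, Polynomial.eval_C, Polynomial.eval_pow,
      Polynomial.eval_X, Polynomial.eval_one, Polynomial.eval_zero]
    push_cast
    ring
  have hpt : ∀ t ∈ Set.Icc (-1 : ℝ) 1,
      sqn (trace ((M + (((1 - t ^ 2) / (1 + t ^ 2) - 1 : ℝ) • pm φ V +
        (2 * t / (1 + t ^ 2) : ℝ) • pm φ V'))⁻¹ *
        (((1 - t ^ 2) / (1 + t ^ 2) : ℝ) • pm φ V' - (2 * t / (1 + t ^ 2) : ℝ) • pm φ V)))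
      ≤ sqn ((Polynomial.derivative P).eval (t : ℂ) / P.eval (t : ℂ)) + 2 := by
    intro t ht
    set c : ℝ := (1 - t ^ 2) / (1 + t ^ 2) with hc
    set s : ℝ := 2 * t / (1 + t ^ 2) with hs
    have h1 : (1 + (t : ℂ) ^ 2) ≠ 0 := by
      have : (1 + t ^ 2 : ℝ) ≠ 0 := by positivity
      exact_mod_cast this
    set Mt := M + ((c - 1) • pm φ V + s • pm φ V') with hMt
    by_cases hdet : IsUnit Mt.det
    swap
    · rw [nonsing_inv_apply_not_isUnit _ hdet, zero_mul, trace_zero, sqn_zero]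
      exact zero_le
    have hq := trace_inv_mul_of_det_quadratic (K := c • pm φ V' - s • pm φ V) hdet
      (f₀ := M.det * (1 + α * (c - 1) + β * s + A * (c - 1) ^ 2 + B * ((c - 1) * s) + C * s ^ 2))
      (f₁ := M.det * (α * (-s) + β * c + 2 * A * (c - 1) * (-s) + B * ((c - 1) * c - s * s) +
        2 * C * s * c))
      (f₂ := M.det * (A * s ^ 2 - B * (s * c) + C * c ^ 2)) (by
        intro ε
        have e : Mt + ε • (c • pm φ V' - s • pm φ V) =
            M + (((c : ℂ) - 1 - ε * s) • pm φ V + ((s : ℂ) + ε * c) • pm φ V') := by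
          ext i j
          simp [hMt, Matrix.add_apply, Matrix.smul_apply, Matrix.sub_apply]
          ring
        rw [e, h]
        ring)
    obtain ⟨hq0, hq1⟩ := hq
    set p0 : ℂ := 1 + α * (c - 1) + β * s + A * (c - 1) ^ 2 + B * ((c - 1) * s) + C * s ^ 2
      with hp0
    set p1 : ℂ := α * (-s) + β * c + 2 * A * (c - 1) * (-s) + B * ((c - 1) * c - s * s) +
        2 * C * s * c with hp1
    have hM0 : M.det ≠ 0 := hM.ne_zero
    have hp0ne : p0 ≠ 0 := by
      intro h0
      rw [h0, mul_zero] at hq0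
      exact hdet.ne_zero hq0.symm
    have htr : trace (Mt⁻¹ * (c • pm φ V' - s • pm φ V)) = p1 / p0 := by
      rw [← hq0] at hq1
      rw [eq_div_iff hp0ne]
      apply mul_left_cancel₀ hM0
      rw [hq1]; ring
    have hcC : (c : ℂ) = (1 - (t : ℂ) ^ 2) / (1 + (t : ℂ) ^ 2) := by rw [hc]; push_cast; rfl
    have hsC : (s : ℂ) = 2 * (t : ℂ) / (1 + (t : ℂ) ^ 2) := by rw [hs]; push_cast; rfl
    have hPp : P.eval (t : ℂ) = (1 + (t : ℂ) ^ 2) ^ 2 * p0 := by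
      rw [hev, hp0, hcC, hsC]; field_simp; ring
    have hPne : P.eval (t : ℂ) ≠ 0 := by rw [hPp]; positivity
    have hid : p1 / p0 = ((1 + t ^ 2) / 2 : ℝ) *
        ((Polynomial.derivative P).eval (t : ℂ) / P.eval (t : ℂ)) + (-(2 * t) : ℝ) := by
      have h2 : p1 * (1 + (t : ℂ) ^ 2) ^ 2 * 2 =
          (1 + (t : ℂ) ^ 2) * (Polynomial.derivative P).eval (t : ℂ) -
            4 * t * P.eval (t : ℂ) := by
        rw [hev, hev', hp1, hcC, hsC]; field_simp; ring
      have h3 : p0 = P.eval (t : ℂ) / (1 + (t : ℂ) ^ 2) ^ 2 := by rw [hPp]; field_simp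
      rw [h3]
      push_cast
      field_simp
      linear_combination h2
    rw [htr, hid]
    refine (sqn_add_le _ _).trans (add_le_add ?_ ?_)
    · rw [sqn_mul]
      have : sqn (((1 + t ^ 2) / 2 : ℝ) : ℂ) ≤ 1 := by
        unfold sqn
        rw [Complex.norm_real, Real.norm_eq_abs, abs_of_nonneg (by positivity)]
        refine ENNReal.ofReal_le_one.2 (Real.sqrt_le_one.2 ?_)
        nlinarith [ht.1, ht.2]
      calc _ ≤ 1 * sqn _ := mul_le_mul_left this _
        _ = _ := one_mul _
    · unfold sqn
      rw [Complex.norm_real, Real.norm_eq_abs]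
      have : Real.sqrt |-(2 * t)| ≤ 2 := by
        rw [Real.sqrt_le_left (by norm_num)]
        rw [abs_neg, abs_le]; constructor <;> nlinarith [ht.1, ht.2]
      calc _ ≤ ENNReal.ofReal 2 := ENNReal.ofReal_le_ofReal this
        _ = 2 := by norm_num
  refine (setLIntegral_mono' measurableSet_Icc hpt).trans ?_
  rw [lintegral_add_right _ measurable_const]
  refine (add_le_add (lintegral_sqn_logDeriv P) le_rfl).trans ?_
  simp only [lintegral_const, Measure.restrict_apply_univ, Real.volume_Icc]
  have : ENNReal.ofReal (1 - (-1)) = 2 := by norm_num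
  rw [this]
  have h4 : (P.natDegree : ℝ≥0∞) ≤ 4 := by exact_mod_cast hdeg
  calc _ ≤ 6 * 4 + 2 * 2 := add_le_add (mul_le_mul_right h4 _) le_rfl
    _ = (28 : ℝ≥0∞) := by norm_num

end rotation

end

section

variable {W : ℕ}

/-- Gaussian weight of a diagonal block. -/
def gH (W : ℕ) (x : HermParam W) : ℝ≥0∞ := gw (fun x => (W : ℝ) * hq x) x

/-- Gaussian weight of an off-diagonal block. -/
def gM (W : ℕ) (T : MatP W) : ℝ≥0∞ := gw (fun T => (W : ℝ) * mq T) T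

/-- Normalization of the weight of a diagonal block. -/
def ZH (W : ℕ) : ℝ≥0∞ := ∫⁻ x : HermParam W, gH W x

/-- Normalization of the weight of an off-diagonal block. -/
def ZM (W : ℕ) : ℝ≥0∞ := ∫⁻ T : MatP W, gM W T

@[fun_prop] lemma measurable_gH : Measurable (gH W) := by unfold gH; fun_prop
@[fun_prop] lemma measurable_gM : Measurable (gM W) := by unfold gM; fun_prop

lemma gH_ne_top (x : HermParam W) : gH W x ≠ ∞ := gw_ne_top _ _
instance neZeroHermParam : NeZero (volume : Measure (HermParam W)) :=
  ⟨fun h => isOpen_univ.measure_ne_zero volume Set.univ_nonempty (by rw [h]; rfl)⟩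

instance neZeroMatP : NeZero (volume : Measure (MatP W)) :=
  ⟨fun h => isOpen_univ.measure_ne_zero volume Set.univ_nonempty (by rw [h]; rfl)⟩

lemma ZH_ne_zero : ZH W ≠ 0 := by
  unfold ZH
  rw [Ne, lintegral_eq_zero_iff measurable_gH]
  intro h
  obtain ⟨x, hx⟩ := h.exists
  exact gw_pos _ _ hx

lemma ZM_ne_zero : ZM W ≠ 0 := by
  unfold ZM
  rw [Ne, lintegral_eq_zero_iff measurable_gM]
  intro h
  obtain ⟨x, hx⟩ := h.exists
  exact gw_pos _ _ hx

/-- Real inner product of Hermitian parameters. -/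
def hin (x y : HermParam W) : ℝ := finr (toHerm x) (toHerm y)

lemma hq_add (x y : HermParam W) : hq (x + y) = hq x + hq y + 2 * hin x y := by
  simp only [hq, hin, toHerm_add, fsq_add]

lemma hq_sub (x y : HermParam W) : hq (x - y) = hq x + hq y - 2 * hin x y := by
  simp only [hq, hin, toHerm_sub, fsq_sub]

lemma hq_smul (c : ℝ) (x : HermParam W) : hq (c • x) = c ^ 2 * hq x := by
  simp only [hq, toHerm_smul, fsq_real_smul]

lemma hin_comm (x y : HermParam W) : hin x y = hin y x := finr_comm _ _

lemma hin_smul_left (c : ℝ) (x y : HermParam W) : hin (c • x) y = c * hin x y := by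
  simp only [hin, toHerm_smul, finr_smul_left]

lemma hin_smul_right (c : ℝ) (x y : HermParam W) : hin x (c • y) = c * hin x y := by
  simp only [hin, toHerm_smul, finr_smul_right]

lemma hin_add_right (x y y' : HermParam W) : hin x (y + y') = hin x y + hin x y' := by
  simp only [hin, toHerm_add, finr_add_right]

lemma hin_self (x : HermParam W) : hin x x = hq x := finr_self _

lemma toHerm_injective : Function.Injective (toHerm : HermParam W → Mat W) :=
  Function.LeftInverse.injective fromHerm_toHerm

lemma hq_eq_zero {x : HermParam W} : hq x = 0 ↔ x = 0 := by
  rw [hq, fsq_eq_zero, ← toHerm_zero, toHerm_injective.eq_iff]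

/-- Parameter version of `pm`. -/
def hp (φ : Fin W → ℂ) (x : HermParam W) : HermParam W := fromHerm (pm φ (toHerm x))

lemma toHerm_hp (φ : Fin W → ℂ) (x : HermParam W) : toHerm (hp φ x) = pm φ (toHerm x) :=
  toHerm_fromHerm (pm_isHermitian φ (toHerm_isHermitian x))

lemma hp_add (φ : Fin W → ℂ) (x y : HermParam W) : hp φ (x + y) = hp φ x + hp φ y := by
  simp only [hp, toHerm_add, pm_add, fromHerm_add]

lemma hp_smul (φ : Fin W → ℂ) (c : ℝ) (x : HermParam W) : hp φ (c • x) = c • hp φ x := by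
  simp only [hp, toHerm_smul, pm_real_smul, fromHerm_real_smul]

lemma hp_hp {φ : Fin W → ℂ} (hφ : star φ ⬝ᵥ φ = 1) (x : HermParam W) :
    hp φ (hp φ x) = hp φ x := by
  rw [hp, toHerm_hp, pm_pm hφ]; rfl

lemma hin_hp_left (φ : Fin W → ℂ) (x y : HermParam W) : hin (hp φ x) y = hin x (hp φ y) := by
  simp only [hin, toHerm_hp, finr_pm_left]

@[fun_prop] lemma continuous_hp (φ : Fin W → ℂ) : Continuous (hp φ) := by
  have h : Continuous (pm φ) := by unfold pm; fun_prop
  exact continuous_fromHerm.comp (h.comp continuous_toHerm)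

@[fun_prop] lemma measurable_hp (φ : Fin W → ℂ) : Measurable (hp φ) :=
  (continuous_hp φ).measurable

/-- Rotation of a pair of Hermitian matrices in the range of `pm φ`. -/
def rot (φ : Fin W → ℂ) (c s : ℝ) :
    (HermParam W × HermParam W) →ₗ[ℝ] (HermParam W × HermParam W) where
  toFun p := (p.1 + ((c - 1) • hp φ p.1 + s • hp φ p.2),
    p.2 + ((c - 1) • hp φ p.2 - s • hp φ p.1))
  map_add' p q := by
    simp only [Prod.fst_add, Prod.snd_add, hp_add, smul_add, Prod.mk_add_mk, Prod.mk.injEq]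
    constructor <;> abel
  map_smul' r p := by
    simp only [Prod.smul_fst, Prod.smul_snd, hp_smul, RingHom.id_apply, Prod.smul_mk, smul_add,
      smul_sub, smul_comm r]

lemma hq_rot {φ : Fin W → ℂ} (hφ : star φ ⬝ᵥ φ = 1) {c s : ℝ} (hcs : c ^ 2 + s ^ 2 = 1)
    (p : HermParam W × HermParam W) :
    hq (rot φ c s p).1 + hq (rot φ c s p).2 = hq p.1 + hq p.2 := by
  obtain ⟨x, y⟩ := p
  have h1 : ∀ x y : HermParam W, hin x (hp φ y) = hin (hp φ x) (hp φ y) := fun x y => by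
    rw [hin_hp_left, hp_hp hφ]
  have e1 : (c - 1) • hp φ y - s • hp φ x = (c - 1) • hp φ y + (-s) • hp φ x := by
    rw [neg_smul, sub_eq_add_neg]
  simp only [rot, LinearMap.coe_mk, AddHom.coe_mk, e1, hq_add, hq_smul, hin_smul_left,
    hin_smul_right, hin_add_right, h1 x, h1 y, hin_self]
  rw [hin_comm (hp φ y) (hp φ x)]
  linear_combination (hq (hp φ x) + hq (hp φ y)) * hcs

lemma rot_injective {φ : Fin W → ℂ} (hφ : star φ ⬝ᵥ φ = 1) {c s : ℝ}
    (hcs : c ^ 2 + s ^ 2 = 1) : Function.Injective (rot φ c s) := by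
  rw [injective_iff_map_eq_zero]
  intro p hp0
  have h := hq_rot hφ hcs p
  rw [hp0] at h
  have h0 : hq (0 : HermParam W) = 0 := hq_eq_zero.2 rfl
  simp only [Prod.fst_zero, Prod.snd_zero, h0] at h
  have h1 := hq_nonneg p.1
  have h2 := hq_nonneg p.2
  exact Prod.ext (hq_eq_zero.1 (by linarith)) (hq_eq_zero.1 (by linarith))

lemma toHerm_rot_fst (φ : Fin W → ℂ) (c s : ℝ) (p : HermParam W × HermParam W)
    (a : HermParam W) : toHerm ((rot φ c s p).1 - a) =
      toHerm (p.1 - a) + ((c - 1) • pm φ (toHerm p.1) + s • pm φ (toHerm p.2)) := by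
  simp only [rot, LinearMap.coe_mk, AddHom.coe_mk]
  rw [add_sub_right_comm]
  simp only [toHerm_add, toHerm_smul, toHerm_hp]

lemma pm_toHerm_rot_snd {φ : Fin W → ℂ} (hφ : star φ ⬝ᵥ φ = 1) (c s : ℝ)
    (p : HermParam W × HermParam W) : pm φ (toHerm (rot φ c s p).2) =
      c • pm φ (toHerm p.2) - s • pm φ (toHerm p.1) := by
  simp only [rot, LinearMap.coe_mk, AddHom.coe_mk]
  rw [sub_eq_add_neg, ← neg_smul]
  simp only [toHerm_add, toHerm_smul, toHerm_hp, pm_add, pm_real_smul, pm_pm hφ]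
  module

/-- Quadratic form on pairs. -/
def hq2 (W : ℕ) (p : HermParam W × HermParam W) : ℝ := W * hq p.1 + W * hq p.2

@[fun_prop] lemma measurable_hq2 : Measurable (hq2 W) := by unfold hq2; fun_prop

lemma gw_hq2 (p : HermParam W × HermParam W) : gw (hq2 W) p = gH W p.1 * gH W p.2 := by
  unfold gH gw hq2
  rw [← ENNReal.ofReal_mul (Real.exp_pos _).le, ← Real.exp_add]
  congr 2; ring

lemma lintegral_gw_hq2 : ∫⁻ p, gw (hq2 W) p = ZH W * ZH W := by
  simp only [gw_hq2]
  exact lintegral_prod_mul measurable_gH.aemeasurable measurable_gH.aemeasurable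

lemma volume_singular (a : HermParam W) :
    volume {x : HermParam W | ¬ IsUnit (toHerm (x - a)).det} = 0 := by
  refine measure_eq_zero_of_lines ?_ (fromHerm 1) ?_
  · have : Measurable fun x : HermParam W => (toHerm (x - a)).det := by fun_prop
    simp only [isUnit_iff_ne_zero, not_not]
    exact this (measurableSet_singleton 0)
  · intro x
    have h := volume_det_add_smul_one_eq_zero (toHerm (x - a))
    convert h using 4 with t
    change ¬ IsUnit (toHerm (x + t • fromHerm 1 - a)).det ↔ _
    rw [isUnit_iff_ne_zero, not_not, add_sub_right_comm, toHerm_add, toHerm_smul,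
      toHerm_fromHerm isHermitian_one]

lemma lintegral_sqn_trace_pm_le (hZ : ZH W ≠ ∞) (a : HermParam W) {φ : Fin W → ℂ}
    (hφ : star φ ⬝ᵥ φ = 1) :
    ∫⁻ x, ∫⁻ x', sqn (trace ((toHerm (x - a))⁻¹ * pm φ (toHerm x'))) * gH W x' * gH W x ≤
      14 * (ZH W * ZH W) := by
  set f : HermParam W × HermParam W → ℝ≥0∞ := fun p =>
    sqn (trace ((toHerm (p.1 - a))⁻¹ * pm φ (toHerm p.2))) with hf
  have hpm : Measurable (pm φ : Mat W → Mat W) := by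
    have h : Continuous (pm φ : Mat W → Mat W) := by unfold pm; fun_prop
    exact h.measurable
  have htrace : Measurable (trace : Mat W → ℂ) := (by fun_prop : Continuous (trace : Mat W → ℂ)).measurable
  have hmul : Measurable fun p : Mat W × Mat W => p.1 * p.2 :=
    (by fun_prop : Continuous fun p : Mat W × Mat W => p.1 * p.2).measurable
  have hfm : Measurable f := by
    refine measurable_sqn.comp (htrace.comp (hmul.comp (Measurable.prodMk (by fun_prop) ?_)))
    exact hpm.comp (measurable_toHerm.comp measurable_snd)
  have hrew : ∫⁻ x, ∫⁻ x', sqn (trace ((toHerm (x - a))⁻¹ * pm φ (toHerm x'))) * gH W x' * gH W x =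
      ∫⁻ p, f p * gw (hq2 W) p := by
    have hp : ∫⁻ p, f p * gw (hq2 W) p = ∫⁻ x, ∫⁻ x', f (x, x') * gw (hq2 W) (x, x') :=
      lintegral_prod _ (by fun_prop)
    rw [hp]
    refine lintegral_congr fun x => lintegral_congr fun x' => ?_
    rw [gw_hq2]; simp only [hf]; ring
  rw [hrew]
  have hrot : ∀ t : ℝ, ∫⁻ p, f (rot φ ((1 - t ^ 2) / (1 + t ^ 2)) (2 * t / (1 + t ^ 2)) p) *
      gw (hq2 W) p = ∫⁻ p, f p * gw (hq2 W) p := by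
    intro t
    have hcs : ((1 - t ^ 2) / (1 + t ^ 2)) ^ 2 + (2 * t / (1 + t ^ 2)) ^ 2 = 1 := by
      have : (1 + t ^ 2) ≠ 0 := by positivity
      field_simp; ring
    refine @lintegral_gw_comp_linear _ _ _ _ Prod.borelSpace _ volume _ _ measurable_hq2 _ (rot_injective hφ hcs) ?_ ?_ ?_ f hfm
    · intro p; unfold hq2; rw [← mul_add, hq_rot hφ hcs, mul_add]
    · rw [lintegral_gw_hq2]; exact mul_ne_zero ZH_ne_zero ZH_ne_zero
    · rw [lintegral_gw_hq2]; exact ENNReal.mul_ne_top hZ hZ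
  have hjm : Measurable fun q : ℝ × (HermParam W × HermParam W) =>
      f (rot φ ((1 - q.1 ^ 2) / (1 + q.1 ^ 2)) (2 * q.1 / (1 + q.1 ^ 2)) q.2) := by
    refine hfm.comp ?_
    simp only [rot, LinearMap.coe_mk, AddHom.coe_mk]
    fun_prop
  have hpt : ∀ᵐ p : HermParam W × HermParam W, ∫⁻ t in Set.Icc (-1 : ℝ) 1,
      f (rot φ ((1 - t ^ 2) / (1 + t ^ 2)) (2 * t / (1 + t ^ 2)) p) ≤ 28 := by
    have hae : ∀ᵐ p : HermParam W × HermParam W, IsUnit (toHerm (p.1 - a)).det := by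
      have h1 : ∀ᵐ x : HermParam W, IsUnit (toHerm (x - a)).det := by
        rw [ae_iff]; exact volume_singular a
      exact Measure.quasiMeasurePreserving_fst.ae h1
    filter_upwards [hae] with p hp
    refine le_trans (le_of_eq ?_) (sqn_trace_rotation hp φ (toHerm p.1) (toHerm p.2))
    refine lintegral_congr fun t => ?_
    simp only [hf]
    rw [toHerm_rot_fst, pm_toHerm_rot_snd hφ]
  have h2 : 2 * ∫⁻ p, f p * gw (hq2 W) p ≤ 28 * (ZH W * ZH W) := by
    calc 2 * ∫⁻ p, f p * gw (hq2 W) p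
        = ∫⁻ t in Set.Icc (-1 : ℝ) 1, ∫⁻ p, f (rot φ ((1 - t ^ 2) / (1 + t ^ 2))
            (2 * t / (1 + t ^ 2)) p) * gw (hq2 W) p := by
          simp only [hrot, lintegral_const, Measure.restrict_apply_univ, Real.volume_Icc]
          rw [mul_comm]; norm_num
      _ = ∫⁻ p, ∫⁻ t in Set.Icc (-1 : ℝ) 1, f (rot φ ((1 - t ^ 2) / (1 + t ^ 2))
            (2 * t / (1 + t ^ 2)) p) * gw (hq2 W) p := by
          refine lintegral_lintegral_swap ?_
          exact (hjm.mul (by fun_prop)).aemeasurable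
      _ ≤ ∫⁻ p, 28 * gw (hq2 W) p := by
          refine lintegral_mono_ae ?_
          filter_upwards [hpt] with p hp
          rw [lintegral_mul_const' _ _ (gw_ne_top _ _)]
          exact mul_le_mul_left hp _
      _ = _ := by rw [lintegral_const_mul' _ _ (by simp), lintegral_gw_hq2]
  have h3 : 2 * ∫⁻ p, f p * gw (hq2 W) p ≤ 2 * (14 * (ZH W * ZH W)) := by
    refine h2.trans (le_of_eq ?_)
    rw [← mul_assoc 2]; norm_num
  exact (ENNReal.mul_le_mul_iff_right (by norm_num) (by norm_num)).1 h3

end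

section

section signs

variable {E : Type*} [NormedAddCommGroup E] [InnerProductSpace ℂ E]

/-- Sign attached to a boolean. -/
def sg (b : Bool) : ℝ := if b then 1 else -1

lemma sum_bool_fin_succ {n : ℕ} (f : (Fin (n + 1) → Bool) → ℝ) :
    ∑ ε, f ε = ∑ ε : Fin n → Bool, (f (Fin.cons true ε) + f (Fin.cons false ε)) := by
  rw [← (Fin.consEquiv fun _ => Bool).sum_comp, Fintype.sum_prod_type, Fintype.sum_bool,
    ← Finset.sum_add_distrib]
  rfl

lemma norm_parallelogram (S x : E) :
    ‖S + x‖ ^ 2 + ‖S - x‖ ^ 2 = 2 * (‖S‖ ^ 2 + ‖x‖ ^ 2) := by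
  have := parallelogram_law_with_norm ℂ S x
  nlinarith

lemma norm_fourth_le (S x : E) : ‖S + x‖ ^ 4 + ‖S - x‖ ^ 4 ≤
    2 * (‖S‖ ^ 4 + 18 * ‖S‖ ^ 2 * ‖x‖ ^ 2 + ‖x‖ ^ 4) := by
  have h1 := norm_parallelogram S x
  have h2 : |‖S + x‖ ^ 2 - ‖S - x‖ ^ 2| ≤ 8 * (‖S‖ * ‖x‖) := by
    have ha : |‖S + x‖ - ‖S - x‖| ≤ 2 * ‖x‖ := by
      have := abs_norm_sub_norm_le (S + x) (S - x)
      rw [show S + x - (S - x) = (2 : ℂ) • x by rw [two_smul]; abel, norm_smul] at this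
      simpa using this
    have hb : |‖S + x‖ - ‖S - x‖| ≤ 2 * ‖S‖ := by
      have := abs_norm_sub_norm_le (S + x) (-(S - x))
      rw [show S + x - -(S - x) = (2 : ℂ) • S by rw [two_smul]; abel, norm_smul, norm_neg] at this
      simpa using this
    have hc := norm_add_le S x
    have hd := norm_sub_le S x
    rw [show ‖S + x‖ ^ 2 - ‖S - x‖ ^ 2 = (‖S + x‖ - ‖S - x‖) * (‖S + x‖ + ‖S - x‖) by ring, abs_mul,
      abs_of_nonneg (a := ‖S + x‖ + ‖S - x‖) (by positivity)]
    have hS := norm_nonneg S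
    have hx := norm_nonneg x
    have h0 := abs_nonneg (‖S + x‖ - ‖S - x‖)
    rcases le_total ‖S‖ ‖x‖ with h | h
    · calc _ ≤ (2 * ‖S‖) * (4 * ‖x‖) := by gcongr; linarith
        _ = _ := by ring
    · calc _ ≤ (2 * ‖x‖) * (4 * ‖S‖) := by gcongr; linarith
        _ = _ := by ring
  have h3 : (‖S + x‖ ^ 2 - ‖S - x‖ ^ 2) ^ 2 ≤ (8 * (‖S‖ * ‖x‖)) ^ 2 := sq_le_sq' (by linarith [abs_le.1 h2]) (abs_le.1 h2).2
  nlinarith [congrArg (fun t => t ^ 2) h1]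

lemma sum_sign_norm_sq {n : ℕ} (x : Fin n → E) (S : E) :
    ∑ ε : Fin n → Bool, ‖S + ∑ a, sg (ε a) • x a‖ ^ 2 =
      2 ^ n * (‖S‖ ^ 2 + ∑ a, ‖x a‖ ^ 2) := by
  induction n generalizing S with
  | zero => simp
  | succ n ih =>
    rw [sum_bool_fin_succ, Finset.sum_add_distrib]
    simp only [Fin.sum_univ_succ, Fin.cons_zero, Fin.cons_succ, ← add_assoc]
    rw [ih, ih]
    have := norm_parallelogram S (x 0)
    simp only [sg, if_true, one_smul, Bool.false_eq_true, if_false, neg_smul, ← sub_eq_add_neg]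
    rw [pow_succ]
    linear_combination 2 ^ n * this

lemma sum_sign_norm_fourth {n : ℕ} (x : Fin n → E) (S : E) :
    ∑ ε : Fin n → Bool, ‖S + ∑ a, sg (ε a) • x a‖ ^ 4 ≤
      2 ^ n * (‖S‖ ^ 4 + 18 * ‖S‖ ^ 2 * (∑ a, ‖x a‖ ^ 2) + 9 * (∑ a, ‖x a‖ ^ 2) ^ 2) := by
  induction n generalizing S with
  | zero => simp
  | succ n ih =>
    rw [sum_bool_fin_succ, Finset.sum_add_distrib]
    simp only [Fin.sum_univ_succ, Fin.cons_zero, Fin.cons_succ, ← add_assoc]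
    have h1 := norm_parallelogram S (x 0)
    have h2 := norm_fourth_le S (x 0)
    have i1 := ih (fun a => x a.succ) (S + x 0)
    have i2 := ih (fun a => x a.succ) (S - x 0)
    simp only [sg, if_true, one_smul, Bool.false_eq_true, if_false, neg_smul, ← sub_eq_add_neg] at *
    refine (add_le_add i1 i2).trans ?_
    rw [pow_succ (2:ℝ) n, ← mul_add, mul_assoc (2 ^ n : ℝ) 2]
    refine mul_le_mul_of_nonneg_left ?_ (pow_nonneg zero_le_two n : (0:ℝ) ≤ 2 ^ n)
    set σ := ∑ a : Fin n, ‖x a.succ‖ ^ 2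
    have hσ : 0 ≤ σ := by positivity
    have e : 18 * ‖S + x 0‖ ^ 2 * σ + 18 * ‖S - x 0‖ ^ 2 * σ =
      36 * (‖S‖ ^ 2 + ‖x 0‖ ^ 2) * σ := by linear_combination 18 * σ * h1
    nlinarith [sq_nonneg (‖x 0‖ ^ 2)]

lemma fourth_root_ge {u : ℝ} (hu : 0 ≤ u) : u ^ 4 - u ^ 8 / 18 ≤ 9 * u := by
  have h : 0 ≤ 9 - u ^ 3 + u ^ 7 / 18 := by
    rcases le_or_gt (u ^ 3) 9 with h | h
    · have : 0 ≤ u ^ 7 := by positivity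
      linarith
    · have h2 : 2 ≤ u := by
        by_contra hlt
        push Not at hlt
        have : u ^ 3 ≤ 2 ^ 3 := by gcongr
        linarith
      have h4 : 18 ≤ u ^ 4 := by nlinarith
      have : u ^ 3 * 18 ≤ u ^ 3 * u ^ 4 := mul_le_mul_of_nonneg_left h4 (by positivity)
      nlinarith
  nlinarith [mul_nonneg hu h]

lemma sum_sign_sqrt_norm {n : ℕ} (x : Fin n → E) :
    2 ^ n * Real.sqrt (Real.sqrt (∑ a, ‖x a‖ ^ 2)) ≤
      18 * ∑ ε : Fin n → Bool, Real.sqrt ‖∑ a, sg (ε a) • x a‖ := by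
  have h2 := sum_sign_norm_sq x 0
  have h4 := sum_sign_norm_fourth x 0
  simp only [zero_add, norm_zero, ne_eq, OfNat.ofNat_ne_zero, not_false_eq_true, zero_pow,
    mul_zero, zero_mul] at h2 h4
  set m := ∑ a, ‖x a‖ ^ 2 with hm
  have hm0 : 0 ≤ m := by positivity
  rcases hm0.eq_or_lt with h0 | hpos
  · rw [← h0]; simp; positivity
  set r := Real.sqrt (Real.sqrt m) with hr
  have hr0 : 0 < r := Real.sqrt_pos.2 (Real.sqrt_pos.2 hpos)
  have hr4 : r ^ 4 = m := by
    rw [show r ^ 4 = (r ^ 2) ^ 2 by ring, hr, Real.sq_sqrt (Real.sqrt_nonneg _), Real.sq_sqrt hm0]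
  have hpt : ∀ y : ℝ, 0 ≤ y → r / m * y ^ 2 - r / (18 * m ^ 2) * y ^ 4 ≤ 9 * Real.sqrt y := by
    intro y hy
    have h := fourth_root_ge (u := Real.sqrt y / r) (by positivity)
    have e4 : Real.sqrt y ^ 4 = y ^ 2 := by
      rw [show Real.sqrt y ^ 4 = (Real.sqrt y ^ 2) ^ 2 by ring, Real.sq_sqrt hy]
    have e8 : Real.sqrt y ^ 8 = y ^ 4 := by
      rw [show Real.sqrt y ^ 8 = (Real.sqrt y ^ 2) ^ 4 by ring, Real.sq_sqrt hy]
    rw [div_pow, div_pow, e4, e8, show r ^ 8 = (r ^ 4) ^ 2 by ring, hr4] at h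
    have h' := mul_le_mul_of_nonneg_left h hr0.le
    calc _ = r * (y ^ 2 / m - y ^ 4 / m ^ 2 / 18) := by field_simp
      _ ≤ _ := h'
      _ = _ := by field_simp
  have hs := Finset.sum_le_sum fun (ε : Fin n → Bool) (_ : ε ∈ Finset.univ) =>
    hpt ‖∑ a, sg (ε a) • x a‖ (norm_nonneg _)
  rw [Finset.sum_sub_distrib, ← Finset.mul_sum, ← Finset.mul_sum, ← Finset.mul_sum, h2] at hs
  have h5 : r / (18 * m ^ 2) * ∑ ε : Fin n → Bool, ‖∑ a, sg (ε a) • x a‖ ^ 4 ≤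
      r / (18 * m ^ 2) * (2 ^ n * (0 + 9 * m ^ 2)) := by
    refine mul_le_mul_of_nonneg_left ?_ (by positivity)
    simpa using h4
  have e1 : r / (18 * m ^ 2) * (2 ^ n * (0 + 9 * m ^ 2)) = 2 ^ n * r / 2 := by field_simp; ring
  have e2 : r / m * (2 ^ n * (0 + m)) = 2 ^ n * r := by field_simp; ring
  simp only [zero_add] at *
  linarith

end signs

end

section

variable {W : ℕ}

@[fun_prop] lemma measurable_hin_right (y : HermParam W) : Measurable (hin y) := by
  unfold hin
  have h : Continuous fun x : HermParam W => finr (toHerm y) (toHerm x) :=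
    continuous_finr.comp (continuous_const.prodMk continuous_toHerm)
  exact h.measurable

lemma hin_sub_right (x y y' : HermParam W) : hin x (y - y') = hin x y - hin x y' := by
  rw [sub_eq_add_neg, hin_add_right, ← neg_one_smul ℝ y', hin_smul_right]; ring

lemma lintegral_sqrt_hin_ge (hW : 0 < W) (hZ : ZH W ≠ ∞) (y : HermParam W) :
    ENNReal.ofReal (Real.sqrt (Real.sqrt (hq y / (2 * W)))) * ZH W ≤
      6 * ∫⁻ x, ENNReal.ofReal (Real.sqrt |hin y x|) * gH W x := by
  rcases (hq_nonneg y).eq_or_lt with h0 | hpos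
  · rw [← h0]; simp
  have hW' : (0 : ℝ) < W := by exact_mod_cast hW
  set L : ℝ := Real.sqrt (hq y / (2 * W)) with hL
  have hLpos : 0 < L := Real.sqrt_pos.2 (by positivity)
  have hL2 : L ^ 2 = hq y / (2 * W) := Real.sq_sqrt (by positivity)
  set τ : ℝ := L / hq y with hτ
  set S : Set (HermParam W) := {x | |hin y x| < L} with hS
  have hSm : MeasurableSet S := measurableSet_lt (by fun_prop) measurable_const
  have hdis := lintegral_gw_disjoint_shift (volume : Measure (HermParam W))
    (q := fun x => (W : ℝ) * hq x) (by fun_prop) (v := τ • y)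
    (by intro x; rw [hq_add, hq_sub]; ring) hSm (by
      intro x h1 h2
      change |hin y (x + τ • y)| < L at h1
      change |hin y (x - τ • y)| < L at h2
      rw [hin_add_right, hin_smul_right, hin_self, hτ, div_mul_cancel₀ _ hpos.ne', abs_lt] at h1
      rw [hin_sub_right, hin_smul_right, hin_self, hτ, div_mul_cancel₀ _ hpos.ne', abs_lt] at h2
      linarith [h1.2, h2.1])
  have hqv : (W : ℝ) * hq (τ • y) = 1 / 2 := by
    rw [hq_smul, hτ, div_pow, hL2]; field_simp
  rw [hqv] at hdis
  have hexp : ENNReal.ofReal (Real.exp (1 / 2)) * (2⁻¹ * ZH W) ≤ ENNReal.ofReal (5 / 6) * ZH W := by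
    rw [← mul_assoc]
    refine mul_le_mul_left ?_ _
    have : (2⁻¹ : ℝ≥0∞) = ENNReal.ofReal (1 / 2) := by
      rw [one_div, ENNReal.ofReal_inv_of_pos (by norm_num)]; simp
    rw [this, ← ENNReal.ofReal_mul (by positivity)]
    refine ENNReal.ofReal_le_ofReal ?_
    have h := Real.exp_one_lt_d9
    have h2 : Real.exp (1 / 2) ^ 2 = Real.exp 1 := by rw [← Real.exp_nat_mul]; norm_num
    have h3 : 0 < Real.exp (1 / 2) := Real.exp_pos _
    nlinarith
  have hsplit : (∫⁻ x in S, gH W x) + (∫⁻ x in Sᶜ, gH W x) = ZH W :=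
    lintegral_add_compl _ hSm
  have hS1 : ∫⁻ x in S, gH W x ≤ ENNReal.ofReal (5 / 6) * ZH W := hdis.trans hexp
  have hSc : ENNReal.ofReal (1 / 6) * ZH W ≤ ∫⁻ x in Sᶜ, gH W x := by
    have h1 : ENNReal.ofReal (1 / 6) * ZH W + ENNReal.ofReal (5 / 6) * ZH W = ZH W := by
      rw [← add_mul, ← ENNReal.ofReal_add (by norm_num) (by norm_num)]; norm_num
    have h2 : ENNReal.ofReal (1 / 6) * ZH W + ENNReal.ofReal (5 / 6) * ZH W ≤
        (∫⁻ x in Sᶜ, gH W x) + ENNReal.ofReal (5 / 6) * ZH W := by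
      calc _ = (∫⁻ x in Sᶜ, gH W x) + (∫⁻ x in S, gH W x) := by rw [h1, add_comm, hsplit]
        _ ≤ _ := add_le_add le_rfl hS1
    exact (ENNReal.add_le_add_iff_right (ENNReal.mul_ne_top ENNReal.ofReal_ne_top hZ)).1 h2
  have h3 : ENNReal.ofReal (Real.sqrt L) * ∫⁻ x in Sᶜ, gH W x ≤
      ∫⁻ x, ENNReal.ofReal (Real.sqrt |hin y x|) * gH W x := by
    rw [← lintegral_const_mul' _ _ ENNReal.ofReal_ne_top]
    refine (setLIntegral_mono' hSm.compl fun x hx => ?_).trans (setLIntegral_le_lintegral _ _)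
    have hx' : L ≤ |hin y x| := not_lt.1 hx
    exact mul_le_mul_left (ENNReal.ofReal_le_ofReal (Real.sqrt_le_sqrt hx')) _
  calc ENNReal.ofReal (Real.sqrt L) * ZH W
      = 6 * (ENNReal.ofReal (Real.sqrt L) * (ENNReal.ofReal (1 / 6) * ZH W)) := by
        have : (6 : ℝ≥0∞) * ENNReal.ofReal (1 / 6) = 1 := by
          rw [show (6 : ℝ≥0∞) = ENNReal.ofReal 6 by norm_num, ← ENNReal.ofReal_mul (by norm_num)]
          norm_num
        calc _ = (6 * ENNReal.ofReal (1 / 6)) * (ENNReal.ofReal (Real.sqrt L) * ZH W) := by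
              rw [this, one_mul]
          _ = _ := by ring
    _ ≤ _ := mul_le_mul_right ((mul_le_mul_right hSc _).trans h3) _

/-- Euclidean norm of a complex vector. -/
def vn {ι : Type*} [Fintype ι] (v : ι → ℂ) : ℝ := ‖(WithLp.toLp 2 v : EuclideanSpace ℂ ι)‖

lemma vn_sq {ι : Type*} [Fintype ι] (v : ι → ℂ) : vn v ^ 2 = ∑ i, ‖v i‖ ^ 2 :=
  EuclideanSpace.norm_sq_eq _

lemma vn_mulVec_sq_le {ι κ : Type*} [Fintype ι] [Fintype κ] (M : Matrix ι κ ℂ) (v : κ → ℂ) :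
    vn (M *ᵥ v) ^ 2 ≤ fsq M * vn v ^ 2 := by
  have h := fsq_mul_le M (replicateCol Unit v)
  rw [← replicateCol_mulVec] at h
  simpa [vn_sq, fsq] using h

lemma pm_mulVec {ι : Type*} [Fintype ι] {φ : ι → ℂ} (hφ : star φ ⬝ᵥ φ = 1) (R : Matrix ι ι ℂ) :
    pm φ R *ᵥ φ = R *ᵥ φ := by
  have h : vecMulVec φ (star φ) *ᵥ φ = φ := by
    rw [vecMulVec_mulVec, hφ]; simp
  unfold pm
  rw [sub_mulVec, add_mulVec, ← mulVec_mulVec, ← mulVec_mulVec, ← mulVec_mulVec, ← mulVec_mulVec, h]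
  abel

lemma vn_sq_eq_dotProduct {ι : Type*} [Fintype ι] (v : ι → ℂ) :
    ((vn v ^ 2 : ℝ) : ℂ) = star v ⬝ᵥ v := by
  rw [vn_sq, dotProduct]
  push_cast
  refine Finset.sum_congr rfl fun i _ => ?_
  rw [Pi.star_apply, ← Complex.conj_mul']; rfl

lemma lintegral_resolvent_vector_le (hW : 0 < W) (hZ : ZH W ≠ ∞) (a : HermParam W)
    {φ : Fin W → ℂ} (hφ : star φ ⬝ᵥ φ = 1) :
    ∫⁻ x, ENNReal.ofReal (Real.sqrt (vn ((toHerm (x - a))⁻¹ *ᵥ φ) / Real.sqrt (2 * W))) * gH W x ≤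
      84 * ZH W := by
  have h := lintegral_sqn_trace_pm_le hZ a hφ
  have key : ∀ x : HermParam W,
      ENNReal.ofReal (Real.sqrt (vn ((toHerm (x - a))⁻¹ *ᵥ φ) / Real.sqrt (2 * W))) * gH W x * ZH W ≤
      6 * ∫⁻ x', sqn (trace ((toHerm (x - a))⁻¹ * pm φ (toHerm x'))) * gH W x' * gH W x := by
    intro x
    set R := (toHerm (x - a))⁻¹ with hR
    have hRh : R.IsHermitian := (toHerm_isHermitian _).inv
    set y := hp φ (fromHerm R) with hy
    have hyR : toHerm y = pm φ R := by rw [hy, toHerm_hp, toHerm_fromHerm hRh]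
    have h1 := lintegral_sqrt_hin_ge hW hZ y
    have h2 : ∀ x', ENNReal.ofReal (Real.sqrt |hin y x'|) ≤ sqn (trace (R * pm φ (toHerm x'))) := by
      intro x'
      refine ENNReal.ofReal_le_ofReal (Real.sqrt_le_sqrt ?_)
      have : hin y x' = (trace (R * pm φ (toHerm x'))).re := by
        rw [hin, hyR, ← trace_mul_conjTranspose_re, (toHerm_isHermitian x').eq, trace_pm_mul]
      rw [this]; exact Complex.abs_re_le_norm _
    have h3 : Real.sqrt (vn (R *ᵥ φ) / Real.sqrt (2 * W)) ≤
        Real.sqrt (Real.sqrt (hq y / (2 * W))) := by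
      refine Real.sqrt_le_sqrt ?_
      rw [Real.sqrt_div (hq_nonneg _)]
      refine div_le_div_of_nonneg_right ?_ (Real.sqrt_nonneg _)
      refine Real.le_sqrt_of_sq_le ?_
      have h4 := vn_mulVec_sq_le (pm φ R) φ
      have h5 : vn φ ^ 2 = 1 := by
        have := vn_sq_eq_dotProduct φ
        rw [hφ] at this; exact_mod_cast this
      rw [pm_mulVec hφ, h5, mul_one] at h4
      rw [hq, hyR]; exact h4
    calc _ ≤ ENNReal.ofReal (Real.sqrt (Real.sqrt (hq y / (2 * W)))) * gH W x * ZH W := by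
          refine mul_le_mul_left (mul_le_mul_left (ENNReal.ofReal_le_ofReal h3) _) _
      _ = (ENNReal.ofReal (Real.sqrt (Real.sqrt (hq y / (2 * W)))) * ZH W) * gH W x := by ring
      _ ≤ (6 * ∫⁻ x', ENNReal.ofReal (Real.sqrt |hin y x'|) * gH W x') * gH W x :=
          mul_le_mul_left h1 _
      _ ≤ (6 * ∫⁻ x', sqn (trace (R * pm φ (toHerm x'))) * gH W x') * gH W x := by
          refine mul_le_mul_left (mul_le_mul_right (lintegral_mono fun x' => ?_) _) _
          exact mul_le_mul_left (h2 x') _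
      _ = _ := by rw [mul_assoc, ← lintegral_mul_const' _ _ (gH_ne_top x)]
  have h6 := lintegral_mono (μ := volume) key
  rw [lintegral_mul_const' _ _ hZ, lintegral_const_mul' _ _ (by simp)] at h6
  have h7 := h6.trans (mul_le_mul_right h _)
  rw [show 6 * (14 * (ZH W * ZH W)) = 84 * ZH W * ZH W by ring] at h7
  exact (ENNReal.mul_le_mul_iff_left ZH_ne_zero hZ).1 h7

lemma lintegral_resolvent_le (hW : 0 < W) (hZ : ZH W ≠ ∞) (a : HermParam W) :
    ∫⁻ x, ENNReal.ofReal (Real.sqrt (Real.sqrt (fsq (toHerm (x - a))⁻¹) / W)) * gH W x ≤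
      3024 * ZH W := by
  have hW' : (0 : ℝ) < W := by exact_mod_cast hW
  have hsgn : ∀ b, ‖((sg b : ℝ) : ℂ)‖ = 1 := by intro b; cases b <;> simp [sg]
  have hε : ∀ ε : Fin W → Bool, ∫⁻ x, ENNReal.ofReal (Real.sqrt
      ‖∑ b, sg (ε b) • (WithLp.toLp 2 fun i => (toHerm (x - a))⁻¹ i b : EuclideanSpace ℂ (Fin W))‖) *
        gH W x ≤ ENNReal.ofReal (2 * Real.sqrt W) * (84 * ZH W) := by
    intro ε
    set φ : Fin W → ℂ := fun b => ((1 / Real.sqrt W : ℝ) : ℂ) * (sg (ε b) : ℝ) with hφ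
    have hφ1 : star φ ⬝ᵥ φ = 1 := by
      rw [← vn_sq_eq_dotProduct, vn_sq]
      simp only [hφ, norm_mul, hsgn, mul_one, Complex.norm_real, Real.norm_eq_abs, sq_abs]
      rw [Finset.sum_const, Finset.card_univ, Fintype.card_fin, nsmul_eq_mul, div_pow,
        Real.sq_sqrt hW'.le]
      norm_num
      exact mul_inv_cancel₀ (by exact_mod_cast hW.ne')
    refine le_trans ?_ (mul_le_mul_right (lintegral_resolvent_vector_le hW hZ a hφ1) _)
    rw [← lintegral_const_mul' _ _ ENNReal.ofReal_ne_top]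
    refine lintegral_mono fun x => ?_
    rw [← mul_assoc, ← ENNReal.ofReal_mul (by positivity)]
    refine mul_le_mul_left (ENNReal.ofReal_le_ofReal ?_) _
    set R := (toHerm (x - a))⁻¹ with hR
    have e1 : vn (R *ᵥ φ) = 1 / Real.sqrt W *
        ‖∑ b, sg (ε b) • (WithLp.toLp 2 fun i => R i b : EuclideanSpace ℂ (Fin W))‖ := by
      have : (WithLp.toLp 2 (R *ᵥ φ) : EuclideanSpace ℂ (Fin W)) = ((1 / Real.sqrt W : ℝ) : ℂ) •
          ∑ b, sg (ε b) • (WithLp.toLp 2 fun i => R i b : EuclideanSpace ℂ (Fin W)) := by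
        ext i
        simp only [mulVec, dotProduct, hφ, PiLp.smul_apply, WithLp.ofLp_sum, Finset.sum_apply,
          smul_eq_mul, Finset.mul_sum, WithLp.ofLp_smul, Pi.smul_apply, Complex.real_smul]
        refine Finset.sum_congr rfl fun b _ => by ring
      rw [vn, this, norm_smul, Complex.norm_real, Real.norm_eq_abs, abs_of_nonneg (by positivity)]
    rw [e1]
    set N := ‖∑ b, sg (ε b) • (WithLp.toLp 2 fun i => R i b : EuclideanSpace ℂ (Fin W))‖
    have hN : 0 ≤ N := norm_nonneg _
    rw [show (2 : ℝ) * Real.sqrt W = Real.sqrt (4 * W) by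
      rw [Real.sqrt_mul (by norm_num), show (4 : ℝ) = 2 ^ 2 by norm_num, Real.sqrt_sq (by norm_num)],
      ← Real.sqrt_mul (by positivity)]
    refine Real.sqrt_le_sqrt ?_
    have e2 : Real.sqrt (2 * W) ≤ 2 * Real.sqrt W := by
      rw [Real.sqrt_le_left (by positivity), mul_pow, Real.sq_sqrt hW'.le]; nlinarith
    have e3 : 0 < Real.sqrt W := Real.sqrt_pos.2 hW'
    have e4 : 0 < Real.sqrt (2 * W) := Real.sqrt_pos.2 (by positivity)
    have e5 : Real.sqrt W ^ 2 = W := Real.sq_sqrt hW'.le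
    rw [show 4 * (W : ℝ) * (1 / Real.sqrt W * N / Real.sqrt (2 * W)) =
      (4 * Real.sqrt W ^ 2 / (Real.sqrt W * Real.sqrt (2 * W))) * N by rw [e5]; field_simp]
    have : 1 ≤ 4 * Real.sqrt W ^ 2 / (Real.sqrt W * Real.sqrt (2 * W)) := by
      rw [one_le_div (by positivity)]; nlinarith
    nlinarith
  have hsum := Finset.sum_le_sum fun (ε : Fin W → Bool) (_ : ε ∈ Finset.univ) => hε ε
  have hmeas : ∀ ε : Fin W → Bool, Measurable fun x => ENNReal.ofReal (Real.sqrt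
      ‖∑ b, sg (ε b) • (WithLp.toLp 2 fun i => (toHerm (x - a))⁻¹ i b : EuclideanSpace ℂ (Fin W))‖) *
        gH W x := by
    intro ε
    have h1 : Measurable fun x => (∑ b, sg (ε b) • (WithLp.toLp 2 fun i => (toHerm (x - a))⁻¹ i b :
        EuclideanSpace ℂ (Fin W))) := by
      refine Finset.measurable_sum _ fun b _ => ?_
      have h : Measurable fun x : HermParam W =>
          (WithLp.toLp 2 fun i => (toHerm (x - a))⁻¹ i b : EuclideanSpace ℂ (Fin W)) :=
        (WithLp.measurable_toLp 2 _).comp (measurable_pi_lambda _ fun i => by fun_prop)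
      exact h.const_smul (sg (ε b))
    fun_prop
  rw [← lintegral_finsetSum _ (fun ε _ => hmeas ε)] at hsum
  simp only [Finset.sum_const, Finset.card_univ, Fintype.card_fun, Fintype.card_bool,
    Fintype.card_fin] at hsum
  have hpt : ∀ x : HermParam W, (2 ^ W : ℝ≥0∞) *
      (ENNReal.ofReal (2 * Real.sqrt W) *
      (ENNReal.ofReal (Real.sqrt (Real.sqrt (fsq (toHerm (x - a))⁻¹) / W)) * gH W x)) ≤
      36 * ∑ ε : Fin W → Bool, ENNReal.ofReal (Real.sqrt
      ‖∑ b, sg (ε b) • (WithLp.toLp 2 fun i => (toHerm (x - a))⁻¹ i b : EuclideanSpace ℂ (Fin W))‖) *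
        gH W x := by
    intro x
    set R := (toHerm (x - a))⁻¹ with hR
    have h := sum_sign_sqrt_norm fun b =>
      (WithLp.toLp 2 fun i => R i b : EuclideanSpace ℂ (Fin W))
    have e : ∑ b, ‖(WithLp.toLp 2 fun i => R i b : EuclideanSpace ℂ (Fin W))‖ ^ 2 = fsq R := by
      simp only [EuclideanSpace.norm_sq_eq]
      rw [Finset.sum_comm]; rfl
    rw [e] at h
    rw [← Finset.sum_mul, ← ENNReal.ofReal_sum_of_nonneg (fun _ _ => Real.sqrt_nonneg _),
      ← mul_assoc, ← mul_assoc, ← mul_assoc]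
    refine mul_le_mul_left ?_ _
    rw [show (2 ^ W : ℝ≥0∞) = ENNReal.ofReal (2 ^ W) by simp,
      show (36 : ℝ≥0∞) = ENNReal.ofReal 36 by norm_num, ← ENNReal.ofReal_mul (by positivity),
      ← ENNReal.ofReal_mul (by positivity), ← ENNReal.ofReal_mul (by positivity)]
    refine ENNReal.ofReal_le_ofReal ?_
    rw [Real.sqrt_div (Real.sqrt_nonneg _)]
    have e3 : 0 < Real.sqrt W := Real.sqrt_pos.2 hW'
    calc _ = 2 * (2 ^ W * Real.sqrt (Real.sqrt (fsq R))) := by field_simp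
      _ ≤ _ := by linarith
  have hfin := lintegral_mono (μ := volume) hpt
  have hc1 : (2 ^ W : ℝ≥0∞) ≠ 0 := by simp
  have hc2 : (2 ^ W : ℝ≥0∞) ≠ ∞ := by simp
  have hc3 : ENNReal.ofReal (2 * Real.sqrt W) ≠ 0 := by
    rw [Ne, ENNReal.ofReal_eq_zero, not_le]
    have := Real.sqrt_pos.2 hW'
    positivity
  rw [lintegral_const_mul' _ _ hc2, lintegral_const_mul' _ _ ENNReal.ofReal_ne_top] at hfin
  simp only [Finset.mul_sum] at hfin
  simp only [← Finset.mul_sum] at hfin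
  rw [lintegral_const_mul' _ _ (by simp)] at hfin
  have h8 := hfin.trans (mul_le_mul_right hsum 36)
  rw [nsmul_eq_mul] at h8
  push_cast at h8
  rw [show (36 : ℝ≥0∞) * (2 ^ W * (ENNReal.ofReal (2 * Real.sqrt W) * (84 * ZH W))) =
    2 ^ W * (ENNReal.ofReal (2 * Real.sqrt W) * (3024 * ZH W)) by ring] at h8
  exact (ENNReal.mul_le_mul_iff_right hc3 ENNReal.ofReal_ne_top).1
    ((ENNReal.mul_le_mul_iff_right hc1 hc2).1 h8)

end

section

variable {W : ℕ}

/-- Multiplication of the entries of a matrix by signs. -/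
def sgm (η : Fin W → Fin W → Bool) : MatP W →ₗ[ℝ] MatP W where
  toFun T := fun m k => sg (η m k) • T m k
  map_add' T T' := by funext m k; simp [smul_add]
  map_smul' c T := by funext m k; simp only [Pi.smul_apply, RingHom.id_apply]; rw [smul_comm]

lemma sg_mul_self (b : Bool) : sg b * sg b = 1 := by cases b <;> simp [sg]

lemma sg_abs (b : Bool) : |sg b| = 1 := by cases b <;> simp [sg]

lemma mq_sgm (η : Fin W → Fin W → Bool) (T : MatP W) : mq (sgm η T) = mq T := by
  simp [mq, fsq, sgm, sg_abs]

lemma sgm_sgm (η : Fin W → Fin W → Bool) (T : MatP W) : sgm η (sgm η T) = T := by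
  funext m k; simp only [sgm, LinearMap.coe_mk, AddHom.coe_mk, smul_smul, sg_mul_self, one_smul]

lemma lintegral_sgm (hZ : ZM W ≠ ∞) (η : Fin W → Fin W → Bool) {f : MatP W → ℝ≥0∞}
    (hf : Measurable f) : ∫⁻ T, f (sgm η T) * gM W T = ∫⁻ T, f T * gM W T :=
  lintegral_gw_comp_linear volume (q := fun T => (W : ℝ) * mq T) (by fun_prop) (sgm η)
    (Function.LeftInverse.injective (sgm_sgm η)) (fun T => by rw [mq_sgm]) ZM_ne_zero hZ hf

lemma measurable_sgm (η : Fin W → Fin W → Bool) : Measurable (sgm η : MatP W → MatP W) :=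
  (LinearMap.continuous_of_finiteDimensional (sgm η)).measurable

/-- Averaging a Gaussian integral over a family of sign changes. -/
lemma lintegral_le_of_sgm_average (hZ : ZM W ≠ ∞) (η : (Fin W → Bool) → Fin W → Fin W → Bool)
    {f g : MatP W → ℝ} (hf : Measurable f) (hf0 : ∀ T, 0 ≤ f T)
    (h : ∀ T, ∑ ε, f (sgm (η ε) T) ≤ 2 ^ W * g T) :
    ∫⁻ T, ENNReal.ofReal (f T) * gM W T ≤ ∫⁻ T, ENNReal.ofReal (g T) * gM W T := by
  have h1 : (2 ^ W : ℝ≥0∞) * ∫⁻ T, ENNReal.ofReal (f T) * gM W T =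
      ∫⁻ T, (∑ ε, ENNReal.ofReal (f (sgm (η ε) T))) * gM W T := by
    simp only [Finset.sum_mul]
    rw [lintegral_finsetSum]
    · have : ∀ ε, ∫⁻ T, ENNReal.ofReal (f (sgm (η ε) T)) * gM W T =
          ∫⁻ T, ENNReal.ofReal (f T) * gM W T := fun ε =>
        lintegral_sgm hZ (η ε) (f := fun T => ENNReal.ofReal (f T)) (by fun_prop)
      simp only [this, Finset.sum_const, Finset.card_univ, Fintype.card_fun, Fintype.card_bool,
        Fintype.card_fin, nsmul_eq_mul]
      push_cast; rfl
    · intro ε _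
      have := hf.comp (measurable_sgm (η ε))
      exact (this.ennreal_ofReal).mul measurable_gM
  have h2 : ∫⁻ T, (∑ ε, ENNReal.ofReal (f (sgm (η ε) T))) * gM W T ≤
      (2 ^ W : ℝ≥0∞) * ∫⁻ T, ENNReal.ofReal (g T) * gM W T := by
    rw [← lintegral_const_mul' _ _ (by simp)]
    refine lintegral_mono fun T => ?_
    rw [← mul_assoc]
    refine mul_le_mul_left ?_ _
    rw [← ENNReal.ofReal_sum_of_nonneg (fun _ _ => hf0 _),
      show (2 ^ W : ℝ≥0∞) = ENNReal.ofReal (2 ^ W) by simp, ← ENNReal.ofReal_mul (by positivity)]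
    exact ENNReal.ofReal_le_ofReal (h T)
  rw [← h1] at h2
  exact (ENNReal.mul_le_mul_iff_right (by simp) (by simp)).1 h2

lemma finr_single (x : Mat W) (i j : Fin W) (c : ℂ) :
    finr x (Matrix.single i j c) = (x i j * star c).re := by
  unfold finr
  rw [Finset.sum_eq_single i, Finset.sum_eq_single j]
  · simp
  · intro b _ h1; simp [Matrix.single, Ne.symm h1]
  · simp
  · intro b _ h1; simp [Matrix.single, Ne.symm h1]
  · simp

lemma fsq_single (i j : Fin W) (c : ℂ) : fsq (Matrix.single i j c : Mat W) = ‖c‖ ^ 2 := by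
  rw [← finr_self, finr_single, Matrix.single_apply_same, Complex.star_def, Complex.mul_conj']
  norm_cast

lemma gaussLin_entry (hW : 0 < W) (i j : Fin W) {c : ℂ} (hc : ‖c‖ = 1) :
    GaussLin (fun T : MatP W => (W : ℝ) * mq T) (fun T => (T i j * star c).re)
      ((1 / (2 * W : ℝ)) • (Matrix.of.symm (Matrix.single i j c) : MatP W)) (1 / (4 * W)) where
  eq t x := by
    have hW' : (0 : ℝ) < W := by exact_mod_cast hW
    have h : mq (x - t • ((1 / (2 * W : ℝ)) • (Matrix.of.symm (Matrix.single i j c) : MatP W))) =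
        mq x + (t * (1 / (2 * W))) ^ 2 - 2 * (t * (1 / (2 * W)) * (x i j * star c).re) := by
      have := fsq_sub (Matrix.of x : Mat W)
        (t • ((1 / (2 * W : ℝ)) • (Matrix.single i j c : Mat W)))
      rw [smul_smul, fsq_real_smul, fsq_single, hc, finr_smul_right, finr_single] at this
      rw [one_pow, mul_one] at this
      rw [smul_smul]
      exact this
    rw [h]; field_simp; ring
  nonneg x := mul_nonneg (Nat.cast_nonneg _) (mq_nonneg x)
  meas := by fun_prop
  measℓ := by
    have : Measurable fun T : MatP W => T i j := by fun_prop
    fun_prop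

lemma lintegral_entry_fourth (hW : 0 < W) (i j : Fin W) :
    ∫⁻ T, ENNReal.ofReal (‖T i j‖ ^ 4) * gM W T ≤ ENNReal.ofReal (18 / W ^ 2) * ZM W := by
  have hW' : (0 : ℝ) < W := by exact_mod_cast hW
  have h1 := ((gaussLin_entry hW i j (c := 1) (by simp)).moments (μ := volume)).2
  have h2 := ((gaussLin_entry hW i j (c := Complex.I) (by simp)).moments (μ := volume)).2
  have hpt : ∀ T : MatP W, ENNReal.ofReal (‖T i j‖ ^ 4) * gM W T ≤
      2 * (ENNReal.ofReal ((T i j * star 1).re ^ 4) * gM W T) +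
        2 * (ENNReal.ofReal ((T i j * star Complex.I).re ^ 4) * gM W T) := by
    intro T
    rw [← mul_assoc, ← mul_assoc, ← add_mul, show (2 : ℝ≥0∞) = ENNReal.ofReal 2 by simp,
      ← ENNReal.ofReal_mul (by norm_num), ← ENNReal.ofReal_mul (by norm_num),
      ← ENNReal.ofReal_add (by positivity) (by positivity)]
    refine mul_le_mul_left (ENNReal.ofReal_le_ofReal ?_) _
    have : ‖T i j‖ ^ 4 = ((T i j).re ^ 2 + (T i j).im ^ 2) ^ 2 := by
      rw [show ‖T i j‖ ^ 4 = (‖T i j‖ ^ 2) ^ 2 by ring, Complex.sq_norm, Complex.normSq_apply]; ring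
    rw [this]
    simp
    nlinarith [sq_nonneg ((T i j).re ^ 2 - (T i j).im ^ 2)]
  have hm : ∀ c : ℂ, Measurable fun T : MatP W =>
      2 * (ENNReal.ofReal ((T i j * star c).re ^ 4) * gM W T) := by
    intro c
    have : Measurable fun T : MatP W => T i j := by fun_prop
    fun_prop
  refine (lintegral_mono (μ := volume) hpt).trans ?_
  rw [lintegral_add_left (hm 1), lintegral_const_mul' _ _ (by simp),
    lintegral_const_mul' _ _ (by simp)]
  refine (add_le_add (mul_le_mul_right h1 2) (mul_le_mul_right h2 2)).trans (le_of_eq ?_)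
  change 2 * (_ * ZM W) + 2 * (_ * ZM W) = _
  rw [← two_mul, ← mul_assoc, ← mul_assoc, show (2 : ℝ≥0∞) = ENNReal.ofReal 2 by simp,
    ← ENNReal.ofReal_mul (by norm_num), ← ENNReal.ofReal_mul (by norm_num)]
  congr 2; field_simp; norm_num

lemma fsq_conj_le {R T : Mat W} (hR : R.IsHermitian) :
    fsq (T * R * Tᴴ) ≤ fsq (R * (Tᴴ * T)) := by
  have h1 : fsq (T * R * Tᴴ) = finr (R * (Tᴴ * T)) (R * (Tᴴ * T))ᴴ := by
    rw [← finr_self, ← trace_mul_conjTranspose_re, ← trace_mul_conjTranspose_re,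
      conjTranspose_conjTranspose]
    congr 1
    simp only [conjTranspose_mul, conjTranspose_conjTranspose, hR.eq]
    rw [trace_mul_comm]
    simp only [← Matrix.mul_assoc]
    rw [trace_mul_comm]
    simp only [← Matrix.mul_assoc]
    rw [trace_mul_comm]
    simp only [← Matrix.mul_assoc]
  have h2 := two_finr_le (R * (Tᴴ * T)) (R * (Tᴴ * T))ᴴ
  rw [fsq_conjTranspose] at h2
  linarith

/-- Inner product of two columns. -/
def gram (T : MatP W) (k j : Fin W) : ℂ := ∑ m, star (T m k) * T m j

@[fun_prop] lemma measurable_gram (k j : Fin W) : Measurable fun T : MatP W => gram T k j := by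
  unfold gram
  refine Finset.measurable_sum _ fun m _ => ?_
  have h1 : Measurable fun T : MatP W => T m k := by fun_prop
  have h2 : Measurable fun T : MatP W => T m j := by fun_prop
  have h3 : Measurable fun T : MatP W => star (T m k) := continuous_star.measurable.comp h1
  exact h3.mul h2

lemma lintegral_gram_ne (hW : 0 < W) (hZ : ZM W ≠ ∞) {k j : Fin W} (hkj : k ≠ j) :
    ∫⁻ T, ENNReal.ofReal (‖gram T k j‖ ^ 2) * gM W T ≤ ENNReal.ofReal (18 / W) * ZM W := by
  have hW' : (0 : ℝ) < W := by exact_mod_cast hW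
  have h := lintegral_le_of_sgm_average hZ (fun ε m l => if l = j then ε m else true)
    (f := fun T => ‖gram T k j‖ ^ 2) (g := fun T => ∑ m, (‖T m k‖ ^ 4 / 2 + ‖T m j‖ ^ 4 / 2))
    (by fun_prop) (fun T => by positivity) (by
      intro T
      have h1 := sum_sign_norm_sq (fun m => star (T m k) * T m j) 0
      simp only [zero_add, norm_zero] at h1
      have h2 : ∀ ε : Fin W → Bool, gram (sgm (fun m l => if l = j then ε m else true) T) k j =
          ∑ m, sg (ε m) • (star (T m k) * T m j) := by
        intro ε
        refine Finset.sum_congr rfl fun m _ => ?_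
        simp only [sgm, LinearMap.coe_mk, AddHom.coe_mk, if_neg hkj, if_true]
        simp [sg]
      simp only [h2, h1]
      refine mul_le_mul_of_nonneg_left ?_ (by positivity)
      norm_num
      refine Finset.sum_le_sum fun m _ => ?_
      rw [mul_pow]
      nlinarith [sq_nonneg (‖T m k‖ ^ 2 - ‖T m j‖ ^ 2)])
  refine h.trans ?_
  have e : ∀ T : MatP W, ENNReal.ofReal (∑ m, (‖T m k‖ ^ 4 / 2 + ‖T m j‖ ^ 4 / 2)) * gM W T =
      ∑ m, (2⁻¹ * (ENNReal.ofReal (‖T m k‖ ^ 4) * gM W T) +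
        2⁻¹ * (ENNReal.ofReal (‖T m j‖ ^ 4) * gM W T)) := by
    intro T
    have h2 : (2⁻¹ : ℝ≥0∞) = ENNReal.ofReal (1 / 2) := by
      rw [one_div, ENNReal.ofReal_inv_of_pos (by norm_num)]; simp
    rw [ENNReal.ofReal_sum_of_nonneg (fun _ _ => by positivity), Finset.sum_mul]
    refine Finset.sum_congr rfl fun m _ => ?_
    rw [h2, ← mul_assoc, ← mul_assoc, ← add_mul, ← ENNReal.ofReal_mul (by norm_num),
      ← ENNReal.ofReal_mul (by norm_num), ← ENNReal.ofReal_add (by positivity) (by positivity)]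
    congr 2; ring
  have hm : ∀ m l : Fin W, Measurable fun T : MatP W =>
      2⁻¹ * (ENNReal.ofReal (‖T m l‖ ^ 4) * gM W T) := by
    intro m l
    have : Measurable fun T : MatP W => T m l := by fun_prop
    fun_prop
  simp only [e]
  have hs : ∀ m, Measurable fun T : MatP W => 2⁻¹ * (ENNReal.ofReal (‖T m k‖ ^ 4) * gM W T) +
      2⁻¹ * (ENNReal.ofReal (‖T m j‖ ^ 4) * gM W T) := fun m => (hm m k).add (hm m j)
  rw [lintegral_finsetSum _ (fun m _ => hs m)]
  have hm2 : ∀ m : Fin W, ∫⁻ T, (2⁻¹ * (ENNReal.ofReal (‖T m k‖ ^ 4) * gM W T) +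
        2⁻¹ * (ENNReal.ofReal (‖T m j‖ ^ 4) * gM W T)) ≤ ENNReal.ofReal (18 / W ^ 2) * ZM W := by
    intro m
    rw [lintegral_add_left (hm m k), lintegral_const_mul' _ _ (by simp),
      lintegral_const_mul' _ _ (by simp)]
    refine (add_le_add (mul_le_mul_right (lintegral_entry_fourth hW m k) _)
      (mul_le_mul_right (lintegral_entry_fourth hW m j) _)).trans (le_of_eq ?_)
    rw [← add_mul, ENNReal.inv_two_add_inv_two, one_mul]
  refine (Finset.sum_le_sum fun m _ => hm2 m).trans (le_of_eq ?_)
  rw [Finset.sum_const, Finset.card_univ, Fintype.card_fin, nsmul_eq_mul, ← mul_assoc,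
    ← ENNReal.ofReal_natCast, ← ENNReal.ofReal_mul (by positivity)]
  congr 2; field_simp

lemma lintegral_gram_self (hW : 0 < W) (k : Fin W) :
    ∫⁻ T, ENNReal.ofReal (‖gram T k k‖ ^ 2) * gM W T ≤ ENNReal.ofReal 18 * ZM W := by
  have hW' : (0 : ℝ) < W := by exact_mod_cast hW
  have hpt : ∀ T : MatP W, ENNReal.ofReal (‖gram T k k‖ ^ 2) * gM W T ≤
      ENNReal.ofReal W * ∑ m, ENNReal.ofReal (‖T m k‖ ^ 4) * gM W T := by
    intro T
    rw [← Finset.sum_mul, ← ENNReal.ofReal_sum_of_nonneg (fun _ _ => by positivity), ← mul_assoc,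
      ← ENNReal.ofReal_mul (by positivity)]
    refine mul_le_mul_left (ENNReal.ofReal_le_ofReal ?_) _
    have h1 : ‖gram T k k‖ ≤ ∑ m, ‖T m k‖ ^ 2 := by
      refine (norm_sum_le _ _).trans (Finset.sum_le_sum fun m _ => ?_)
      rw [norm_mul, norm_star, sq]
    have h2 : (∑ m, ‖T m k‖ ^ 2) ^ 2 ≤ W * ∑ m, ‖T m k‖ ^ 4 := by
      have := sq_sum_le_card_mul_sum_sq (s := (Finset.univ : Finset (Fin W)))
        (f := fun m => ‖T m k‖ ^ 2)
      simp only [Finset.card_univ, Fintype.card_fin, ← pow_mul] at this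
      exact this
    exact (pow_le_pow_left₀ (norm_nonneg _) h1 2).trans h2
  have hm : ∀ m : Fin W, Measurable fun T : MatP W =>
      (ENNReal.ofReal (‖T m k‖ ^ 4) * gM W T) := by
    intro m
    have : Measurable fun T : MatP W => T m k := by fun_prop
    fun_prop
  refine (lintegral_mono (μ := volume) hpt).trans ?_
  rw [lintegral_const_mul' _ _ ENNReal.ofReal_ne_top, lintegral_finsetSum _ (fun m _ => hm m)]
  refine (mul_le_mul_right (Finset.sum_le_sum fun m _ => lintegral_entry_fourth hW m k) _).trans
    (le_of_eq ?_)
  rw [Finset.sum_const, Finset.card_univ, Fintype.card_fin, nsmul_eq_mul, ← mul_assoc, ← mul_assoc,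
    ← ENNReal.ofReal_natCast, ← ENNReal.ofReal_mul (by positivity),
    ← ENNReal.ofReal_mul (by positivity)]
  congr 2; field_simp

lemma lintegral_gram_row (hW : 0 < W) (hZ : ZM W ≠ ∞) (k : Fin W) :
    ∑ j, ∫⁻ T, ENNReal.ofReal (‖gram T k j‖ ^ 2) * gM W T ≤ ENNReal.ofReal 36 * ZM W := by
  have hW' : (0 : ℝ) < W := by exact_mod_cast hW
  rw [← Finset.add_sum_erase _ _ (Finset.mem_univ k)]
  have h : ∑ j ∈ Finset.univ.erase k, ∫⁻ T, ENNReal.ofReal (‖gram T k j‖ ^ 2) * gM W T ≤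
      ENNReal.ofReal 18 * ZM W := by
    refine (Finset.sum_le_sum fun j hj =>
      lintegral_gram_ne hW hZ (Finset.ne_of_mem_erase hj).symm).trans ?_
    rw [Finset.sum_const, nsmul_eq_mul, ← mul_assoc, ← ENNReal.ofReal_natCast,
      ← ENNReal.ofReal_mul (by positivity)]
    refine mul_le_mul_left (ENNReal.ofReal_le_ofReal ?_) _
    have : ((Finset.univ.erase k).card : ℝ) ≤ W := by
      exact_mod_cast (Finset.card_le_univ _).trans (by simp)
    calc _ ≤ (W : ℝ) * (18 / W) := mul_le_mul_of_nonneg_right this (by positivity)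
      _ = 18 := by field_simp
  refine (add_le_add (lintegral_gram_self hW k) h).trans (le_of_eq ?_)
  rw [← add_mul, ← ENNReal.ofReal_add (by norm_num) (by norm_num)]; norm_num

/-- Second moment of a Hermitian matrix conjugated by a Ginibre matrix. -/
lemma lintegral_fsq_conj_le (hW : 0 < W) (hZ : ZM W ≠ ∞) {R : Mat W} (hR : R.IsHermitian) :
    ∫⁻ T, ENNReal.ofReal (fsq ((Matrix.of T : Mat W) * R * (Matrix.of T : Mat W)ᴴ)) * gM W T ≤
      ENNReal.ofReal (36 * fsq R) * ZM W := by
  have h1 : ∫⁻ T, ENNReal.ofReal (fsq ((Matrix.of T : Mat W) * R * (Matrix.of T : Mat W)ᴴ)) * gM W T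
      ≤ ∫⁻ T, ENNReal.ofReal (∑ i, ∑ j, ‖∑ k, R i k * gram T k j‖ ^ 2) * gM W T := by
    refine lintegral_mono fun T => mul_le_mul_left (ENNReal.ofReal_le_ofReal ?_) _
    exact fsq_conj_le hR
  refine h1.trans ?_
  have h2 := lintegral_le_of_sgm_average hZ (fun ε _ l => ε l)
    (f := fun T => ∑ i, ∑ j, ‖∑ k, R i k * gram T k j‖ ^ 2)
    (g := fun T => ∑ k, ∑ j, (∑ i, ‖R i k‖ ^ 2) * ‖gram T k j‖ ^ 2)
    (by
      refine Finset.measurable_sum _ fun i _ => Finset.measurable_sum _ fun j _ => ?_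
      have : Measurable fun T : MatP W => ∑ k, R i k * gram T k j :=
        Finset.measurable_sum _ fun k _ => by fun_prop
      fun_prop) (fun T => by positivity) (by
      intro T
      have h2 : ∀ (ε : Fin W → Bool) k j, gram (sgm (fun _ l => ε l) T) k j =
          sg (ε j) • sg (ε k) • gram T k j := by
        intro ε k j
        simp only [gram, Finset.smul_sum]
        refine Finset.sum_congr rfl fun m _ => ?_
        simp only [sgm, LinearMap.coe_mk, AddHom.coe_mk, star_smul, star_trivial, smul_mul_smul_comm,
          smul_smul, mul_comm]
      have h3 : ∀ (ε : Fin W → Bool) i j, ‖∑ k, R i k * gram (sgm (fun _ l => ε l) T) k j‖ ^ 2 =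
          ‖0 + ∑ k, sg (ε k) • (R i k * gram T k j)‖ ^ 2 := by
        intro ε i j
        have : ∑ k, R i k * gram (sgm (fun _ l => ε l) T) k j =
            sg (ε j) • ∑ k, sg (ε k) • (R i k * gram T k j) := by
          rw [Finset.smul_sum]
          refine Finset.sum_congr rfl fun k _ => ?_
          rw [h2, mul_smul_comm, mul_smul_comm]
        rw [this, norm_smul, Real.norm_eq_abs, sg_abs, one_mul, zero_add]
      simp only [h3]
      rw [Finset.sum_comm]
      have h4 : ∀ i, ∑ ε : Fin W → Bool, ∑ j, ‖0 + ∑ k, sg (ε k) • (R i k * gram T k j)‖ ^ 2 =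
          2 ^ W * ∑ j, ∑ k, ‖R i k‖ ^ 2 * ‖gram T k j‖ ^ 2 := by
        intro i
        rw [Finset.sum_comm, Finset.mul_sum]
        refine Finset.sum_congr rfl fun j _ => ?_
        rw [sum_sign_norm_sq]
        simp [mul_pow]
      simp only [h4]
      rw [← Finset.mul_sum]
      refine le_of_eq ?_
      congr 1
      simp only [Finset.sum_mul]
      calc _ = ∑ i, ∑ k, ∑ j, ‖R i k‖ ^ 2 * ‖gram T k j‖ ^ 2 :=
            Finset.sum_congr rfl fun i _ => Finset.sum_comm
        _ = ∑ k, ∑ i, ∑ j, ‖R i k‖ ^ 2 * ‖gram T k j‖ ^ 2 := Finset.sum_comm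
        _ = _ := Finset.sum_congr rfl fun k _ => Finset.sum_comm)
  refine h2.trans ?_
  have e : ∀ T : MatP W,
      ENNReal.ofReal (∑ k, ∑ j, (∑ i, ‖R i k‖ ^ 2) * ‖gram T k j‖ ^ 2) * gM W T =
      ∑ k, ENNReal.ofReal (∑ i, ‖R i k‖ ^ 2) *
        ∑ j, (ENNReal.ofReal (‖gram T k j‖ ^ 2) * gM W T) := by
    intro T
    rw [ENNReal.ofReal_sum_of_nonneg (fun _ _ => by positivity), Finset.sum_mul]
    refine Finset.sum_congr rfl fun k _ => ?_
    rw [← Finset.mul_sum, ENNReal.ofReal_mul (by positivity), mul_assoc]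
    congr 1
    rw [ENNReal.ofReal_sum_of_nonneg (fun _ _ => by positivity), Finset.sum_mul]
  have hm : ∀ k j : Fin W, Measurable fun T : MatP W =>
      ENNReal.ofReal (‖gram T k j‖ ^ 2) * gM W T := fun k j => by fun_prop
  have hm2 : ∀ k : Fin W, Measurable fun T : MatP W => ENNReal.ofReal (∑ i, ‖R i k‖ ^ 2) *
        ∑ j, (ENNReal.ofReal (‖gram T k j‖ ^ 2) * gM W T) := fun k =>
    (Finset.measurable_sum _ fun j _ => hm k j).const_mul _
  simp only [e]
  rw [lintegral_finsetSum _ (fun k _ => hm2 k)]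
  have h5 : ∀ k : Fin W, ∫⁻ T, ENNReal.ofReal (∑ i, ‖R i k‖ ^ 2) *
        ∑ j, (ENNReal.ofReal (‖gram T k j‖ ^ 2) * gM W T) ≤
      ENNReal.ofReal (∑ i, ‖R i k‖ ^ 2) * (ENNReal.ofReal 36 * ZM W) := by
    intro k
    rw [lintegral_const_mul' _ _ ENNReal.ofReal_ne_top, lintegral_finsetSum _ (fun j _ => hm k j)]
    exact mul_le_mul_right (lintegral_gram_row hW hZ k) _
  refine (Finset.sum_le_sum fun k _ => h5 k).trans (le_of_eq ?_)
  rw [← Finset.sum_mul, ← ENNReal.ofReal_sum_of_nonneg (fun _ _ => by positivity), ← mul_assoc,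
    ← ENNReal.ofReal_mul (by positivity), mul_comm (36 : ℝ), fsq, Finset.sum_comm]

end

section

variable {W : ℕ}

@[fun_prop] lemma measurable_conj_inv : Measurable fun p : HermParam W × MatP W =>
    (Matrix.of p.2 : Mat W) * (toHerm p.1)⁻¹ * (Matrix.of p.2 : Mat W)ᴴ := by
  have h1 : Measurable fun p : HermParam W × MatP W => (toHerm p.1)⁻¹ := by fun_prop
  have h2 : Measurable fun p : HermParam W × MatP W => (Matrix.of p.2 : Mat W) :=
    measurable_of.comp measurable_snd
  have h3 : Measurable fun p : HermParam W × MatP W => (Matrix.of p.2 : Mat W)ᴴ :=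
    measurable_matrix_conjTranspose.comp h2
  refine measurable_pi_iff.2 fun i => measurable_pi_iff.2 fun j => ?_
  have e : (fun p : HermParam W × MatP W =>
      ((Matrix.of p.2 : Mat W) * (toHerm p.1)⁻¹ * (Matrix.of p.2 : Mat W)ᴴ) i j) =
      fun p => ∑ k, (∑ l, (Matrix.of p.2 : Mat W) i l * (toHerm p.1)⁻¹ l k) *
        (Matrix.of p.2 : Mat W)ᴴ k j := by
    funext p; simp only [Matrix.mul_apply]
  rw [e]
  refine Finset.measurable_sum _ fun k _ => (Finset.measurable_sum _ fun l _ => ?_).mul ?_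
  · exact ((measurable_matrix_apply i l).comp h2).mul ((measurable_matrix_apply l k).comp h1)
  · exact (measurable_matrix_apply k j).comp h3

/-- The self-energy `T γ⁻¹ Tᴴ` as a Hermitian parameter. -/
def sel (T : MatP W) (γ : HermParam W) : HermParam W :=
  fromHerm ((Matrix.of T : Mat W) * (toHerm γ)⁻¹ * (Matrix.of T : Mat W)ᴴ)

lemma toHerm_sel (T : MatP W) (γ : HermParam W) : toHerm (sel T γ) =
    (Matrix.of T : Mat W) * (toHerm γ)⁻¹ * (Matrix.of T : Mat W)ᴴ :=
  toHerm_fromHerm (by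
    have := isHermitian_mul_mul_conjTranspose (Matrix.of T : Mat W) (toHerm_isHermitian γ).inv
    exact this)

lemma measurable_sel : Measurable fun p : HermParam W × MatP W => sel p.2 p.1 :=
  measurable_fromHerm.comp measurable_conj_inv

/-- Fractional size of the self-energy. -/
def sefr (p : HermParam W × MatP W) : ℝ := Real.sqrt (Real.sqrt (hq (sel p.2 p.1)) / W)

@[fun_prop] lemma measurable_sefr : Measurable (sefr : HermParam W × MatP W → ℝ) := by
  have := measurable_hq.comp (measurable_sel (W := W))
  unfold sefr
  exact (this.sqrt.div_const _).sqrt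

lemma lintegral_sefr_inner (hW : 0 < W) (hM : ZM W ≠ ∞) (γ : HermParam W) :
    ∫⁻ T, ENNReal.ofReal (sefr (γ, T)) * gM W T ≤
      ENNReal.ofReal (Real.sqrt (Real.sqrt (fsq (toHerm γ)⁻¹) / W)) * (37 * ZM W) := by
  set R := (toHerm γ)⁻¹ with hR
  have hRh : R.IsHermitian := (toHerm_isHermitian _).inv
  have hf : ∀ T, hq (sel T γ) = fsq ((Matrix.of T : Mat W) * R * (Matrix.of T : Mat W)ᴴ) := by
    intro T; rw [hq, toHerm_sel]
  rcases (fsq_nonneg R).eq_or_lt with h0 | hpos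
  · have hR0 : R = 0 := fsq_eq_zero.1 h0.symm
    have : ∀ T, sefr (γ, T) = 0 := by intro T; simp [sefr, hf, hR0, fsq_zero]
    simp [this]
  have hW' : (0 : ℝ) < W := by exact_mod_cast hW
  have hpt : ∀ T, ENNReal.ofReal (sefr (γ, T)) * gM W T ≤
      ENNReal.ofReal (Real.sqrt (Real.sqrt (fsq R) / W)) *
        (gM W T + ENNReal.ofReal (1 / fsq R) *
          (ENNReal.ofReal (fsq ((Matrix.of T : Mat W) * R * (Matrix.of T : Mat W)ᴴ)) * gM W T)) := by
    intro T
    set B := fsq ((Matrix.of T : Mat W) * R * (Matrix.of T : Mat W)ᴴ) with hB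
    have hB0 : 0 ≤ B := fsq_nonneg _
    have h1 : sefr (γ, T) ≤ Real.sqrt (Real.sqrt (fsq R) / W) * (1 + 1 / fsq R * B) := by
      have e : sefr (γ, T) =
          Real.sqrt (Real.sqrt (fsq R) / W) * Real.sqrt (Real.sqrt (B / fsq R)) := by
        rw [← Real.sqrt_mul (by positivity)]
        unfold sefr
        simp only [hf, ← hB]
        congr 1
        rw [Real.sqrt_div hB0]
        have : Real.sqrt (fsq R) ≠ 0 := (Real.sqrt_pos.2 hpos).ne'
        field_simp
      rw [e]
      refine mul_le_mul_of_nonneg_left ?_ (Real.sqrt_nonneg _)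
      have hy : 0 ≤ B / fsq R := by positivity
      rw [show 1 / fsq R * B = B / fsq R by ring]
      set y := B / fsq R
      have s1 : Real.sqrt y ≤ 1 + y := by
        rw [Real.sqrt_le_left (by positivity)]; nlinarith
      rw [Real.sqrt_le_left (by positivity)]
      nlinarith
    calc _ ≤ ENNReal.ofReal (Real.sqrt (Real.sqrt (fsq R) / W) * (1 + 1 / fsq R * B)) * gM W T :=
          mul_le_mul_left (ENNReal.ofReal_le_ofReal h1) _
      _ = _ := by
          rw [ENNReal.ofReal_mul (by positivity), ENNReal.ofReal_add (by positivity) (by positivity),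
            ENNReal.ofReal_mul (by positivity), ENNReal.ofReal_one]
          ring
  refine (lintegral_mono (μ := volume) hpt).trans ?_
  rw [lintegral_const_mul' _ _ ENNReal.ofReal_ne_top]
  refine mul_le_mul_right ?_ _
  rw [lintegral_add_left measurable_gM, lintegral_const_mul' _ _ ENNReal.ofReal_ne_top]
  refine (add_le_add le_rfl (mul_le_mul_right (lintegral_fsq_conj_le hW hM hRh) _)).trans ?_
  rw [← mul_assoc, ← ENNReal.ofReal_mul (by positivity)]
  have : 1 / fsq R * (36 * fsq R) = 36 := by field_simp
  rw [this]
  change ZM W + _ ≤ _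
  rw [show ENNReal.ofReal 36 = 36 by norm_num]
  refine le_of_eq ?_
  ring

/-- Uniform single-site estimate for the self-energy. -/
lemma lintegral_sefr_le (hW : 0 < W) (hH : ZH W ≠ ∞) (hM : ZM W ≠ ∞) (a : HermParam W) :
    ∫⁻ γ, ∫⁻ T, ENNReal.ofReal (1 + sefr (γ, T)) * (gH W (γ + a) * gM W T) ≤
      111889 * (ZH W * ZM W) := by
  have hs0 : ∀ p : HermParam W × MatP W, 0 ≤ sefr p := fun p => Real.sqrt_nonneg _
  have h1 : ∀ γ : HermParam W,
      ∫⁻ T, ENNReal.ofReal (1 + sefr (γ, T)) * (gH W (γ + a) * gM W T) ≤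
      gH W (γ + a) * ZM W + (37 * ZM W) *
        (ENNReal.ofReal (Real.sqrt (Real.sqrt (fsq (toHerm γ)⁻¹) / W)) * gH W (γ + a)) := by
    intro γ
    have e : ∀ T, ENNReal.ofReal (1 + sefr (γ, T)) * (gH W (γ + a) * gM W T) =
        gH W (γ + a) * (gM W T + ENNReal.ofReal (sefr (γ, T)) * gM W T) := by
      intro T
      rw [ENNReal.ofReal_add (by norm_num) (hs0 _), ENNReal.ofReal_one]; ring
    simp only [e]
    rw [lintegral_const_mul' _ _ (gH_ne_top _), lintegral_add_left measurable_gM]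
    refine (mul_le_mul_right (add_le_add le_rfl (lintegral_sefr_inner hW hM γ)) _).trans
      (le_of_eq ?_)
    change gH W (γ + a) * (ZM W + _) = _
    ring
  refine (lintegral_mono (μ := volume) h1).trans ?_
  have hgm : Measurable fun γ : HermParam W => gH W (γ + a) * ZM W := by
    have : Measurable fun γ : HermParam W => gH W (γ + a) := measurable_gH.comp (by fun_prop)
    exact this.mul_const _
  rw [lintegral_add_left hgm, lintegral_mul_const' _ _ hM,
    lintegral_const_mul' _ _ (ENNReal.mul_ne_top (by simp) hM)]
  have h2 : ∫⁻ γ, gH W (γ + a) = ZH W := lintegral_add_right_eq_self (fun γ => gH W γ) a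
  have h3 : ∫⁻ γ, ENNReal.ofReal (Real.sqrt (Real.sqrt (fsq (toHerm γ)⁻¹) / W)) * gH W (γ + a) ≤
      3024 * ZH W := by
    refine le_trans (le_of_eq ?_) (lintegral_resolvent_le hW hH a)
    rw [← lintegral_add_right_eq_self (fun x : HermParam W =>
      ENNReal.ofReal (Real.sqrt (Real.sqrt (fsq (toHerm (x - a))⁻¹) / W)) * gH W x) a]
    simp only [add_sub_cancel_right]
  rw [h2]
  refine (add_le_add le_rfl (mul_le_mul_right h3 _)).trans (le_of_eq ?_)
  ring

end

section

variable {W : ℕ}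

lemma lintegral_fin_cons {E : Type*} [MeasureSpace E] [SigmaFinite (volume : Measure E)] {m : ℕ}
    {f : (Fin (m + 1) → E) → ℝ≥0∞} (hf : Measurable f) :
    ∫⁻ γ, f γ = ∫⁻ g, ∫⁻ γ' : Fin m → E, f (Fin.cons g γ') := by
  have h := (volume_preserving_piFinSuccAbove (fun _ : Fin (m + 1) => E) 0).symm
  rw [← h.lintegral_comp hf]
  have hm : Measurable fun p => f ((MeasurableEquiv.piFinSuccAbove (fun _ : Fin (m + 1) => E) 0).symm p) :=
    hf.comp (MeasurableEquiv.measurable _)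
  have e : ∫⁻ p : E × (Fin m → E), f ((MeasurableEquiv.piFinSuccAbove (fun _ : Fin (m + 1) => E) 0).symm p) =
      ∫⁻ g, ∫⁻ γ' : Fin m → E,
        f ((MeasurableEquiv.piFinSuccAbove (fun _ : Fin (m + 1) => E) 0).symm (g, γ')) :=
    lintegral_prod _ hm.aemeasurable
  refine Eq.trans e ?_
  refine lintegral_congr fun g => lintegral_congr fun γ' => ?_
  congr 1
  exact Fin.insertNth_zero' g γ'

lemma measurable_fin_cons {E : Type*} [MeasurableSpace E] {m : ℕ} :
    Measurable fun p : E × (Fin m → E) => (Fin.cons p.1 p.2 : Fin (m + 1) → E) := by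
  refine measurable_pi_iff.2 fun j => ?_
  refine Fin.cases ?_ (fun j => ?_) j
  · simpa using measurable_fst
  · simp only [Fin.cons_succ]; fun_prop

/-- The shift between the Schur complements and the diagonal blocks. -/
def bvec {m : ℕ} (a e : HermParam W) (T : Fin m → MatP W) (γ : Fin (m + 1) → HermParam W) :
    Fin (m + 1) → HermParam W :=
  Fin.cons a fun j => e + sel (T j) (γ j.castSucc)

/-- Diagonal blocks expressed through the Schur complements. -/
def xof {m : ℕ} (a e : HermParam W) (T : Fin m → MatP W) (γ : Fin (m + 1) → HermParam W) :
    Fin (m + 1) → HermParam W := fun j => γ j + bvec a e T γ j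

lemma xof_cons {m : ℕ} (a e : HermParam W) (t : MatP W) (T : Fin m → MatP W) (g : HermParam W)
    (γ : Fin (m + 1) → HermParam W) :
    xof a e (Fin.cons t T) (Fin.cons g γ) = Fin.cons (g + a) (xof (e + sel t g) e T γ) := by
  funext j
  refine Fin.cases ?_ (fun j => ?_) j
  · simp [xof, bvec]
  · simp only [xof, bvec, Fin.cons_succ]
    refine Fin.cases ?_ (fun j => ?_) j
    · simp
    · simp only [Fin.cons_succ, ← Fin.succ_castSucc]

lemma measurable_xof {m : ℕ} (e : HermParam W) :
    Measurable fun p : HermParam W × (Fin m → MatP W) × (Fin (m + 1) → HermParam W) =>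
      xof p.1 e p.2.1 p.2.2 := by
  refine measurable_pi_iff.2 fun j => ?_
  have hadd : Measurable fun p : HermParam W × HermParam W => p.1 + p.2 :=
    continuous_add.measurable
  have h1 : Measurable fun p : HermParam W × (Fin m → MatP W) × (Fin (m + 1) → HermParam W) =>
      p.2.2 j := by fun_prop
  have h2 : Measurable fun p : HermParam W × (Fin m → MatP W) × (Fin (m + 1) → HermParam W) =>
      bvec p.1 e p.2.1 p.2.2 j := by
    refine Fin.cases ?_ (fun j => ?_) j
    · simpa [bvec] using measurable_fst
    · simp only [bvec, Fin.cons_succ]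
      have h3 : Measurable fun p : HermParam W × (Fin m → MatP W) × (Fin (m + 1) → HermParam W) =>
        (p.2.2 j.castSucc, p.2.1 j) := by fun_prop
      exact hadd.comp ((measurable_const (a := e)).prodMk (measurable_sel.comp h3))
  exact hadd.comp (h1.prodMk h2)

/-- The passage from Schur complements to diagonal blocks preserves Lebesgue measure. -/
lemma lintegral_xof {m : ℕ} (a e : HermParam W) (T : Fin m → MatP W)
    {f : (Fin (m + 1) → HermParam W) → ℝ≥0∞} (hf : Measurable f) :
    ∫⁻ γ, f (xof a e T γ) = ∫⁻ x, f x := by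
  induction m generalizing a with
  | zero =>
    have : ∀ γ : Fin 1 → HermParam W, xof a e T γ = γ + fun _ => a := by
      intro γ; funext j; fin_cases j; simp [xof, bvec]
    simp only [this]
    exact lintegral_add_right_eq_self f _
  | succ m ih =>
    rw [← Fin.cons_self_tail T]
    set t := T 0
    set T' := Fin.tail T
    have hm : Measurable fun γ => f (xof a e (Fin.cons t T' : Fin (m + 1) → MatP W) γ) :=
      hf.comp ((measurable_xof e).comp (measurable_const.prodMk
        (measurable_const.prodMk measurable_id)))
    rw [lintegral_fin_cons hm, lintegral_fin_cons hf]
    simp only [xof_cons]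
    have h1 : ∀ g : HermParam W, ∫⁻ γ' : Fin (m + 1) → HermParam W,
        f (Fin.cons (g + a) (xof (e + sel t g) e T' γ')) =
        ∫⁻ x : Fin (m + 1) → HermParam W, f (Fin.cons (g + a) x) := by
      intro g
      exact ih (e + sel t g) T' (f := fun x => f (Fin.cons (g + a) x))
        (hf.comp (measurable_fin_cons.comp (measurable_const.prodMk measurable_id)))
    simp only [h1]
    exact lintegral_add_right_eq_self
      (fun g : HermParam W => ∫⁻ x : Fin (m + 1) → HermParam W, f (Fin.cons g x)) a

/-- Product Gaussian weight. -/
def wt {m k : ℕ} (x : Fin k → HermParam W) (T : Fin m → MatP W) : ℝ≥0∞ :=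
  (∏ j, gH W (x j)) * ∏ j, gM W (T j)

lemma measurable_sel_left (g : HermParam W) : Measurable fun t : MatP W => sel t g := by
  have h1 : Measurable fun t : MatP W => ((g, t) : HermParam W × MatP W) := by fun_prop
  have h := Measurable.comp (measurable_sel (W := W)) h1
  simpa only [Function.comp_def] using h

lemma measurable_wt_xof {m : ℕ} (a e : HermParam W) :
    Measurable fun p : (Fin (m + 1) → HermParam W) × (Fin m → MatP W) =>
      wt (xof a e p.2 p.1) p.2 := by
  have h1 : Measurable fun p : (Fin (m + 1) → HermParam W) × (Fin m → MatP W) =>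
      xof a e p.2 p.1 := (measurable_xof e).comp
        (measurable_const.prodMk (measurable_snd.prodMk measurable_fst))
  unfold wt
  refine Measurable.mul ?_ ?_
  · exact Finset.measurable_prod _ fun j _ => measurable_gH.comp ((measurable_pi_apply j).comp h1)
  · exact Finset.measurable_prod _ fun j _ =>
      measurable_gM.comp ((measurable_pi_apply j).comp measurable_snd)

lemma measurable_chain {ψ : HermParam W × MatP W → ℝ≥0∞} (hψ : Measurable ψ) {m : ℕ}
    (a e : HermParam W) :
    Measurable fun p : (Fin (m + 1) → HermParam W) × (Fin m → MatP W) =>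
      (∏ j : Fin m, ψ (p.1 j.castSucc, p.2 j)) * wt (xof a e p.2 p.1) p.2 := by
  refine Measurable.mul ?_ (measurable_wt_xof a e)
  exact Finset.measurable_prod _ fun j _ => hψ.comp (by fun_prop)

set_option maxHeartbeats 400000 in
/-- Multiplicative functionals of the chain have exponentially bounded expectation. -/
lemma lintegral_chain_le {ψ : HermParam W × MatP W → ℝ≥0∞} (hψ : Measurable ψ) {c : ℝ≥0∞}
    (h : ∀ a : HermParam W, ∫⁻ γ, ∫⁻ T, ψ (γ, T) * (gH W (γ + a) * gM W T) ≤ c) {m : ℕ}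
    (a e : HermParam W) :
    ∫⁻ γ : Fin (m + 1) → HermParam W, ∫⁻ T : Fin m → MatP W,
      (∏ j, ψ (γ j.castSucc, T j)) * wt (xof a e T γ) T ≤ c ^ m * ZH W := by
  induction m generalizing a with
  | zero =>
    have e1 : ∀ γ : Fin 1 → HermParam W, ∫⁻ T : Fin 0 → MatP W,
        (∏ j : Fin 0, ψ (γ j.castSucc, T j)) * wt (xof a e T γ) T =
        gH W (γ 0 + a) := by
      intro γ
      simp only [volume_pi, Measure.pi_of_empty _ (fun i => Fin.elim0 i : Fin 0 → MatP W)]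
      simp [wt, xof, bvec, -lintegral_const]
    have hm : Measurable fun γ : Fin 1 → HermParam W => gH W (γ 0 + a) := by
      refine measurable_gH.comp ?_
      exact (measurable_add_const a).comp (measurable_pi_apply 0)
    simp only [e1]
    rw [lintegral_fin_cons hm]
    have e2 : ∫⁻ γ, gH W (γ + a) = ZH W := lintegral_add_right_eq_self (fun γ => gH W γ) a
    have e3 : ∀ g : HermParam W, ∫⁻ γ' : Fin 0 → HermParam W,
        gH W ((Fin.cons g γ' : Fin 1 → HermParam W) 0 + a) = gH W (g + a) := by
      intro g
      simp only [volume_pi, Measure.pi_of_empty _ (fun i => Fin.elim0 i : Fin 0 → HermParam W)]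
      simp
    simp only [e3, e2]
    simp
  | succ m ih =>
    have hF := measurable_chain hψ (m := m + 1) a e
    have hI : ∀ a', Measurable fun p : (Fin (m + 1) → HermParam W) × (Fin m → MatP W) =>
      (∏ j : Fin m, ψ (p.1 j.castSucc, p.2 j)) * wt (xof a' e p.2 p.1) p.2 :=
      fun a' => measurable_chain hψ a' e
    have hFg := hF.lintegral_prod_right' (ν := volume)
    rw [lintegral_fin_cons hFg]
    have key : ∀ g : HermParam W, ∫⁻ γ' : Fin (m + 1) → HermParam W,
        ∫⁻ T : Fin (m + 1) → MatP W,
        (∏ j, ψ ((Fin.cons g γ' : Fin (m + 2) → HermParam W) j.castSucc, T j)) *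
          wt (xof a e T (Fin.cons g γ')) T ≤
        ∫⁻ t, (ψ (g, t) * (gH W (g + a) * gM W t)) * (c ^ m * ZH W) := by
      intro g
      have hc : ∀ γ' : Fin (m + 1) → HermParam W, Measurable fun T : Fin (m + 1) → MatP W =>
          (∏ j, ψ ((Fin.cons g γ' : Fin (m + 2) → HermParam W) j.castSucc, T j)) *
          wt (xof a e T (Fin.cons g γ')) T := fun γ' =>
        hF.comp (measurable_prodMk_left (x := (Fin.cons g γ' : Fin (m + 2) → HermParam W)))
      have e1 : ∀ γ' : Fin (m + 1) → HermParam W, ∫⁻ T : Fin (m + 1) → MatP W,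
          (∏ j, ψ ((Fin.cons g γ' : Fin (m + 2) → HermParam W) j.castSucc, T j)) *
            wt (xof a e T (Fin.cons g γ')) T =
          ∫⁻ t, ∫⁻ T' : Fin m → MatP W, (ψ (g, t) * (gH W (g + a) * gM W t)) *
            ((∏ j : Fin m, ψ (γ' j.castSucc, T' j)) * wt (xof (e + sel t g) e T' γ') T') := by
        intro γ'
        rw [lintegral_fin_cons (hc γ')]
        refine lintegral_congr fun t => lintegral_congr fun T' => ?_
        rw [xof_cons]
        simp only [wt, Fin.prod_univ_succ (n := m), Fin.prod_univ_succ (n := m + 1),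
          Fin.cons_zero, Fin.cons_succ, Fin.castSucc_zero, ← Fin.succ_castSucc]
        ring
      simp only [e1]
      have hj : Measurable fun p : ((Fin (m + 1) → HermParam W) × MatP W) × (Fin m → MatP W) =>
          (ψ (g, p.1.2) * (gH W (g + a) * gM W p.1.2)) *
            ((∏ j : Fin m, ψ (p.1.1 j.castSucc, p.2 j)) *
              wt (xof (e + sel p.1.2 g) e p.2 p.1.1) p.2) := by
        have a1 : Measurable fun p : ((Fin (m + 1) → HermParam W) × MatP W) × (Fin m → MatP W) =>
          ψ (g, p.1.2) := hψ.comp (by fun_prop)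
        have a2 : Measurable fun p : ((Fin (m + 1) → HermParam W) × MatP W) × (Fin m → MatP W) =>
          gM W p.1.2 := measurable_gM.comp (by fun_prop)
        have a3 : Measurable fun p : ((Fin (m + 1) → HermParam W) × MatP W) × (Fin m → MatP W) =>
          ∏ j : Fin m, ψ (p.1.1 j.castSucc, p.2 j) :=
          Finset.measurable_prod _ fun j _ => hψ.comp (by fun_prop)
        have a4 : Measurable fun p : ((Fin (m + 1) → HermParam W) × MatP W) × (Fin m → MatP W) =>
          xof (e + sel p.1.2 g) e p.2 p.1.1 := by
          have b0 : Measurable fun t : MatP W => sel t g :=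
            measurable_sel_left g
          have b1 : Measurable fun p : ((Fin (m + 1) → HermParam W) × MatP W) × (Fin m → MatP W) =>
            sel p.1.2 g := b0.comp (measurable_snd.comp measurable_fst)
          have b2 : Measurable fun p : ((Fin (m + 1) → HermParam W) × MatP W) × (Fin m → MatP W) =>
            e + sel p.1.2 g := (measurable_const_add e).comp b1
          have b3 : Measurable fun p :
              ((Fin (m + 1) → HermParam W) × MatP W) × (Fin m → MatP W) =>
              (e + sel p.1.2 g, p.2, p.1.1) :=
            b2.prodMk (measurable_snd.prodMk (measurable_fst.comp measurable_fst))
          exact (measurable_xof e).comp b3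
        have a5 : Measurable fun p : ((Fin (m + 1) → HermParam W) × MatP W) × (Fin m → MatP W) =>
          wt (xof (e + sel p.1.2 g) e p.2 p.1.1) p.2 := by
          unfold wt
          refine Measurable.mul ?_ ?_
          · exact Finset.measurable_prod _ fun j _ =>
              measurable_gH.comp ((measurable_pi_apply j).comp a4)
          · exact Finset.measurable_prod _ fun j _ =>
              measurable_gM.comp ((measurable_pi_apply j).comp measurable_snd)
        exact (a1.mul (a2.const_mul _)).mul (a3.mul a5)
      have hj2 := hj.lintegral_prod_right' (ν := volume)
      rw [lintegral_lintegral_swap hj2.aemeasurable]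
      refine lintegral_mono (μ := volume) fun t => ?_
      have b1 : ∀ γ' : Fin (m + 1) → HermParam W, ∫⁻ T' : Fin m → MatP W,
          (ψ (g, t) * (gH W (g + a) * gM W t)) *
            ((∏ j : Fin m, ψ (γ' j.castSucc, T' j)) * wt (xof (e + sel t g) e T' γ') T') =
          (ψ (g, t) * (gH W (g + a) * gM W t)) * ∫⁻ T' : Fin m → MatP W,
            ((∏ j : Fin m, ψ (γ' j.castSucc, T' j)) * wt (xof (e + sel t g) e T' γ') T') :=
        fun γ' => lintegral_const_mul _ ((hI _).comp (measurable_const.prodMk measurable_id))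
      simp only [b1]
      rw [lintegral_const_mul _ ((hI (e + sel t g)).lintegral_prod_right' (ν := volume))]
      exact mul_le_mul_right (ih _) _
    refine (lintegral_mono (μ := volume) key).trans ?_
    have hsm : ∀ g, Measurable fun t => ψ (g, t) * (gH W (g + a) * gM W t) := fun g =>
      (hψ.comp (measurable_const.prodMk measurable_id)).mul (measurable_gM.const_mul _)
    have hsj : Measurable fun p : HermParam W × MatP W =>
        ψ (p.1, p.2) * (gH W (p.1 + a) * gM W p.2) :=
      (hψ.comp (by fun_prop)).mul ((measurable_gH.comp ((measurable_add_const a).comp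
        measurable_fst)).mul (measurable_gM.comp measurable_snd))
    have e4 : ∀ g, ∫⁻ t, (ψ (g, t) * (gH W (g + a) * gM W t)) * (c ^ m * ZH W) =
        (∫⁻ t, (ψ (g, t) * (gH W (g + a) * gM W t))) * (c ^ m * ZH W) := fun g =>
      lintegral_mul_const _ (hsm g)
    simp only [e4]
    rw [lintegral_mul_const _ hsj.lintegral_prod_right', pow_succ]
    refine (mul_le_mul_left (h a) _).trans (le_of_eq (by ring))

end

section

section opNormAPI
variable {ι : Type*} [Fintype ι] [DecidableEq ι]

lemma opNorm_nonneg (M : Matrix ι ι ℂ) : 0 ≤ opNorm M := norm_nonneg _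

lemma opNorm_smul (c : ℂ) (M : Matrix ι ι ℂ) : opNorm (c • M) = ‖c‖ * opNorm M := by
  unfold opNorm
  rw [map_smul, norm_smul]

lemma opNorm_eq_zero {M : Matrix ι ι ℂ} : opNorm M = 0 ↔ M = 0 := by
  unfold opNorm
  rw [norm_eq_zero, EmbeddingLike.map_eq_zero_iff]

lemma opNorm_single (i j : ι) (c : ℂ) : opNorm (Matrix.single i j c) ≤ ‖c‖ := by
  unfold opNorm
  refine ContinuousLinearMap.opNorm_le_bound _ (norm_nonneg _) fun v => ?_
  rw [EuclideanSpace.norm_eq, EuclideanSpace.norm_eq]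
  have : ∀ k, ((toEuclideanCLM (𝕜 := ℂ) (Matrix.single i j c)) v) k = if k = i then c * v j else 0 := by
    intro k
    have : ((toEuclideanCLM (𝕜 := ℂ) (Matrix.single i j c)) v) k =
      ((Matrix.single i j c) *ᵥ v.ofLp) k := rfl
    rw [this, Matrix.single_mulVec]
    by_cases h : k = i
    · subst h; simp
    · simp [h]
  simp only [this]
  have e : ∑ k, ‖(if k = i then c * v j else 0)‖ ^ 2 = (‖c‖ * ‖v j‖) ^ 2 := by
    rw [Finset.sum_eq_single i]
    · simp
    · intro b _ hb; simp [hb]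
    · simp
  rw [e, Real.sqrt_sq (by positivity)]
  refine mul_le_mul_of_nonneg_left ?_ (norm_nonneg _)
  refine Real.le_sqrt_of_sq_le ?_
  exact Finset.single_le_sum (f := fun k => ‖v k‖ ^ 2) (fun k _ => by positivity) (Finset.mem_univ j)

lemma opNorm_sum_le {κ : Type*} (s : Finset κ) (f : κ → Matrix ι ι ℂ) :
    opNorm (∑ k ∈ s, f k) ≤ ∑ k ∈ s, opNorm (f k) := by
  unfold opNorm
  rw [map_sum]; exact norm_sum_le _ _

lemma opNorm_le_sum (M : Matrix ι ι ℂ) : opNorm M ≤ ∑ i, ∑ j, ‖M i j‖ := by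
  conv_lhs => rw [Matrix.matrix_eq_sum_single M]
  refine (opNorm_sum_le _ _).trans (Finset.sum_le_sum fun i _ => ?_)
  refine (opNorm_sum_le _ _).trans (Finset.sum_le_sum fun j _ => opNorm_single _ _ _)

lemma continuous_opNorm : Continuous (opNorm : Matrix ι ι ℂ → ℝ) := by
  unfold opNorm
  refine continuous_norm.comp ?_
  exact LinearMap.continuous_of_finiteDimensional
    ((toEuclideanCLM (𝕜 := ℂ) (n := ι)).toAlgEquiv.toLinearMap)

@[fun_prop] lemma measurable_opNorm : Measurable (opNorm : Matrix ι ι ℂ → ℝ) :=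
  continuous_opNorm.measurable

end opNormAPI

variable {W : ℕ}

/-- Transfer product in the Schur complement coordinates. -/
def gprod (Γ T : ℕ → Mat W) : ℕ → Mat W
  | 0 => (Γ 0)⁻¹
  | m + 1 => gprod Γ T m * (T m)ᴴ * (Γ (m + 1))⁻¹

lemma gprod_smul {Γ T Γ' T' : ℕ → Mat W} {a c : ℕ → ℂ} (m : ℕ)
    (hΓ : ∀ j ≤ m, IsUnit (Γ j).det) (ha : ∀ j, a j ≠ 0)
    (h1 : ∀ j ≤ m, Γ' j = a j • Γ j) (h2 : ∀ j < m, (T' j)ᴴ = c j • (T j)ᴴ) :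
    gprod Γ' T' m = ((∏ j ∈ Finset.range m, c j) * (∏ j ∈ Finset.range (m + 1), a j)⁻¹) •
      gprod Γ T m := by
  have hinv : ∀ j ≤ m, (Γ' j)⁻¹ = (a j)⁻¹ • (Γ j)⁻¹ := by
    intro j hj
    rw [h1 j hj]
    have := Matrix.inv_smul' (Γ j) (Units.mk0 (a j) (ha j)) (hΓ j hj)
    simpa [Units.smul_def] using this
  induction m with
  | zero => simp [gprod, hinv]
  | succ m ih =>
    rw [gprod, ih (fun j hj => hΓ j (by omega)) (fun j hj => h1 j (by omega))
      (fun j hj => h2 j (by omega)) (fun j hj => hinv j (by omega)), h2 m (by omega),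
      hinv (m + 1) le_rfl, Finset.prod_range_succ c m, Finset.prod_range_succ a (m + 1), gprod]
    simp only [Matrix.smul_mul, Matrix.mul_smul, smul_smul]
    congr 1
    rw [mul_inv]
    ring

lemma isUnit_gprod {Γ T : ℕ → Mat W} (m : ℕ)
    (hΓ : ∀ j ≤ m, IsUnit (Γ j).det) (hT : ∀ j < m, IsUnit (T j).det) :
    IsUnit (gprod Γ T m).det := by
  have h (M : Mat W) (h : IsUnit M.det) : IsUnit (M⁻¹).det := by
    rw [Matrix.det_nonsing_inv]; exact h.ringInverse
  induction m with
  | zero => exact h _ (hΓ 0 le_rfl)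
  | succ m ih =>
    rw [gprod, det_mul, det_mul]
    refine ((ih (fun j hj => hΓ j (by omega)) fun j hj => hT j (by omega)).mul ?_).mul
      (h _ (hΓ _ le_rfl))
    rw [det_conjTranspose]
    exact (hT m (by omega)).star

/-- Block Gaussian elimination. -/
lemma block_elimination {m : ℕ} {Γ T : ℕ → Mat W} {v f : ℕ → Fin W → ℂ}
    (hΓ : ∀ j ≤ m, IsUnit (Γ j).det)
    (h0 : Γ 0 *ᵥ v 0 - (T 0)ᴴ *ᵥ v 1 = f 0)
    (hs : ∀ j < m, (Γ (j + 1) + T j * (Γ j)⁻¹ * (T j)ᴴ) *ᵥ v (j + 1) - T j *ᵥ v j -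
      (T (j + 1))ᴴ *ᵥ v (j + 2) = f (j + 1))
    (hf : ∀ j < m, f j = 0) : ∀ j ≤ m, Γ j *ᵥ v j = (T j)ᴴ *ᵥ v (j + 1) + f j := by
  intro j
  induction j with
  | zero => intro _; rw [← h0]; abel
  | succ j ih =>
    intro hj
    have h1 := ih (by omega)
    rw [hf j (by omega), add_zero] at h1
    have h2 : T j *ᵥ v j = (T j * (Γ j)⁻¹ * (T j)ᴴ) *ᵥ v (j + 1) := by
      rw [← mulVec_mulVec, ← h1, mulVec_mulVec, Matrix.mul_assoc,
        Matrix.nonsing_inv_mul _ (hΓ j (by omega)), Matrix.mul_one]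
    rw [← hs j (by omega), add_mulVec, h2]
    abel

lemma gprod_mulVec {m : ℕ} {Γ T : ℕ → Mat W} {v f : ℕ → Fin W → ℂ}
    (hΓ : ∀ j ≤ m, IsUnit (Γ j).det)
    (h : ∀ j ≤ m, Γ j *ᵥ v j = (T j)ᴴ *ᵥ v (j + 1) + f j)
    (hf : ∀ j < m, f j = 0) : ∀ j ≤ m, gprod Γ T j *ᵥ (Γ j *ᵥ v j) = v 0 := by
  intro j
  induction j with
  | zero =>
    intro _
    rw [gprod, mulVec_mulVec, Matrix.nonsing_inv_mul _ (hΓ 0 (by omega)), one_mulVec]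
  | succ j ih =>
    intro hj
    rw [gprod, mulVec_mulVec, Matrix.mul_assoc, Matrix.nonsing_inv_mul _ (hΓ _ hj), Matrix.mul_one,
      ← ih (by omega), h j (by omega), hf j (by omega), add_zero, mulVec_mulVec]

lemma eq_zero_of_elimination {m : ℕ} {Γ T : ℕ → Mat W} {v : ℕ → Fin W → ℂ}
    (hΓ : ∀ j ≤ m, IsUnit (Γ j).det)
    (h : ∀ j ≤ m, Γ j *ᵥ v j = (T j)ᴴ *ᵥ v (j + 1)) (hv : v (m + 1) = 0) :
    ∀ j ≤ m, v j = 0 := by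
  have key : ∀ k ≤ m + 1, v (m + 1 - k) = 0 := by
    intro k
    induction k with
    | zero => intro _; exact hv
    | succ k ih =>
      intro hk
      have h1 := h (m + 1 - (k + 1)) (by omega)
      rw [show m + 1 - (k + 1) + 1 = m + 1 - k by omega, ih (by omega), mulVec_zero] at h1
      have h2 := congrArg (fun u => (Γ (m + 1 - (k + 1)))⁻¹ *ᵥ u) h1
      simpa only [mulVec_mulVec, Matrix.nonsing_inv_mul _ (hΓ (m + 1 - (k + 1)) (by omega)),
        one_mulVec, mulVec_zero] using h2
  intro j hj
  have := key (m + 1 - j) (by omega)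
  rwa [show m + 1 - (m + 1 - j) = j by omega] at this

/-- Zero-extended block components of a vector. -/
def blk {n : ℕ} (v : Fin n × Fin W → ℂ) (j : ℕ) : Fin W → ℂ :=
  if h : j < n then fun a => v (⟨j, h⟩, a) else 0

lemma ham_row {n : ℕ} (V T : ℕ → Mat W) (z : ℂ) (v : Fin n × Fin W → ℂ) (j : Fin n) :
    (fun a => ((ham n W V T - z • 1) *ᵥ v) (j, a)) =
      (V j - z • 1) *ᵥ blk v j - (if (j : ℕ) = 0 then 0 else T (j - 1) *ᵥ blk v (j - 1)) -
        (T j)ᴴ *ᵥ blk v (j + 1) := by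
  have hent : ∀ (a : Fin W) (k : Fin n) (b : Fin W), (ham n W V T - z • 1) (j, a) (k, b) =
      (if (k : ℕ) = j then (V j - z • 1) a b else 0) +
      (if (k : ℕ) + 1 = j then - T (j - 1) a b else 0) +
      (if (k : ℕ) = j + 1 then - (T j)ᴴ a b else 0) := by
    intro a k b
    simp only [ham, Matrix.sub_apply, Matrix.smul_apply, Matrix.of_apply, Matrix.neg_apply]
    by_cases h1 : (j : ℕ) = k
    · have : j = k := Fin.ext h1
      subst this
      simp [Matrix.one_apply, Prod.ext_iff]
    · have h1' : j ≠ k := fun h => h1 (by rw [h])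
      have h1'' : ¬ (k : ℕ) = j := fun h => h1 h.symm
      by_cases h2 : (j : ℕ) = k + 1
      · have h3 : ¬ (k : ℕ) = j + 1 := by omega
        simp [h2, Prod.ext_iff, h1']
        omega
      · have h2' : ¬ (k : ℕ) + 1 = j := fun h => h2 h.symm
        by_cases h3 : (k : ℕ) = j + 1
        · rw [if_neg h1, if_neg h2, if_pos h3, if_neg h1'', if_neg h2']
          simp [Prod.ext_iff, h1']
        · simp [h1, h1'', h2, h2', h3, Prod.ext_iff, h1']
  funext a
  simp only [mulVec, dotProduct, Fintype.sum_prod_type, hent, add_mul, Finset.sum_add_distrib]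
  have hA : ∀ (i : ℕ) (M : Mat W), ∑ k : Fin n, ∑ b, (if (k : ℕ) = i then M a b else 0) * v (k, b) =
      (M *ᵥ blk v i) a := by
    intro i M
    by_cases hi : i < n
    · rw [Finset.sum_eq_single ⟨i, hi⟩]
      · simp [mulVec, dotProduct, blk, hi]
      · intro k _ hk
        have : ¬ (k : ℕ) = i := fun h => hk (Fin.ext h)
        simp [this]
      · simp
    · have : ∀ k : Fin n, ¬ (k : ℕ) = i := fun k => by have := k.2; omega
      simp [this, blk, hi]
  have hB : ∑ k : Fin n, ∑ b, (if (k : ℕ) + 1 = j then - T (j - 1) a b else 0) * v (k, b) =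
      - (if (j : ℕ) = 0 then (0 : Fin W → ℂ) else T (j - 1) *ᵥ blk v (j - 1)) a := by
    by_cases h0 : (j : ℕ) = 0
    · simp [h0]
    · have : ∀ k : Fin n, ((k : ℕ) + 1 = j) = ((k : ℕ) = j - 1) := by
        intro k; apply propext; omega
      simp only [this]
      have := hA (j - 1) (- T (j - 1))
      simp only [Matrix.neg_apply] at this
      rw [this, if_neg h0, neg_mulVec]; rfl
  have hC := hA (j + 1) (-(T j)ᴴ)
  simp only [Matrix.neg_apply] at hC
  rw [hA, hB, hC, neg_mulVec]
  simp only [Pi.sub_apply, Pi.neg_apply]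
  change _ = ((V ↑j - z • 1) *ᵥ blk v ↑j) a - _ - ((T ↑j)ᴴ *ᵥ blk v (↑j + 1)) a
  ring

lemma Vm_of_lt {n : ℕ} (ω : ΩW n W) {j : ℕ} (h : j < n) : Vm ω j = toHerm (ω.1 ⟨j, h⟩) :=
  dif_pos h

lemma Tm_of_lt {m : ℕ} (ω : ΩW (m + 1) W) {j : ℕ} (h : j < m) :
    Tm ω j = Matrix.of (ω.2 ⟨j, h⟩) := dif_pos h

/-- The real scalar matrix `z • 1` as a Hermitian parameter. -/
def zpar (W : ℕ) (z : ℝ) : HermParam W := fromHerm ((z : ℂ) • 1)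

lemma toHerm_zpar (z : ℝ) : toHerm (zpar W z) = (z : ℂ) • 1 := by
  refine toHerm_fromHerm ?_
  rw [Matrix.IsHermitian, conjTranspose_smul, conjTranspose_one]
  simp

/-- The configuration of the model with given Schur complements. -/
def conf (z : ℝ) {m : ℕ} (p : ΩW (m + 1) W) : ΩW (m + 1) W :=
  (xof (zpar W z) (zpar W z) p.2 p.1, p.2)

lemma Tm_conf (z : ℝ) {m : ℕ} (p : ΩW (m + 1) W) (j : ℕ) : Tm (conf z p) j = Tm p j := rfl

lemma Vm_conf_zero (z : ℝ) {m : ℕ} (p : ΩW (m + 1) W) :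
    Vm (conf z p) 0 - (z : ℂ) • 1 = Vm p 0 := by
  rw [Vm_of_lt _ (Nat.succ_pos m), Vm_of_lt _ (Nat.succ_pos m)]
  simp only [conf, xof, bvec, toHerm_add]
  erw [Fin.cons_zero]
  rw [toHerm_zpar, add_sub_cancel_right]

lemma Vm_conf_succ (z : ℝ) {m : ℕ} (p : ΩW (m + 1) W) {j : ℕ} (hj : j < m) :
    Vm (conf z p) (j + 1) - (z : ℂ) • 1 =
      Vm p (j + 1) + Tm p j * (Vm p j)⁻¹ * (Tm p j)ᴴ := by
  rw [Vm_of_lt _ (show j + 1 < m + 1 by omega), Vm_of_lt _ (show j + 1 < m + 1 by omega),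
    Vm_of_lt _ (show j < m + 1 by omega), Tm_of_lt _ hj]
  have : (⟨j + 1, by omega⟩ : Fin (m + 1)) = Fin.succ ⟨j, hj⟩ := rfl
  simp only [conf, xof, bvec, toHerm_add, this, Fin.cons_succ, toHerm_zpar, toHerm_sel]
  rw [add_comm, add_sub_assoc]
  have h2 : (⟨j, hj⟩ : Fin m).castSucc = (⟨j, by omega⟩ : Fin (m + 1)) := rfl
  rw [h2]
  abel

lemma ham_mulVec_elimination (z : ℝ) {m : ℕ} (p : ΩW (m + 1) W)
    (hΓ : ∀ j ≤ m, IsUnit (Vm p j).det) (v f : Fin (m + 1) × Fin W → ℂ)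
    (h : (hamOf (conf z p) - (z : ℂ) • 1) *ᵥ v = f) (hf : ∀ j < m, blk f j = 0) :
    ∀ j ≤ m, Vm p j *ᵥ blk v j = (Tm p j)ᴴ *ᵥ blk v (j + 1) + blk f j := by
  have hrow : ∀ j (hj : j < m + 1), blk f j =
      (Vm (conf z p) j - (z : ℂ) • 1) *ᵥ blk v j -
        (if j = 0 then 0 else Tm p (j - 1) *ᵥ blk v (j - 1)) -
        (Tm p j)ᴴ *ᵥ blk v (j + 1) := by
    intro j hj
    have := ham_row (Vm (conf z p)) (Tm (conf z p)) (z : ℂ) v ⟨j, hj⟩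
    change (fun a => ((hamOf (conf z p) - (z : ℂ) • 1) *ᵥ v) (⟨j, hj⟩, a)) = _ at this
    rw [h] at this
    simp only [blk, hj, dif_pos, Tm_conf] at this ⊢
    exact this
  refine block_elimination hΓ ?_ ?_ hf
  · rw [hrow 0 (by omega), Vm_conf_zero]; simp
  · intro j hj
    rw [hrow (j + 1) (by omega), Vm_conf_succ _ _ hj]
    simp

lemma isUnit_ham (z : ℝ) {m : ℕ} (p : ΩW (m + 1) W) (hΓ : ∀ j ≤ m, IsUnit (Vm p j).det) :
    IsUnit (hamOf (conf z p) - (z : ℂ) • 1).det := by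
  rw [← Matrix.isUnit_iff_isUnit_det, ← Matrix.mulVec_injective_iff_isUnit]
  refine (injective_iff_map_eq_zero (Matrix.mulVecLin
    (hamOf (conf z p) - (z : ℂ) • 1))).2 fun v hv => ?_
  have hb0 : ∀ j, blk (0 : Fin (m + 1) × Fin W → ℂ) j = 0 := by
    intro j; unfold blk; split_ifs <;> rfl
  have h1 := ham_mulVec_elimination z p hΓ v 0 hv (fun j _ => hb0 j)
  simp only [hb0, add_zero] at h1
  have h2 := eq_zero_of_elimination hΓ h1 (by simp [blk])
  funext ⟨j, a⟩
  have h3 := congrFun (h2 j (by have := j.2; omega)) a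
  simpa [blk, show (j : ℕ) ≤ m by have := j.2; omega] using h3

/-- The corner block of the resolvent as a product in the Schur complement coordinates. -/
lemma Gblock_conf (z : ℝ) {m : ℕ} (p : ΩW (m + 1) W) (hΓ : ∀ j ≤ m, IsUnit (Vm p j).det) :
    Gblock (conf z p) (z : ℂ) 0 (Fin.last m) = gprod (Vm p) (Tm p) m := by
  ext a b
  set K := hamOf (conf z p) - (z : ℂ) • 1 with hK
  set f : Fin (m + 1) × Fin W → ℂ := Pi.single (Fin.last m, b) 1 with hf
  set v := K⁻¹ *ᵥ f with hv
  have hKv : K *ᵥ v = f := by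
    rw [hv, mulVec_mulVec, Matrix.mul_nonsing_inv _ (isUnit_ham z p hΓ), one_mulVec]
  have hf0 : ∀ j < m, blk f j = 0 := by
    intro j hj
    funext c
    have hne : (⟨j, by omega⟩ : Fin (m + 1)) ≠ Fin.last m := by
      intro h; have := congrArg Fin.val h; simp at this; omega
    simp [blk, hf, show j < m + 1 by omega, hne]
  have h1 := ham_mulVec_elimination z p hΓ v f hKv hf0
  have h2 := gprod_mulVec hΓ h1 hf0 m le_rfl
  rw [h1 m le_rfl] at h2
  have h3 : blk v (m + 1) = 0 := by simp [blk]
  have h4 : blk f m = Pi.single b 1 := by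
    funext c
    have : (⟨m, by omega⟩ : Fin (m + 1)) = Fin.last m := rfl
    simp [blk, hf, Pi.single_apply, this]
  rw [h3, mulVec_zero, zero_add, h4] at h2
  have h5 := congrFun h2 a
  rw [Matrix.mulVec_single_one] at h5
  change _ = K⁻¹.mulVec f (0, a) at h5
  rw [hf, Matrix.mulVec_single_one] at h5
  exact h5.symm

end

section

variable {W : ℕ}

lemma volume_singular_matP :
    volume {T : MatP W | ¬ IsUnit (Matrix.of T : Mat W).det} = 0 := by
  refine measure_eq_zero_of_lines ?_ ((Matrix.of.symm (1 : Mat W)) : MatP W) ?_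
  · have : Measurable fun T : MatP W => (Matrix.of T : Mat W).det :=
      measurable_matrix_det.comp measurable_of
    simp only [isUnit_iff_ne_zero, not_not]
    exact this (measurableSet_singleton 0)
  · intro T
    have h := volume_det_add_smul_one_eq_zero (Matrix.of T : Mat W)
    convert h using 4 with t
    change ¬ IsUnit (Matrix.of T + t • (1 : Mat W) : Mat W).det ↔ _
    rw [isUnit_iff_ne_zero, not_not]

/-- All Schur complements and hoppings are invertible. -/
def Regular {m : ℕ} (p : ΩW (m + 1) W) : Prop :=
  (∀ j ≤ m, IsUnit (Vm p j).det) ∧ ∀ j < m, IsUnit (Tm p j).det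

lemma ae_regular (m W : ℕ) : ∀ᵐ p : ΩW (m + 1) W, Regular p := by
  have h1 : ∀ᵐ γ : Fin (m + 1) → HermParam W, ∀ j, IsUnit (toHerm (γ j)).det := by
    rw [ae_all_iff]
    intro j
    have h : ∀ᵐ g : HermParam W, IsUnit (toHerm g).det := by
      rw [ae_iff]; simpa using volume_singular (W := W) 0
    exact (Measure.quasiMeasurePreserving_eval
      (fun _ : Fin (m + 1) => (volume : Measure (HermParam W))) j).ae h
  have h2 : ∀ᵐ T : Fin m → MatP W, ∀ j, IsUnit (Matrix.of (T j) : Mat W).det := by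
    rw [ae_all_iff]
    intro j
    have h : ∀ᵐ g : MatP W, IsUnit (Matrix.of g : Mat W).det := by
      rw [ae_iff]; exact volume_singular_matP
    exact (Measure.quasiMeasurePreserving_eval
      (fun _ : Fin m => (volume : Measure (MatP W))) j).ae h
  have h3 : ∀ᵐ p : ΩW (m + 1) W, ∀ j, IsUnit (toHerm (p.1 j)).det :=
    Measure.quasiMeasurePreserving_fst.ae h1
  have h4 : ∀ᵐ p : ΩW (m + 1) W, ∀ j, IsUnit (Matrix.of (p.2 j) : Mat W).det :=
    Measure.quasiMeasurePreserving_snd.ae h2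
  filter_upwards [h3, h4] with p hp1 hp2
  refine ⟨fun j hj => ?_, fun j hj => ?_⟩
  · rw [Vm_of_lt p (by omega : j < m + 1)]; exact hp1 _
  · rw [Tm_of_lt p hj]; exact hp2 _

/-- The quadratic form in the exponent of the density. -/
def qtot {n W : ℕ} (ω : ΩW n W) : ℝ := (W : ℝ) * ((∑ j, hq (ω.1 j)) + ∑ j, mq (ω.2 j))

@[fun_prop] lemma measurable_qtot {n : ℕ} : Measurable (qtot : ΩW n W → ℝ) := by
  unfold qtot; fun_prop

lemma wegnerDensity_eq_gw {n : ℕ} : wegnerDensity n W = gw qtot := by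
  funext ω
  rw [wegnerDensity_eq, gw, qtot, neg_mul]

@[fun_prop] lemma measurable_wegnerDensity {n : ℕ} : Measurable (wegnerDensity n W) := by
  rw [wegnerDensity_eq_gw]; fun_prop

lemma gw_qtot {n : ℕ} (ω : ΩW n W) : gw qtot ω = (∏ j, gH W (ω.1 j)) * ∏ j, gM W (ω.2 j) := by
  unfold gw gH gM qtot gw
  rw [← ENNReal.ofReal_prod_of_nonneg (fun _ _ => (Real.exp_pos _).le),
    ← ENNReal.ofReal_prod_of_nonneg (fun _ _ => (Real.exp_pos _).le), ← Real.exp_sum, ← Real.exp_sum,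
    ← ENNReal.ofReal_mul (Real.exp_pos _).le, ← Real.exp_add]
  congr 2
  rw [Finset.sum_neg_distrib, Finset.sum_neg_distrib, ← Finset.mul_sum, ← Finset.mul_sum]
  ring

lemma gw_qtot_conf (z : ℝ) {m : ℕ} (p : ΩW (m + 1) W) :
    gw qtot (conf z p) = wt (xof (zpar W z) (zpar W z) p.2 p.1) p.2 := gw_qtot _

@[fun_prop] lemma measurable_conf (z : ℝ) {m : ℕ} :
    Measurable (conf z : ΩW (m + 1) W → ΩW (m + 1) W) := by
  have h1 : Measurable fun p : ΩW (m + 1) W => xof (zpar W z) (zpar W z) p.2 p.1 :=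
    (measurable_xof (zpar W z)).comp
      (measurable_const.prodMk (measurable_snd.prodMk measurable_fst))
  exact h1.prodMk measurable_snd

/-- The passage to Schur complement coordinates preserves Lebesgue measure. -/
lemma lintegral_conf (z : ℝ) {m : ℕ} {F : ΩW (m + 1) W → ℝ≥0∞} (hF : Measurable F) :
    ∫⁻ p, F (conf z p) = ∫⁻ ω, F ω := by
  have h1 : ∫⁻ ω, F ω = ∫⁻ T, ∫⁻ x, F (x, T) := lintegral_prod_symm' _ hF
  have h2 : ∫⁻ p, F (conf z p) = ∫⁻ T, ∫⁻ x, F (conf z (x, T)) :=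
    lintegral_prod_symm' _ (hF.comp (measurable_conf z))
  rw [h1, h2]
  refine lintegral_congr fun T => ?_
  exact lintegral_xof (zpar W z) (zpar W z) T (f := fun x => F (x, T))
    (hF.comp (measurable_id.prodMk measurable_const))

lemma measurable_Vm {n : ℕ} (j : ℕ) : Measurable fun ω : ΩW n W => Vm ω j := by
  unfold Vm
  split_ifs with h
  · exact measurable_toHerm.comp (by fun_prop)
  · exact measurable_const

lemma measurable_Tm {n : ℕ} (j : ℕ) : Measurable fun ω : ΩW n W => Tm ω j := by
  unfold Tm
  split_ifs with h
  · exact measurable_of.comp (by fun_prop)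
  · exact measurable_const

lemma measurable_hamOf {n : ℕ} : Measurable (hamOf : ΩW n W → _) := by
  refine measurable_pi_iff.2 fun p => measurable_pi_iff.2 fun q => ?_
  simp only [hamOf, ham, Matrix.of_apply]
  have hV : ∀ i j k, Measurable fun ω : ΩW n W => Vm ω i j k := fun i j k =>
    (measurable_matrix_apply j k).comp (measurable_Vm i)
  have hT : ∀ i j k, Measurable fun ω : ΩW n W => Tm ω i j k := fun i j k =>
    (measurable_matrix_apply j k).comp (measurable_Tm i)
  split_ifs
  · exact hV _ _ _
  · exact (hT _ _ _).neg
  · simp only [Matrix.neg_apply, Matrix.conjTranspose_apply]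
    exact (Complex.continuous_conj.measurable.comp (hT _ _ _)).neg
  · exact measurable_const

lemma measurable_Gblock {n : ℕ} (z : ℂ) (x y : Fin n) :
    Measurable fun ω : ΩW n W => Gblock ω z x y := by
  have h1 : Measurable fun ω : ΩW n W => hamOf ω - z • 1 := by
    have : Measurable fun M : Matrix (Fin n × Fin W) (Fin n × Fin W) ℂ => M - z • 1 :=
      (by fun_prop : Continuous fun M : Matrix (Fin n × Fin W) (Fin n × Fin W) ℂ =>
        M - z • 1).measurable
    exact this.comp measurable_hamOf
  have h2 : Measurable fun ω : ΩW n W => resolvent ω z := measurable_matrix_inv.comp h1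
  refine measurable_pi_iff.2 fun a => measurable_pi_iff.2 fun b => ?_
  exact (measurable_matrix_apply (x, a) (y, b)).comp h2

/-- The observable `log ‖G(1,n;z)‖`. -/
def logG (z : ℝ) {m : ℕ} (ω : ΩW (m + 1) W) : ℝ :=
  Real.log (opNorm (Gblock ω (z : ℂ) 0 (Fin.last m)))

@[fun_prop] lemma measurable_logG (z : ℝ) {m : ℕ} :
    Measurable (logG z : ΩW (m + 1) W → ℝ) :=
  Real.measurable_log.comp (measurable_opNorm.comp (measurable_Gblock _ _ _))

/-- The observable in Schur complement coordinates. -/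
def lg {m : ℕ} (p : ΩW (m + 1) W) : ℝ := Real.log (opNorm (gprod (Vm p) (Tm p) m))

lemma logG_conf (z : ℝ) {m : ℕ} {p : ΩW (m + 1) W} (hp : Regular p) :
    logG z (conf z p) = lg p := by
  rw [logG, lg, Gblock_conf z p hp.1]

lemma measurable_gprod {m : ℕ} (k : ℕ) :
    Measurable fun p : ΩW (m + 1) W => gprod (Vm p) (Tm p) k := by
  have hmul : Measurable fun p : Mat W × Mat W => p.1 * p.2 :=
    (by fun_prop : Continuous fun p : Mat W × Mat W => p.1 * p.2).measurable
  induction k with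
  | zero => exact measurable_matrix_inv.comp (measurable_Vm 0)
  | succ k ih =>
    have h1 : Measurable fun p : ΩW (m + 1) W => (Tm p k)ᴴ :=
      measurable_matrix_conjTranspose.comp (measurable_Tm k)
    have h2 : Measurable fun p : ΩW (m + 1) W => (Vm p (k + 1))⁻¹ :=
      measurable_matrix_inv.comp (measurable_Vm _)
    exact hmul.comp ((hmul.comp (ih.prodMk h1)).prodMk h2)

@[fun_prop] lemma measurable_lg {m : ℕ} : Measurable (lg : ΩW (m + 1) W → ℝ) :=
  Real.measurable_log.comp (measurable_opNorm.comp (measurable_gprod m))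

lemma opNorm_gprod_pos (hW : 0 < W) {m : ℕ} {p : ΩW (m + 1) W} (hp : Regular p) :
    0 < opNorm (gprod (Vm p) (Tm p) m) := by
  refine (opNorm_nonneg _).lt_of_ne fun h => ?_
  have h0 := opNorm_eq_zero.1 h.symm
  have h1 := isUnit_gprod m hp.1 hp.2
  have : Nonempty (Fin W) := ⟨⟨0, hW⟩⟩
  rw [h0, det_zero] at h1
  exact not_isUnit_zero h1

/-- Response of the observable to scalings of the Schur complements and hoppings. -/
lemma lg_scale (hW : 0 < W) {m : ℕ} {p p' : ΩW (m + 1) W} (hp : Regular p) {a c : ℕ → ℝ}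
    (h1 : ∀ j ≤ m, Vm p' j = ((Real.exp (a j) : ℝ) : ℂ) • Vm p j)
    (h2 : ∀ j < m, Tm p' j = ((Real.exp (c j) : ℝ) : ℂ) • Tm p j) :
    lg p' = lg p + (∑ j ∈ Finset.range m, c j) - ∑ j ∈ Finset.range (m + 1), a j := by
  have h := gprod_smul (Γ := Vm p) (T := Tm p) (Γ' := Vm p') (T' := Tm p')
    (a := fun j => ((Real.exp (a j) : ℝ) : ℂ)) (c := fun j => ((Real.exp (c j) : ℝ) : ℂ)) m hp.1
    (fun j => by exact_mod_cast (Real.exp_pos _).ne') h1 (fun j hj => by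
      rw [h2 j hj, conjTranspose_smul, Complex.star_def, Complex.conj_ofReal])
  rw [lg, h, opNorm_smul, lg]
  have e : ‖(∏ j ∈ Finset.range m, ((Real.exp (c j) : ℝ) : ℂ)) *
      (∏ j ∈ Finset.range (m + 1), ((Real.exp (a j) : ℝ) : ℂ))⁻¹‖ =
      Real.exp ((∑ j ∈ Finset.range m, c j) - ∑ j ∈ Finset.range (m + 1), a j) := by
    rw [← Complex.ofReal_prod, ← Complex.ofReal_prod, ← Real.exp_sum, ← Real.exp_sum,
      ← Complex.ofReal_inv, ← Complex.ofReal_mul, Complex.norm_real, ← Real.exp_neg, ← Real.exp_add,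
      Real.norm_of_nonneg (Real.exp_pos _).le, sub_eq_add_neg]
  rw [e, Real.log_mul (Real.exp_pos _).ne' (opNorm_gprod_pos hW hp).ne', Real.log_exp]
  ring

end

section

/-- Abstract Mermin-Wagner inequality for a pair of opposite deformations. -/
lemma setLIntegral_le_sqrt_of_deformation {α : Type*} [MeasurableSpace α] {μ : Measure α}
    {Sp Sm : α → α} {Jp Jm w : α → ℝ≥0∞} {A Up Um : Set α} {b : ℝ≥0∞}
    (hSp : Measurable Sp) (hSm : Measurable Sm) (hJp : Measurable Jp) (hJm : Measurable Jm)
    (hw : Measurable w) (hUp : MeasurableSet Up) (hUm : MeasurableSet Um)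
    (hJ : ∀ x, Jp x * Jm x = 1)
    (hp : ∀ g : α → ℝ≥0∞, Measurable g → ∫⁻ x, g (Sp x) * Jp x ∂μ = ∫⁻ x, g x ∂μ)
    (hm : ∀ g : α → ℝ≥0∞, Measurable g → ∫⁻ x, g (Sm x) * Jm x ∂μ = ∫⁻ x, g x ∂μ)
    (hA : MeasurableSet A)
    (hcost : ∀ x ∈ A, w x ^ 2 ≤ b ^ 2 * (w (Sp x) * w (Sm x)))
    (hAp : ∀ x ∈ A, Sp x ∈ Up) (hAm : ∀ x ∈ A, Sm x ∈ Um) :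
    (∫⁻ x in A, w x ∂μ) ^ 2 ≤ b ^ 2 * ((∫⁻ x in Up, w x ∂μ) * ∫⁻ x in Um, w x ∂μ) := by
  set gp := Up.indicator w
  set gm := Um.indicator w
  have hgp : Measurable gp := hw.indicator hUp
  have hgm : Measurable gm := hw.indicator hUm
  set fp : α → ℝ≥0∞ := fun x => (gp (Sp x) * Jp x) ^ (1 / 2 : ℝ)
  set fm : α → ℝ≥0∞ := fun x => (gm (Sm x) * Jm x) ^ (1 / 2 : ℝ)
  have hfp : Measurable fp := ((hgp.comp hSp).mul hJp).pow_const _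
  have hfm : Measurable fm := ((hgm.comp hSm).mul hJm).pow_const _
  have hsq : ∀ y : ℝ≥0∞, (y ^ (1 / 2 : ℝ)) ^ (2 : ℝ) = y := fun y => by
    rw [← ENNReal.rpow_mul]; norm_num
  have hpt : ∀ x, A.indicator w x ≤ b * (fp x * fm x) := by
    intro x
    by_cases hx : x ∈ A
    · rw [Set.indicator_of_mem hx]
      have h1 : gp (Sp x) = w (Sp x) := Set.indicator_of_mem (hAp x hx) _
      have h2 : gm (Sm x) = w (Sm x) := Set.indicator_of_mem (hAm x hx) _
      have h3 : (b * (fp x * fm x)) ^ 2 = b ^ 2 * (w (Sp x) * w (Sm x)) := by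
        have e : (fp x * fm x) ^ 2 = w (Sp x) * w (Sm x) := by
          simp only [fp, fm, h1, h2]
          rw [mul_pow, ← ENNReal.rpow_two, ← ENNReal.rpow_two, hsq, hsq]
          calc _ = w (Sp x) * w (Sm x) * (Jp x * Jm x) := by ring
            _ = _ := by rw [hJ, mul_one]
        rw [mul_pow, e]
      exact (ENNReal.pow_le_pow_left_iff two_ne_zero).1 (by rw [h3]; exact hcost x hx)
    · rw [Set.indicator_of_notMem hx]; exact zero_le
  have h1 : ∫⁻ x in A, w x ∂μ ≤ b * ((∫⁻ x in Up, w x ∂μ) ^ (1 / 2 : ℝ) *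
      (∫⁻ x in Um, w x ∂μ) ^ (1 / 2 : ℝ)) := by
    rw [← lintegral_indicator hA]
    refine (lintegral_mono hpt).trans ?_
    have hfm2 : Measurable fun x => fp x * fm x := hfp.mul hfm
    rw [lintegral_const_mul _ hfm2]
    refine mul_le_mul_right ?_ b
    have h := ENNReal.lintegral_mul_le_Lp_mul_Lq μ (p := 2) (q := 2)
      ⟨by norm_num, by norm_num, by norm_num⟩ hfp.aemeasurable hfm.aemeasurable
    refine h.trans (le_of_eq ?_)
    simp only [fp, fm, hsq]
    rw [hp _ hgp, hm _ hgm, lintegral_indicator hUp, lintegral_indicator hUm]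
  calc _ ≤ (b * ((∫⁻ x in Up, w x ∂μ) ^ (1 / 2 : ℝ) *
      (∫⁻ x in Um, w x ∂μ) ^ (1 / 2 : ℝ))) ^ 2 := by gcongr
    _ = _ := by
      rw [mul_pow, mul_pow, ← ENNReal.rpow_two (x := _ ^ (1 / 2 : ℝ)),
        ← ENNReal.rpow_two (x := _ ^ (1 / 2 : ℝ)), hsq, hsq]

lemma lintegral_exp_smul {E : Type*} [NormedAddCommGroup E] [NormedSpace ℝ E]
    [FiniteDimensional ℝ E] [MeasurableSpace E] [BorelSpace E] (μ : Measure E) [μ.IsAddHaarMeasure]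
    (t : ℝ) {g : E → ℝ≥0∞} (hg : Measurable g) :
    (∫⁻ x, g (Real.exp t • x) ∂μ) * ENNReal.ofReal (Real.exp (Module.finrank ℝ E * t)) =
      ∫⁻ x, g x ∂μ := by
  have h1 : ∫⁻ x, g (Real.exp t • x) ∂μ = ∫⁻ x, g x ∂(μ.map (Real.exp t • ·)) :=
    (lintegral_map hg (measurable_const_smul _)).symm
  rw [h1, Measure.map_addHaar_smul μ (Real.exp_pos t).ne', lintegral_smul_measure, smul_eq_mul,
    abs_of_pos (by positivity), mul_right_comm, ← ENNReal.ofReal_mul (by positivity), ← Real.exp_nat_mul,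
    ← Real.exp_neg, ← Real.exp_add]
  simp

lemma lintegral_pi_exp_smul {E : Type*} [NormedAddCommGroup E] [NormedSpace ℝ E]
    [FiniteDimensional ℝ E] [MeasureSpace E] [BorelSpace E]
    [(volume : Measure E).IsAddHaarMeasure] {k : ℕ}
    (t : Fin k → ℝ) {g : (Fin k → E) → ℝ≥0∞} (hg : Measurable g) :
    (∫⁻ x : Fin k → E, g (fun j => Real.exp (t j) • x j)) *
      ENNReal.ofReal (Real.exp (Module.finrank ℝ E * ∑ j, t j)) = ∫⁻ x, g x := by
  induction k with
  | zero =>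
    have : ∀ x : Fin 0 → E, (fun j => Real.exp (t j) • x j) = x := fun x => by
      funext j; exact j.elim0
    simp [this]
  | succ k ih =>
    have hsm : Measurable fun x : Fin (k + 1) → E => fun j => Real.exp (t j) • x j :=
      measurable_pi_iff.2 fun j => (measurable_const_smul _).comp (measurable_pi_apply j)
    have hgs : Measurable fun x : Fin (k + 1) → E => g fun j => Real.exp (t j) • x j :=
      hg.comp hsm
    rw [lintegral_fin_cons hgs, lintegral_fin_cons hg]
    have e : ∀ (a : E) (x : Fin k → E), (fun j => Real.exp (t j) •
        (Fin.cons a x : Fin (k + 1) → E) j) =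
        Fin.cons (Real.exp (t 0) • a) (fun j : Fin k => Real.exp (t j.succ) • x j) := by
      intro a x; funext j
      refine Fin.cases ?_ (fun j => ?_) j <;> simp
    have hgc : ∀ a : E, Measurable fun x : Fin k → E => g (Fin.cons a x) := fun a =>
      hg.comp (measurable_fin_cons.comp (measurable_const.prodMk measurable_id))
    have hgj : Measurable fun a : E => ∫⁻ x : Fin k → E, g (Fin.cons a x) :=
      (hg.comp measurable_fin_cons).lintegral_prod_right'
    simp only [e]
    set J := ENNReal.ofReal (Real.exp (Module.finrank ℝ E * ∑ j : Fin k, t j.succ))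
    have h1 : ∀ a : E, (∫⁻ x : Fin k → E, g (Fin.cons (Real.exp (t 0) • a)
        (fun j => Real.exp (t j.succ) • x j))) * J =
        ∫⁻ x : Fin k → E, g (Fin.cons (Real.exp (t 0) • a) x) := fun a =>
      ih (fun j => t j.succ) (hgc _)
    rw [Fin.sum_univ_succ, mul_add, Real.exp_add, ENNReal.ofReal_mul (by positivity),
      mul_comm (ENNReal.ofReal _), ← mul_assoc,
      ← lintegral_mul_const' J _ ENNReal.ofReal_ne_top]
    simp only [h1]
    exact lintegral_exp_smul volume (t 0) hgj

variable {W : ℕ}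

/-- Rescaling of the first Schur complement and of the hoppings. -/
def scl {m : ℕ} (σ b : ℝ) (θ : (Fin (m + 1) → HermParam W) → Fin m → ℝ) (p : ΩW (m + 1) W) :
    ΩW (m + 1) W :=
  (fun j => Real.exp (σ * if j = 0 then b else 0) • p.1 j,
    fun j : Fin m => Real.exp (σ * θ p.1 j) • p.2 j)

/-- Jacobian of the rescaling. -/
def sclJ {m : ℕ} (σ b : ℝ) (θ : (Fin (m + 1) → HermParam W) → Fin m → ℝ) (p : ΩW (m + 1) W) :
    ℝ≥0∞ :=
  ENNReal.ofReal (Real.exp (Module.finrank ℝ (HermParam W) *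
      ∑ j : Fin (m + 1), σ * if j = 0 then b else 0)) *
    ENNReal.ofReal (Real.exp (Module.finrank ℝ (MatP W) * ∑ j, σ * θ p.1 j))

variable {m : ℕ} {θ : (Fin (m + 1) → HermParam W) → Fin m → ℝ}

lemma measurable_scl (hθ : ∀ j, Measurable fun γ => θ γ j) (σ b : ℝ) :
    Measurable (scl σ b θ : ΩW (m + 1) W → ΩW (m + 1) W) := by
  refine Measurable.prodMk (measurable_pi_iff.2 fun j => ?_) (measurable_pi_iff.2 fun j => ?_)
  · exact (measurable_const_smul _).comp ((measurable_pi_apply j).comp measurable_fst)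
  · have h1 : Measurable fun p : ΩW (m + 1) W => Real.exp (σ * θ p.1 j) :=
      Real.measurable_exp.comp (((hθ j).comp measurable_fst).const_mul σ)
    exact h1.smul ((measurable_pi_apply j).comp measurable_snd)

lemma measurable_sclJ (hθ : ∀ j, Measurable fun γ => θ γ j) (σ b : ℝ) :
    Measurable (sclJ σ b θ : ΩW (m + 1) W → ℝ≥0∞) := by
  unfold sclJ
  have h : Measurable fun p : ΩW (m + 1) W => ∑ j, σ * θ p.1 j :=
    Finset.measurable_sum _ fun j _ => ((hθ j).comp measurable_fst).const_mul σ
  fun_prop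

lemma sclJ_mul (b : ℝ) (p : ΩW (m + 1) W) : sclJ 1 b θ p * sclJ (-1) b θ p = 1 := by
  unfold sclJ
  rw [mul_mul_mul_comm, ← ENNReal.ofReal_mul (by positivity), ← ENNReal.ofReal_mul (by positivity),
    ← Real.exp_add, ← Real.exp_add]
  simp

lemma lintegral_scl (hθ : ∀ j, Measurable fun γ => θ γ j) (σ b : ℝ) {g : ΩW (m + 1) W → ℝ≥0∞}
    (hg : Measurable g) : ∫⁻ p, g (scl σ b θ p) * sclJ σ b θ p = ∫⁻ p, g p := by
  have h1 : ∫⁻ p, g (scl σ b θ p) * sclJ σ b θ p =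
      ∫⁻ γ : Fin (m + 1) → HermParam W, ∫⁻ T : Fin m → MatP W,
        g (scl σ b θ (γ, T)) * sclJ σ b θ (γ, T) :=
    lintegral_prod _ ((hg.comp (measurable_scl hθ σ b)).mul (measurable_sclJ hθ σ b)).aemeasurable
  have h2 : ∫⁻ p, g p = ∫⁻ γ : Fin (m + 1) → HermParam W, ∫⁻ T : Fin m → MatP W, g (γ, T) :=
    lintegral_prod _ hg.aemeasurable
  rw [h1, h2]
  have h3 : Measurable fun γ : Fin (m + 1) → HermParam W => ∫⁻ T : Fin m → MatP W, g (γ, T) :=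
    hg.lintegral_prod_right'
  rw [← lintegral_pi_exp_smul (fun j : Fin (m + 1) => σ * if j = 0 then b else 0) h3,
    ← lintegral_mul_const' _ _ ENNReal.ofReal_ne_top]
  refine lintegral_congr fun γ => ?_
  have h4 : Measurable fun T : Fin m → MatP W =>
      g (fun j => Real.exp (σ * if j = 0 then b else 0) • γ j, T) :=
    hg.comp (measurable_const.prodMk measurable_id)
  rw [← lintegral_pi_exp_smul (fun j : Fin m => σ * θ γ j) h4, mul_assoc,
    ← lintegral_mul_const' _ _ (ENNReal.mul_ne_top ENNReal.ofReal_ne_top ENNReal.ofReal_ne_top)]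
  refine lintegral_congr fun T => ?_
  simp only [scl, sclJ]
  rw [mul_comm (ENNReal.ofReal (Real.exp (_ * ∑ j, σ * θ γ j)))]

end

section

variable {W m : ℕ} {θ : (Fin (m + 1) → HermParam W) → Fin m → ℝ}

lemma sel_smul {c b : ℝ} (hb : b ≠ 0) {γ : HermParam W} (hγ : IsUnit (toHerm γ).det) (T : MatP W) :
    sel (c • T) (b • γ) = (c ^ 2 / b) • sel T γ := by
  apply toHerm_injective
  rw [toHerm_sel, toHerm_smul, toHerm_smul, toHerm_sel]
  have h1 : (b • toHerm γ)⁻¹ = b⁻¹ • (toHerm γ)⁻¹ := by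
    have := Matrix.inv_smul' (toHerm γ) (Units.mk0 (b : ℂ) (by exact_mod_cast hb)) hγ
    have e1 : b • toHerm γ = (b : ℂ) • toHerm γ := by ext; simp
    have e2 : b⁻¹ • (toHerm γ)⁻¹ = (b : ℂ)⁻¹ • (toHerm γ)⁻¹ := by ext; simp
    rw [e1, e2]
    simpa [Units.smul_def] using this
  have h2 : (Matrix.of (c • T) : Mat W) = c • Matrix.of T := rfl
  rw [h1, h2, conjTranspose_smul]
  simp only [Matrix.smul_mul, Matrix.mul_smul, smul_smul, star_trivial]
  congr 1
  field_simp

lemma conf_fst_zero (z : ℝ) (p : ΩW (m + 1) W) : (conf z p).1 0 = p.1 0 + zpar W z := by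
  simp only [conf, xof, bvec]
  erw [Fin.cons_zero]

lemma conf_fst_succ (z : ℝ) (p : ΩW (m + 1) W) (j : Fin m) :
    (conf z p).1 j.succ = p.1 j.succ + (zpar W z + sel (p.2 j) (p.1 j.castSucc)) := by
  simp only [conf, xof, bvec]
  erw [Fin.cons_succ]

lemma conf_scl_zero (z σ b : ℝ) (p : ΩW (m + 1) W) :
    (conf z (scl σ b θ p)).1 0 = (conf z p).1 0 + (Real.exp (σ * b) - 1) • p.1 0 := by
  rw [conf_fst_zero, conf_fst_zero]
  simp only [scl, if_pos]
  module

/-- Relative change of the self-energies under the rescaling. -/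
def kap (b : ℝ) (θ : (Fin (m + 1) → HermParam W) → Fin m → ℝ) (γ : Fin (m + 1) → HermParam W)
    (j : Fin m) : ℝ := 2 * θ γ j - if j.castSucc = 0 then b else 0

lemma conf_scl_succ (z σ b : ℝ) {p : ΩW (m + 1) W} (hp : Regular p) (j : Fin m) :
    (conf z (scl σ b θ p)).1 j.succ = (conf z p).1 j.succ +
      (Real.exp (σ * kap b θ p.1 j) - 1) • sel (p.2 j) (p.1 j.castSucc) := by
  rw [conf_fst_succ, conf_fst_succ]
  have hu : IsUnit (toHerm (p.1 j.castSucc)).det := by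
    have := hp.1 j (by have := j.2; omega)
    rw [Vm_of_lt p (by have := j.2; omega)] at this
    exact this
  have h0 : (scl σ b θ p).1 j.succ = p.1 j.succ := by
    simp [scl, Fin.succ_ne_zero]
  have h1 : sel ((scl σ b θ p).2 j) ((scl σ b θ p).1 j.castSucc) =
      Real.exp (σ * kap b θ p.1 j) • sel (p.2 j) (p.1 j.castSucc) := by
    simp only [scl]
    rw [sel_smul (Real.exp_pos _).ne' hu, ← Real.exp_nat_mul, ← Real.exp_sub]
    congr 2
    unfold kap; push_cast; ring
  rw [h0, h1]
  module

lemma cosh_sub_one_le {x : ℝ} (hx : |x| ≤ 1) : Real.exp x + Real.exp (-x) ≤ 2 + 2 * x ^ 2 := by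
  have h1 : ∀ y : ℝ, |y| ≤ 1 → Real.exp y ≤ 1 + y + y ^ 2 := by
    intro y hy
    have := abs_le.1 (Real.abs_exp_sub_one_sub_id_le hy)
    linarith [this.2]
  have h2 := h1 x hx
  have h3 := h1 (-x) (by rwa [abs_neg])
  linarith [h2, h3, neg_sq x]

lemma hq_scale_cost {x : ℝ} (hx : |x| ≤ 1) (V B : HermParam W) :
    hq (V + (Real.exp (1 * x) - 1) • B) + hq (V + (Real.exp (-1 * x) - 1) • B) - 2 * hq V ≤
      2 * x ^ 2 * (hq V + 5 * hq B) := by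
  rw [hq_add, hq_add, hq_smul, hq_smul, hin_smul_right, hin_smul_right, one_mul, neg_one_mul]
  have hc := cosh_sub_one_le hx
  have hpr : Real.exp x * Real.exp (-x) = 1 := by rw [← Real.exp_add]; simp
  set u := Real.exp x
  set v := Real.exp (-x)
  have hu : 0 < u := Real.exp_pos _
  have hv : 0 < v := Real.exp_pos _
  have huv : 0 ≤ u + v - 2 := by nlinarith [sq_nonneg (u - v)]
  have hB := hq_nonneg B
  have hin2 : 2 * hin V B ≤ hq V + hq B := two_finr_le _ _
  have hx2 : x ^ 2 ≤ 1 := by rw [← sq_abs]; nlinarith [abs_nonneg x]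
  have hV := hq_nonneg V
  have e : (u - 1) ^ 2 + (v - 1) ^ 2 = (u + v - 2) * (u + v) := by nlinarith
  have h1 : (u + v - 2) * (u + v) ≤ 2 * x ^ 2 * 4 := by
    have : u + v ≤ 4 := by linarith
    exact mul_le_mul (by linarith) this (by linarith) (by positivity)
  have h2 : ((u - 1) ^ 2 + (v - 1) ^ 2) * hq B ≤ 2 * x ^ 2 * 4 * hq B := by
    rw [e]; exact mul_le_mul_of_nonneg_right h1 hB
  have h3 : (u + v - 2) * (2 * hin V B) ≤ 2 * x ^ 2 * (hq V + hq B) := by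
    refine (mul_le_mul_of_nonneg_left hin2 huv).trans ?_
    exact mul_le_mul_of_nonneg_right (by linarith) (by linarith)
  nlinarith

lemma mq_scale_cost {x : ℝ} (hx : |2 * x| ≤ 1) (T : MatP W) :
    mq (Real.exp (1 * x) • T) + mq (Real.exp (-1 * x) • T) - 2 * mq T ≤ 8 * x ^ 2 * mq T := by
  have h : ∀ c : ℝ, mq (c • T) = c ^ 2 * mq T := fun c => fsq_real_smul c (Matrix.of T : Mat W)
  have hc := cosh_sub_one_le hx
  rw [h, h, ← Real.exp_nat_mul, ← Real.exp_nat_mul]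
  have e1 : ((2 : ℕ) : ℝ) * (1 * x) = 2 * x := by push_cast; ring
  have e2 : ((2 : ℕ) : ℝ) * (-1 * x) = -(2 * x) := by push_cast; ring
  rw [e1, e2]
  nlinarith [mq_nonneg T]

/-- Second-order cost of the rescaling. -/
lemma qtot_scale_cost (z : ℝ) {b : ℝ} {p : ΩW (m + 1) W} (hp : Regular p) (hb : |b| ≤ 1)
    (hκ : ∀ j, |kap b θ p.1 j| ≤ 1) (hθ : ∀ j, |2 * θ p.1 j| ≤ 1) :
    qtot (conf z (scl 1 b θ p)) + qtot (conf z (scl (-1) b θ p)) - 2 * qtot (conf z p) ≤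
      (W : ℝ) * (2 * b ^ 2 * (hq ((conf z p).1 0) + 5 * hq (p.1 0)) +
        ∑ j, (2 * (kap b θ p.1 j) ^ 2 *
          (hq ((conf z p).1 j.succ) + 5 * hq (sel (p.2 j) (p.1 j.castSucc))) +
          8 * (θ p.1 j) ^ 2 * mq (p.2 j))) := by
  have e : ∀ ω : ΩW (m + 1) W, qtot ω =
      W * (hq (ω.1 0) + ∑ j : Fin m, (hq (ω.1 j.succ) + mq (ω.2 j))) := by
    intro ω
    unfold qtot
    rw [Fin.sum_univ_succ, Finset.sum_add_distrib, add_assoc]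
    rfl
  rw [e, e, e]
  have h2 : ∀ σ, ∀ j : Fin m, (conf z (scl σ b θ p)).2 j = Real.exp (σ * θ p.1 j) • p.2 j :=
    fun σ j => rfl
  have h3 : ∀ j : Fin m, (conf z p).2 j = p.2 j := fun j => rfl
  simp only [conf_scl_zero, conf_scl_succ z _ b hp, h2, h3]
  have c0 := hq_scale_cost hb ((conf z p).1 0) (p.1 0)
  have cs : ∑ j : Fin m, ((hq ((conf z p).1 j.succ + (Real.exp (1 * kap b θ p.1 j) - 1) •
        sel (p.2 j) (p.1 j.castSucc)) + mq (Real.exp (1 * θ p.1 j) • p.2 j)) +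
      (hq ((conf z p).1 j.succ + (Real.exp (-1 * kap b θ p.1 j) - 1) •
        sel (p.2 j) (p.1 j.castSucc)) + mq (Real.exp (-1 * θ p.1 j) • p.2 j)) -
      2 * (hq ((conf z p).1 j.succ) + mq (p.2 j))) ≤
      ∑ j, (2 * (kap b θ p.1 j) ^ 2 *
          (hq ((conf z p).1 j.succ) + 5 * hq (sel (p.2 j) (p.1 j.castSucc))) +
          8 * (θ p.1 j) ^ 2 * mq (p.2 j)) := by
    refine Finset.sum_le_sum fun j _ => ?_
    have a1 := hq_scale_cost (hκ j) ((conf z p).1 j.succ) (sel (p.2 j) (p.1 j.castSucc))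
    have a2 := mq_scale_cost (hθ j) (p.2 j)
    linarith
  rw [Finset.sum_sub_distrib, Finset.sum_add_distrib, ← Finset.mul_sum] at cs
  have hW : (0 : ℝ) ≤ W := Nat.cast_nonneg _
  have key := mul_le_mul_of_nonneg_left (add_le_add c0 cs) hW
  refine le_trans (le_of_eq ?_) key
  ring

/-- Change of the observable under the rescaling. -/
lemma lg_scl (hW : 0 < W) (σ b : ℝ) {p : ΩW (m + 1) W} (hp : Regular p) :
    lg (scl σ b θ p) = lg p + σ * (∑ j, θ p.1 j - b) := by
  have cs : ∀ (r : ℝ) (M : Mat W), r • M = ((r : ℝ) : ℂ) • M := fun r M => by ext; simp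
  have h := lg_scale hW (p := p) (p' := scl σ b θ p) hp
    (a := fun j => σ * if j = 0 then b else 0)
    (c := fun j => if h : j < m then σ * θ p.1 ⟨j, h⟩ else 0) ?_ ?_
  · rw [h, Finset.sum_range, Finset.sum_range_succ']
    have : ∀ i : Fin m, (if h : (i : ℕ) < m then σ * θ p.1 ⟨i, h⟩ else 0) = σ * θ p.1 i := by
      intro i; rw [dif_pos i.2]
    simp only [this, ← Finset.mul_sum, if_true, Nat.succ_ne_zero, if_false, mul_zero,
      Finset.sum_const_zero]
    ring
  · intro j hj
    rw [Vm_of_lt _ (show j < m + 1 by omega), Vm_of_lt _ (show j < m + 1 by omega), ← cs,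
      ← toHerm_smul]
    have e : (((⟨j, by omega⟩ : Fin (m + 1)) = 0)) = (j = 0) := by
      rw [Fin.ext_iff]; rfl
    simp only [scl, e]
  · intro j hj
    rw [Tm_of_lt _ hj, Tm_of_lt _ hj, ← cs]
    simp only [scl, hj, dif_pos]
    rfl

end

section

instance borelSpacePiHermParam {n W : ℕ} : BorelSpace (Fin n → HermParam W) :=
  have : ∀ _ : Fin n, BorelSpace (HermParam W) := fun _ => Prod.borelSpace
  Pi.borelSpace
instance borelSpaceΩW {n W : ℕ} : BorelSpace (ΩW n W) := Prod.borelSpace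
instance sigmaFiniteΩW {n W : ℕ} : SigmaFinite (volume : Measure (ΩW n W)) :=
  Measure.prod.instSigmaFinite (μ := (volume : Measure (Fin n → HermParam W)))
    (ν := (volume : Measure (Fin (n - 1) → MatP W)))

instance measurableAddΩW {n W : ℕ} : MeasurableAdd (ΩW n W) where
  measurable_const_add c := (continuous_const_add c).measurable
  measurable_add_const c := (continuous_add_const c).measurable

lemma norm_inv_apply_rpow_le {ι : Type*} [Fintype ι] [DecidableEq ι] {A : Matrix ι ι ℂ}
    (hA : A.IsHermitian) {r : ℝ} (hr0 : 0 < r) (hr1 : r < 1) (t : ℝ) (i j : ι) :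
    ‖(A + (t : ℂ) • 1)⁻¹ i j‖ ^ r ≤ ∑ k, |t + hA.eigenvalues k| ^ (-r) := by
  have hnn : ∀ k, 0 ≤ |t + hA.eigenvalues k| ^ (-r) := fun k => Real.rpow_nonneg (abs_nonneg _) _
  set U : Matrix ι ι ℂ := (hA.eigenvectorUnitary : Matrix ι ι ℂ) with hU
  have hUU : U * star U = 1 := Unitary.mul_star_self_of_mem hA.eigenvectorUnitary.2
  have hUU' : star U * U = 1 := Unitary.star_mul_self_of_mem hA.eigenvectorUnitary.2
  have hsp : A = U * diagonal (fun k => (hA.eigenvalues k : ℂ)) * star U := by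
    have := hA.spectral_theorem
    rw [Unitary.conjStarAlgAut_apply] at this
    exact this
  have e1 : A + (t : ℂ) • 1 = U * diagonal (fun k => ((t + hA.eigenvalues k : ℝ) : ℂ)) * star U := by
    have : diagonal (fun k => ((t + hA.eigenvalues k : ℝ) : ℂ)) =
        diagonal (fun k => (hA.eigenvalues k : ℂ)) + (t : ℂ) • (1 : Matrix ι ι ℂ) := by
      ext a b
      by_cases hab : a = b
      · subst hab; simp [add_comm]
      · simp [hab]
    rw [this, Matrix.mul_add, Matrix.add_mul, ← hsp, Matrix.mul_smul, Matrix.smul_mul, mul_one,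
      hUU]
  by_cases h0 : ∃ k, t + hA.eigenvalues k = 0
  · obtain ⟨k, hk⟩ := h0
    have hdet : (A + (t : ℂ) • 1).det = 0 := by
      rw [e1, det_mul, det_mul, det_diagonal,
        Finset.prod_eq_zero (Finset.mem_univ k) (by rw [hk]; simp)]
      simp
    have : (A + (t : ℂ) • 1)⁻¹ = 0 := by
      rw [Matrix.inv_def, hdet]; simp
    rw [this]
    simp only [Matrix.zero_apply, norm_zero, Real.zero_rpow hr0.ne']
    exact Finset.sum_nonneg fun k _ => hnn k
  · push Not at h0
    have hinv : (A + (t : ℂ) • 1)⁻¹ =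
        U * diagonal (fun k => ((t + hA.eigenvalues k : ℝ) : ℂ)⁻¹) * star U := by
      apply Matrix.inv_eq_right_inv
      have e2 : U * diagonal (fun k => ((t + hA.eigenvalues k : ℝ) : ℂ)) * star U *
          (U * diagonal (fun k => ((t + hA.eigenvalues k : ℝ) : ℂ)⁻¹) * star U) =
          U * (diagonal (fun k => ((t + hA.eigenvalues k : ℝ) : ℂ)) * ((star U * U) *
            diagonal (fun k => ((t + hA.eigenvalues k : ℝ) : ℂ)⁻¹))) * star U := by
        simp only [Matrix.mul_assoc]
      rw [e1, e2, hUU', one_mul, diagonal_mul_diagonal]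
      have : (fun k => ((t + hA.eigenvalues k : ℝ) : ℂ) * ((t + hA.eigenvalues k : ℝ) : ℂ)⁻¹) =
          fun _ => 1 := by
        funext k
        exact mul_inv_cancel₀ (by exact_mod_cast h0 k)
      rw [this, diagonal_one, mul_one, hUU]
    have hUle : ∀ a b, ‖U a b‖ ≤ 1 := fun a b =>
      entry_norm_bound_of_unitary hA.eigenvectorUnitary.2 a b
    have hle : ‖(A + (t : ℂ) • 1)⁻¹ i j‖ ≤ ∑ k, |t + hA.eigenvalues k|⁻¹ := by
      rw [hinv, Matrix.mul_apply]
      refine (norm_sum_le _ _).trans (Finset.sum_le_sum fun k _ => ?_)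
      rw [Matrix.mul_diagonal, norm_mul, norm_mul, norm_inv, Complex.norm_real, Real.norm_eq_abs,
        Matrix.star_apply, norm_star]
      have h1 := hUle i k
      have h2 := hUle j k
      have h3 : 0 ≤ |t + hA.eigenvalues k|⁻¹ := by positivity
      calc _ ≤ 1 * |t + hA.eigenvalues k|⁻¹ * 1 := by gcongr
        _ = _ := by ring
    have hsub : ∀ s : Finset ι, (∑ k ∈ s, |t + hA.eigenvalues k|⁻¹) ^ r ≤
        ∑ k ∈ s, |t + hA.eigenvalues k| ^ (-r) := by
      intro s
      induction s using Finset.induction_on with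
      | empty => simp [Real.zero_rpow hr0.ne']
      | insert a s ha ih =>
        rw [Finset.sum_insert ha, Finset.sum_insert ha]
        refine (Real.rpow_add_le_add_rpow (by positivity) (by positivity) hr0.le hr1.le).trans ?_
        refine add_le_add (le_of_eq ?_) ih
        rw [Real.inv_rpow (abs_nonneg _), Real.rpow_neg (abs_nonneg _)]
    exact (Real.rpow_le_rpow (norm_nonneg _) hle hr0.le).trans (hsub _)

variable {n W : ℕ}

lemma hamOf_isHermitian (ω : ΩW n W) : (hamOf ω).IsHermitian := by
  have hV : ∀ j, (Vm ω j).IsHermitian := by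
    intro j
    unfold Vm
    split_ifs
    · exact toHerm_isHermitian _
    · exact isHermitian_zero
  ext p q
  simp only [hamOf, ham, conjTranspose_apply, Matrix.of_apply]
  by_cases h1 : (p.1 : ℕ) = (q.1 : ℕ)
  · rw [if_pos h1.symm, if_pos h1, h1]
    exact congrFun (congrFun (hV q.1) p.2) q.2
  · rw [if_neg (Ne.symm h1), if_neg h1]
    by_cases h2 : (p.1 : ℕ) = (q.1 : ℕ) + 1
    · have h3 : ¬ (q.1 : ℕ) = (p.1 : ℕ) + 1 := by omega
      rw [if_neg h3, if_pos h2, if_pos h2]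
      simp
    · by_cases h3 : (q.1 : ℕ) = (p.1 : ℕ) + 1
      · have h4 : ¬ (p.1 : ℕ) = (q.1 : ℕ) + 1 := h2
        rw [if_pos h3, if_neg h4, if_pos h3]
        simp
      · simp [h2, h3]

/-- Shift of all diagonal blocks by a multiple of the identity. -/
def shv (n W : ℕ) (t : ℝ) : ΩW n W := (fun _ => zpar W t, 0)

lemma hamOf_add_shv (ω : ΩW n W) (t : ℝ) :
    hamOf (ω + shv n W t) = hamOf ω + (t : ℂ) • 1 := by
  have hV : ∀ j, j < n → Vm (ω + shv n W t) j = Vm ω j + (t : ℂ) • 1 := by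
    intro j hj
    simp only [Vm, hj, dif_pos]
    rw [← toHerm_zpar, ← toHerm_add]
    rfl
  have hT : ∀ j, Tm (ω + shv n W t) j = Tm ω j := by
    intro j
    unfold Tm
    split_ifs
    · ext a b; simp [shv]
    · rfl
  ext p q
  simp only [hamOf, ham, Matrix.of_apply, Matrix.add_apply, Matrix.smul_apply, hT]
  by_cases h1 : (p.1 : ℕ) = (q.1 : ℕ)
  · rw [if_pos h1, if_pos h1, hV _ p.1.2]
    have : p.1 = q.1 := Fin.ext h1
    simp [Matrix.one_apply, Prod.ext_iff, this]
  · rw [if_neg h1, if_neg h1]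
    have : p ≠ q := fun h => h1 (by rw [h])
    rw [Matrix.one_apply_ne this]
    simp

lemma qtot_shv (t : ℝ) : qtot (shv n W t) = (W : ℝ) ^ 2 * n * t ^ 2 := by
  have h1 : hq (zpar W t) = t ^ 2 * W := by
    unfold hq fsq
    rw [toHerm_zpar]
    have : ∀ i j : Fin W, ‖((t : ℂ) • (1 : Mat W)) i j‖ ^ 2 = if i = j then t ^ 2 else 0 := by
      intro i j
      by_cases h : i = j
      · simp [h]
      · simp [h]
    simp only [this]
    simp [mul_comm]
  have h2 : mq (0 : MatP W) = 0 := fsq_zero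
  simp only [qtot, shv, h1, Pi.zero_apply, h2]
  simp
  ring

lemma qtot_par (x v : ΩW n W) : qtot (x + v) + qtot (x - v) = 2 * qtot x + 2 * qtot v := by
  have h1 : ∀ a b : HermParam W, hq (a + b) + hq (a - b) = 2 * hq a + 2 * hq b := by
    intro a b; rw [hq_add, hq_sub]; ring
  have h2 : ∀ a b : MatP W, mq (a + b) + mq (a - b) = 2 * mq a + 2 * mq b := by
    intro a b
    have e1 := fsq_add (Matrix.of a : Mat W) (Matrix.of b)
    have e2 := fsq_sub (Matrix.of a : Mat W) (Matrix.of b)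
    change fsq (Matrix.of a + Matrix.of b : Mat W) + fsq (Matrix.of a - Matrix.of b : Mat W) = _
    rw [e1, e2]; unfold mq; ring
  unfold qtot
  have e1 : ∑ j, hq ((x + v).1 j) + ∑ j, hq ((x - v).1 j) =
      2 * ∑ j, hq (x.1 j) + 2 * ∑ j, hq (v.1 j) := by
    rw [← Finset.sum_add_distrib, Finset.mul_sum, Finset.mul_sum, ← Finset.sum_add_distrib]
    exact Finset.sum_congr rfl fun j _ => h1 _ _
  have e2 : ∑ j, mq ((x + v).2 j) + ∑ j, mq ((x - v).2 j) =
      2 * ∑ j, mq (x.2 j) + 2 * ∑ j, mq (v.2 j) := by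
    rw [← Finset.sum_add_distrib, Finset.mul_sum, Finset.mul_sum, ← Finset.sum_add_distrib]
    exact Finset.sum_congr rfl fun j _ => h2 _ _
  linear_combination (W : ℝ) * e1 + (W : ℝ) * e2

lemma shv_neg (t : ℝ) : shv n W (-t) = - shv n W t := by
  have : zpar W (-t) = - zpar W t := by
    apply toHerm_injective
    rw [toHerm_neg, toHerm_zpar, toHerm_zpar]; simp
  unfold shv
  ext1
  · funext j; exact this
  · simp

lemma continuous_shv : Continuous (shv n W) := by
  have h : Continuous (zpar W) := by
    unfold zpar
    exact continuous_fromHerm.comp (by fun_prop)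
  exact (continuous_pi fun _ => h).prodMk continuous_const

lemma opNorm_rpow_le_sum {r : ℝ} (hr0 : 0 < r) (hr1 : r < 1) (M : Mat W) :
    opNorm M ^ r ≤ ∑ i, ∑ j, ‖M i j‖ ^ r := by
  have hsub : ∀ {ι : Type} (s : Finset ι) (f : ι → ℝ), (∀ i, 0 ≤ f i) →
      (∑ k ∈ s, f k) ^ r ≤ ∑ k ∈ s, f k ^ r := by
    intro ι s f hf
    classical
    induction s using Finset.induction_on with
    | empty => simp [Real.zero_rpow hr0.ne']
    | insert a s ha ih =>
      rw [Finset.sum_insert ha, Finset.sum_insert ha]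
      exact (Real.rpow_add_le_add_rpow (hf a) (Finset.sum_nonneg fun i _ => hf i) hr0.le
        hr1.le).trans (by gcongr)
  refine (Real.rpow_le_rpow (opNorm_nonneg _) (opNorm_le_sum M) hr0.le).trans ?_
  refine (hsub _ _ fun i => by positivity).trans (Finset.sum_le_sum fun i _ => ?_)
  exact hsub _ _ fun j => norm_nonneg _

lemma setLIntegral_opNorm_shv_le {r : ℝ} (hr0 : 0 < r) (hr1 : r < 1) {τ : ℝ} (hτ : τ ≠ 0)
    (ω : ΩW n W) (z : ℝ) (x y : Fin n) :
    ∫⁻ t in Set.Icc (-1:ℝ) 1,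
      ENNReal.ofReal (opNorm (Gblock (ω + shv n W (t * τ)) z x y) ^ r) ≤
      ENNReal.ofReal ((W : ℝ) ^ 2 * (n * W) * (|τ| ^ (-r) * (2 + 2 / (1 - r)))) := by
  have hH : (hamOf ω - (z : ℂ) • 1).IsHermitian := by
    refine (hamOf_isHermitian ω).sub ?_
    ext a b
    by_cases h : a = b
    · subst h; simp
    · simp [h, Ne.symm h]
  have hK : 0 ≤ 2 + 2 / (1 - r) := by
    have : 0 < 1 - r := by linarith
    positivity
  have hpt : ∀ t : ℝ, ENNReal.ofReal (opNorm (Gblock (ω + shv n W (t * τ)) z x y) ^ r) ≤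
      (W : ℝ≥0∞) ^ 2 * ∑ k, ENNReal.ofReal (|τ| ^ (-r)) *
        ENNReal.ofReal (|t - -(hH.eigenvalues k / τ)| ^ (-r)) := by
    intro t
    have h1 : ∀ i j, ‖Gblock (ω + shv n W (t * τ)) z x y i j‖ ^ r ≤
        ∑ k, |τ| ^ (-r) * |t - -(hH.eigenvalues k / τ)| ^ (-r) := by
      intro i j
      have h := norm_inv_apply_rpow_le hH hr0 hr1 (t * τ) (x, i) (y, j)
      have e : Gblock (ω + shv n W (t * τ)) z x y i j =
          (hamOf ω - (z : ℂ) • 1 + ((t * τ : ℝ) : ℂ) • 1)⁻¹ (x, i) (y, j) := by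
        simp only [Gblock, resolvent, Matrix.of_apply, hamOf_add_shv]
        rw [sub_add_eq_add_sub]
      rw [e]
      refine h.trans (le_of_eq (Finset.sum_congr rfl fun k _ => ?_))
      rw [← Real.mul_rpow (abs_nonneg _) (abs_nonneg _), ← abs_mul]
      congr 2
      field_simp
      ring
    have h2 : opNorm (Gblock (ω + shv n W (t * τ)) z x y) ^ r ≤
        (W : ℝ) ^ 2 * ∑ k, |τ| ^ (-r) * |t - -(hH.eigenvalues k / τ)| ^ (-r) := by
      refine (opNorm_rpow_le_sum hr0 hr1 _).trans ?_
      refine (Finset.sum_le_sum fun i _ => Finset.sum_le_sum fun j _ => h1 i j).trans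
        (le_of_eq ?_)
      simp only [Finset.sum_const, Finset.card_univ, Fintype.card_fin, nsmul_eq_mul]
      ring
    refine (ENNReal.ofReal_le_ofReal h2).trans (le_of_eq ?_)
    rw [ENNReal.ofReal_mul (by positivity), ENNReal.ofReal_pow (by positivity),
      ENNReal.ofReal_natCast, ENNReal.ofReal_sum_of_nonneg (fun k _ => by positivity)]
    congr 1
    exact Finset.sum_congr rfl fun k _ => ENNReal.ofReal_mul (by positivity)
  have hm : ∀ k, Measurable fun t : ℝ =>
      ENNReal.ofReal (|t - -(hH.eigenvalues k / τ)| ^ (-r)) := fun k => by fun_prop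
  refine (lintegral_mono hpt).trans ?_
  rw [lintegral_const_mul _ (by fun_prop), lintegral_finsetSum _ (fun k _ => by fun_prop)]
  simp only [lintegral_const_mul _ (hm _)]
  refine (mul_le_mul_right (Finset.sum_le_sum fun k _ =>
    mul_le_mul_right (lintegral_abs_sub_rpow_neg hr0 hr1 _) _) _).trans (le_of_eq ?_)
  simp only [Finset.sum_const, Finset.card_univ, Fintype.card_prod, Fintype.card_fin,
    nsmul_eq_mul]
  rw [ENNReal.ofReal_mul (by positivity), ENNReal.ofReal_mul (by positivity),
    ENNReal.ofReal_mul (by positivity), ENNReal.ofReal_mul (by positivity),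
    ENNReal.ofReal_pow (by positivity), ENNReal.ofReal_natCast, ENNReal.ofReal_natCast]
  push_cast
  ring

lemma measurable_opNorm_Gblock_rpow (r z : ℝ) (x y : Fin n) : Measurable fun ω : ΩW n W =>
    ENNReal.ofReal (opNorm (Gblock ω z x y) ^ r) :=
  ENNReal.measurable_ofReal.comp ((measurable_opNorm.comp (measurable_Gblock _ _ _)).pow_const r)

lemma measurable_gw_qtot : Measurable (gw qtot : ΩW n W → ℝ≥0∞) := by unfold gw; fun_prop

lemma measurable_shv_shift {f : ΩW n W → ℝ≥0∞} (hf : Measurable f) (σ : ℝ) :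
    Measurable fun p : ℝ × ΩW n W => f (p.2 + shv n W (p.1 * σ)) := by
  have : Continuous fun p : ℝ × ΩW n W => p.2 + shv n W (p.1 * σ) :=
    continuous_snd.add (continuous_shv.comp (continuous_fst.mul continuous_const))
  exact hf.comp this.measurable

lemma setLIntegral_shv_shift_le {f : ΩW n W → ℝ≥0∞} (hf : Measurable f) {σ : ℝ} {c : ℝ≥0∞}
    (h : ∀ ω, ∫⁻ t in Set.Icc (-1:ℝ) 1, f (ω + shv n W (t * σ)) ≤ c) :
    ∫⁻ t in Set.Icc (-1:ℝ) 1, ∫⁻ ω, f (ω + shv n W (t * σ)) * gw qtot ω ≤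
      c * ∫⁻ ω : ΩW n W, gw qtot ω := by
  have hs := measurable_shv_shift hf σ
  have hjm : Measurable fun p : ℝ × ΩW n W => f (p.2 + shv n W (p.1 * σ)) * gw qtot p.2 :=
    hs.mul (measurable_gw_qtot.comp measurable_snd)
  rw [lintegral_lintegral_swap hjm.aemeasurable, ← lintegral_const_mul _ measurable_gw_qtot]
  refine lintegral_mono (μ := volume) fun ω => ?_
  have h0 : Measurable fun t : ℝ => (t, ω) := measurable_prodMk_right
  have h1 : Measurable fun t : ℝ => f (ω + shv n W (t * σ)) := hs.comp h0
  have h2 : ∫⁻ t in Set.Icc (-1:ℝ) 1, f (ω + shv n W (t * σ)) * gw qtot ω =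
    (∫⁻ t in Set.Icc (-1:ℝ) 1, f (ω + shv n W (t * σ))) * gw qtot ω := lintegral_mul_const _ h1
  exact h2.le.trans (mul_le_mul_left (h ω) _)

lemma lintegral_gw_le_of_shift_average {f : ΩW n W → ℝ≥0∞} (hf : Measurable f) {τ : ℝ}
    {c : ℝ≥0∞} (hτ : (W : ℝ) ^ 2 * n * τ ^ 2 ≤ 1)
    (h1 : ∀ ω, ∫⁻ t in Set.Icc (-1:ℝ) 1, f (ω + shv n W (t * τ)) ≤ c)
    (h2 : ∀ ω, ∫⁻ t in Set.Icc (-1:ℝ) 1, f (ω + shv n W (t * -τ)) ≤ c) :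
    ∫⁻ ω, f ω * gw qtot ω ≤ ENNReal.ofReal (Real.exp 1) * (c * ∫⁻ ω : ΩW n W, gw qtot ω) := by
  have hstep : ∀ t ∈ Set.Icc (-1:ℝ) 1, ∫⁻ ω, f ω * gw qtot ω ≤ ENNReal.ofReal (Real.exp 1) *
      (2⁻¹ * ((∫⁻ ω, f (ω + shv n W (t * τ)) * gw qtot ω) +
        ∫⁻ ω, f (ω + shv n W (t * -τ)) * gw qtot ω)) := by
    intro t ht
    have h := lintegral_gw_le_shift (volume : Measure (ΩW n W)) measurable_qtot
      (v := shv n W (t * τ)) (fun x => qtot_par x _) hf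
    have e : ∀ ω : ΩW n W, ω - shv n W (t * τ) = ω + shv n W (t * -τ) := by
      intro ω; rw [mul_neg, shv_neg, sub_eq_add_neg]
    simp only [e] at h
    refine h.trans (mul_le_mul_left (ENNReal.ofReal_le_ofReal (Real.exp_le_exp.2 ?_)) _)
    rw [qtot_shv]
    have ht2 : t ^ 2 ≤ 1 := by
      rw [← sq_abs]
      have := abs_le.2 ht
      nlinarith [abs_nonneg t]
    calc (W : ℝ) ^ 2 * n * (t * τ) ^ 2 = t ^ 2 * ((W : ℝ) ^ 2 * n * τ ^ 2) := by ring
      _ ≤ 1 * 1 := by gcongr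
      _ = 1 := one_mul 1
  have hm : ∀ σ : ℝ, Measurable fun t : ℝ => ∫⁻ ω, f (ω + shv n W (t * σ)) * gw qtot ω := by
    intro σ
    have hjm : Measurable fun p : ℝ × ΩW n W => f (p.2 + shv n W (p.1 * σ)) * gw qtot p.2 :=
      (measurable_shv_shift hf σ).mul (measurable_gw_qtot.comp measurable_snd)
    exact hjm.lintegral_prod_right'
  have h1' := setLIntegral_shv_shift_le hf h1
  have h2' := setLIntegral_shv_shift_le hf h2
  set Z := ∫⁻ ω : ΩW n W, gw qtot ω
  set I := ∫⁻ ω, f ω * gw qtot ω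
  have hvol : ∫⁻ t in Set.Icc (-1:ℝ) 1, I = I * 2 := by
    rw [lintegral_const, Measure.restrict_apply_univ, Real.volume_Icc]
    norm_num
  have hmain : I * 2 ≤ ENNReal.ofReal (Real.exp 1) * (c * Z) := by
    rw [← hvol]
    refine (setLIntegral_mono' measurableSet_Icc hstep).trans ?_
    have hms : Measurable fun t : ℝ => ((∫⁻ ω, f (ω + shv n W (t * τ)) * gw qtot ω) +
        ∫⁻ ω, f (ω + shv n W (t * -τ)) * gw qtot ω) := (hm τ).add (hm (-τ))
    rw [lintegral_const_mul _ (hms.const_mul _), lintegral_const_mul _ hms,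
      lintegral_add_left (hm τ)]
    refine mul_le_mul_right ?_ _
    refine (mul_le_mul_right (add_le_add h1' h2') _).trans (le_of_eq ?_)
    rw [← two_mul, ← mul_assoc, ENNReal.inv_mul_cancel (by norm_num) (by norm_num), one_mul]
  have hle : I ≤ I * 2 := by
    rw [mul_two]; exact le_self_add
  exact hle.trans hmain

lemma lintegral_opNorm_rpow_le {r : ℝ} (hr0 : 0 < r) (hr1 : r < 1) (hn : 0 < n) (hW : 0 < W)
    (z : ℝ) (x y : Fin n) :
    ∫⁻ ω : ΩW n W, ENNReal.ofReal (opNorm (Gblock ω z x y) ^ r) * gw qtot ω ≤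
      ENNReal.ofReal (3 * (2 + 2 / (1 - r)) * ((n : ℝ) * W) ^ 4) * ∫⁻ ω : ΩW n W, gw qtot ω := by
  have hn' : (1 : ℝ) ≤ n := by exact_mod_cast hn
  have hW' : (1 : ℝ) ≤ W := by exact_mod_cast hW
  have hfm := measurable_opNorm_Gblock_rpow (W := W) r z x y
  obtain ⟨τ, hτdef⟩ : ∃ τ : ℝ, τ = ((W : ℝ) * n)⁻¹ := ⟨_, rfl⟩
  have hτ : 0 < τ := by rw [hτdef]; positivity
  have hcost : (W : ℝ) ^ 2 * n * τ ^ 2 ≤ 1 := by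
    have : (W : ℝ) ^ 2 * n * τ ^ 2 = 1 / n := by
      rw [hτdef]; field_simp
    rw [this, div_le_one (by linarith)]
    linarith
  have hA := fun ω : ΩW n W => setLIntegral_opNorm_shv_le hr0 hr1 hτ.ne' ω z x y
  have hB := fun ω : ΩW n W =>
    setLIntegral_opNorm_shv_le hr0 hr1 (neg_ne_zero.2 hτ.ne') ω z x y
  simp only [abs_neg] at hB
  refine (lintegral_gw_le_of_shift_average hfm hcost hA hB).trans ?_
  rw [← mul_assoc, ← ENNReal.ofReal_mul (Real.exp_pos _).le]
  refine mul_le_mul_left (ENNReal.ofReal_le_ofReal ?_) _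
  have hc : 0 ≤ 2 + 2 / (1 - r) := by
    have : 0 < 1 - r := by linarith
    positivity
  have ht : |τ| ^ (-r) ≤ (W : ℝ) * n := by
    rw [abs_of_pos hτ, hτdef, Real.inv_rpow (by positivity), Real.rpow_neg (by positivity), inv_inv]
    have h1 : (1 : ℝ) ≤ W * n := by nlinarith
    calc ((W : ℝ) * n) ^ r ≤ ((W : ℝ) * n) ^ (1 : ℝ) :=
          Real.rpow_le_rpow_of_exponent_le h1 hr1.le
      _ = _ := Real.rpow_one _
  have he : Real.exp 1 ≤ 3 := Real.exp_one_lt_three.le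
  calc Real.exp 1 * ((W : ℝ) ^ 2 * (n * W) * (|τ| ^ (-r) * (2 + 2 / (1 - r))))
      ≤ 3 * ((W : ℝ) ^ 2 * (n * W) * ((W * n) * (2 + 2 / (1 - r)))) := by
        gcongr
    _ = 3 * (2 + 2 / (1 - r)) * ((n : ℝ) ^ 2 * W ^ 4) := by ring
    _ ≤ 3 * (2 + 2 / (1 - r)) * ((n : ℝ) * W) ^ 4 := by
        rw [mul_pow]
        gcongr
        norm_num

end

section

section tilt

variable {α : Type*} [MeasurableSpace α] {P : Measure α} [IsProbabilityMeasure P] {X : α → ℝ}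
  {s r q : ℝ}

lemma exp_mul_le_one_add (hq : 0 ≤ q) (hqr : q ≤ r) (x : ℝ) :
    Real.exp (q * x) ≤ 1 + Real.exp (r * x) := by
  rcases le_total 0 x with h | h
  · have : Real.exp (q * x) ≤ Real.exp (r * x) := Real.exp_le_exp.2 (by gcongr)
    linarith
  · have : Real.exp (q * x) ≤ 1 := Real.exp_le_one_iff.2 (mul_nonpos_of_nonneg_of_nonpos hq h)
    linarith [Real.exp_pos (r * x)]

lemma integrable_exp_mul_of_le (hX : Measurable X) (hr : Integrable (fun ω => Real.exp (r * X ω)) P)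
    (hq : 0 ≤ q) (hqr : q ≤ r) : Integrable (fun ω => Real.exp (q * X ω)) P := by
  refine Integrable.mono' ((integrable_const (1 : ℝ)).add hr)
    (Real.measurable_exp.comp (hX.const_mul q)).aestronglyMeasurable (ae_of_all _ fun ω => ?_)
  rw [Real.norm_eq_abs, abs_of_pos (Real.exp_pos _)]
  exact exp_mul_le_one_add hq hqr _

lemma sq_div_four_le_integral_exp (hX : Measurable X)
    (hr : Integrable (fun ω => Real.exp (r * X ω)) P) (hsr : s ≤ r) {M : ℝ}
    (hM : 0 < M) (hM1 : M ≤ 1) (hlow : M ≤ ∫ ω, Real.exp ((s / 2) * X ω) ∂P)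
    (hq1 : s / 2 < q) (hq2 : q < s) : M ^ 2 / 4 ≤ ∫ ω, Real.exp (q * X ω) ∂P := by
  have hi1 := integrable_exp_mul_of_le (q := s / 2) hX hr (by linarith) (by linarith)
  have hi2 := integrable_exp_mul_of_le (q := q) hX hr (by linarith) (by linarith)
  have hpt : ∀ x : ℝ, M / 2 * (Real.exp ((s / 2) * x) - M / 2) ≤ Real.exp (q * x) := by
    intro x
    set u := Real.exp ((s / 2) * x) with hu
    have hu0 : 0 < u := Real.exp_pos _
    rcases le_total 0 x with h | h
    · have h1 : u ≤ Real.exp (q * x) := Real.exp_le_exp.2 (by gcongr)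
      nlinarith
    · have h1 : u ^ 2 ≤ Real.exp (q * x) := by
        rw [hu, ← Real.exp_nat_mul]
        apply Real.exp_le_exp.2
        push_cast
        nlinarith
      rcases le_total u (M / 2) with h2 | h2
      · have : M / 2 * (u - M / 2) ≤ 0 :=
          mul_nonpos_of_nonneg_of_nonpos (by linarith) (by linarith)
        linarith [Real.exp_pos (q * x)]
      · nlinarith
  have h := integral_mono ((hi1.sub (integrable_const (M / 2))).const_mul (M / 2)) hi2
    (fun ω => hpt (X ω))
  rw [integral_const_mul, integral_sub' hi1 (integrable_const _), integral_const] at h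
  simp only [probReal_univ, one_smul] at h
  nlinarith

lemma setIntegral_exp_le_half (hX : Measurable X)
    (hr : Integrable (fun ω => Real.exp (r * X ω)) P) (hs : 0 < s) (hsr : s ≤ r) {K : ℝ}
    (hK : ∫ ω, Real.exp (r * X ω) ∂P ≤ K) {M : ℝ}
    (hM : 0 < M) (hM1 : M ≤ 1) (hlow : M ≤ ∫ ω, Real.exp ((s / 2) * X ω) ∂P)
    (hq1 : s / 2 < q) (hq2 : q < s) {E : Set α} {l ε : ℝ} (hl : 0 ≤ l)
    (hε : P.real E ≤ ε)
    (hnum : Real.exp (s * l) * ε + Real.exp (-(r - s) * l) * K ≤ M ^ 2 / 8) :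
    ∫ ω in E, Real.exp (q * X ω) ∂P ≤ 1 / 2 * ∫ ω, Real.exp (q * X ω) ∂P := by
  have hi2 := integrable_exp_mul_of_le (q := q) hX hr (by linarith) (by linarith)
  have hlow2 := sq_div_four_le_integral_exp hX hr hsr hM hM1 hlow hq1 hq2
  have hpt : ∀ x : ℝ, Real.exp (q * x) ≤ Real.exp (s * l) +
      Real.exp (-(r - s) * l) * Real.exp (r * x) := by
    intro x
    rcases le_total x l with h | h
    · have : Real.exp (q * x) ≤ Real.exp (s * l) := by
        apply Real.exp_le_exp.2
        rcases le_total 0 x with h0 | h0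
        · exact mul_le_mul hq2.le h h0 hs.le
        · nlinarith
      have := mul_pos (Real.exp_pos (-(r - s) * l)) (Real.exp_pos (r * x))
      linarith
    · have : Real.exp (q * x) ≤ Real.exp (-(r - s) * l) * Real.exp (r * x) := by
        rw [← Real.exp_add]
        apply Real.exp_le_exp.2
        nlinarith
      linarith [Real.exp_pos (s * l)]
  have h1 : ∫ ω in E, Real.exp (q * X ω) ∂P ≤ ∫ ω in E, (Real.exp (s * l) +
      Real.exp (-(r - s) * l) * Real.exp (r * X ω)) ∂P :=
    setIntegral_mono hi2.integrableOn
      (((integrable_const _).add (hr.const_mul _)).integrableOn) (fun ω => hpt _)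
  have h2 : ∫ ω in E, (Real.exp (s * l) + Real.exp (-(r - s) * l) * Real.exp (r * X ω)) ∂P =
      Real.exp (s * l) * P.real E +
        Real.exp (-(r - s) * l) * ∫ ω in E, Real.exp (r * X ω) ∂P := by
    rw [integral_add (integrable_const _).integrableOn (hr.const_mul _).integrableOn,
      integral_const_mul, setIntegral_const, smul_eq_mul, mul_comm]
  have h3 : ∫ ω in E, Real.exp (r * X ω) ∂P ≤ K :=
    (setIntegral_le_integral hr (ae_of_all _ fun ω => (Real.exp_pos _).le)).trans hK
  have h4 : Real.exp (s * l) * P.real E ≤ Real.exp (s * l) * ε := by gcongr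
  have h5 : Real.exp (-(r - s) * l) * ∫ ω in E, Real.exp (r * X ω) ∂P ≤
      Real.exp (-(r - s) * l) * K := by gcongr
  linarith

end tilt

/-- Smallness of an event that survives the tilt. -/
lemma exists_tilt_rate {ξ s C : ℝ} (hξ : 0 < ξ) (hs0 : 0 < s) (hs1 : s < 1) (hC : 1 ≤ C) :
    ∃ A : ℝ, 0 < A ∧ ∀ n W : ℕ, 1 ≤ n → 1 ≤ W → ∃ l : ℝ, 0 ≤ l ∧
      Real.exp (s * l) * Real.exp (-A * (n + Real.log W)) +
        Real.exp (-((1 + s) / 2 - s) * l) * (C * ((n : ℝ) * W) ^ 4) ≤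
          Real.exp (-ξ * n) ^ 2 / 8 := by
  have hd : 0 < (1 + s) / 2 - s := by linarith
  set d := (1 + s) / 2 - s with hdd
  have hlC : 0 ≤ Real.log C := Real.log_nonneg hC
  have hl16 : 0 < Real.log 16 := Real.log_pos (by norm_num)
  set L := (Real.log 16 + Real.log C + 4 + 2 * ξ) / d with hL
  have hL0 : 0 < L := by positivity
  refine ⟨s * L + 2 * ξ + Real.log 16, by positivity, fun n W hn hW => ?_⟩
  have hn' : (1 : ℝ) ≤ n := by exact_mod_cast hn
  have hW' : (1 : ℝ) ≤ W := by exact_mod_cast hW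
  have hlW : 0 ≤ Real.log W := Real.log_nonneg hW'
  have hln : Real.log n ≤ n := (Real.log_le_sub_one_of_pos (by linarith)).trans (by linarith)
  set y := (n : ℝ) + Real.log W with hy
  have hy1 : 1 ≤ y := by linarith
  have hny : (n : ℝ) ≤ y := by linarith
  refine ⟨L * y, by positivity, ?_⟩
  have e16 : Real.exp (-ξ * n) ^ 2 / 16 = Real.exp (-(2 * ξ * n) - Real.log 16) := by
    rw [Real.exp_sub, Real.exp_log (by norm_num), ← Real.exp_nat_mul]
    congr 2; push_cast; ring
  have h1 : Real.exp (s * (L * y)) * Real.exp (-(s * L + 2 * ξ + Real.log 16) * y) ≤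
      Real.exp (-ξ * n) ^ 2 / 16 := by
    rw [e16, ← Real.exp_add]
    apply Real.exp_le_exp.2
    nlinarith
  have h2 : Real.exp (-d * (L * y)) * (C * ((n : ℝ) * W) ^ 4) ≤ Real.exp (-ξ * n) ^ 2 / 16 := by
    have e : C * ((n : ℝ) * W) ^ 4 = Real.exp (Real.log C + 4 * (Real.log n + Real.log W)) := by
      rw [Real.exp_add, Real.exp_log (by linarith), ← Real.log_mul (by positivity) (by positivity),
        mul_comm 4 (Real.log _), Real.exp_mul, Real.exp_log (by positivity)]
      norm_cast
    rw [e16, e, ← Real.exp_add]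
    apply Real.exp_le_exp.2
    have hdL : d * L = Real.log 16 + Real.log C + 4 + 2 * ξ := by
      rw [hL]; field_simp
    have : -d * (L * y) = -(d * L) * y := by ring
    rw [this, hdL]
    nlinarith
  linarith

end

section

variable {W m : ℕ}

lemma lintegral_gw_ne_top {E : Type*} [NormedAddCommGroup E] [NormedSpace ℝ E]
    [FiniteDimensional ℝ E] [MeasurableSpace E] [BorelSpace E] (μ : Measure E) [μ.IsAddHaarMeasure]
    {q : E → ℝ} (hq : ∀ x, ‖x‖ ^ 2 ≤ q x) : ∫⁻ x, gw q x ∂μ ≠ ∞ := by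
  set k := Module.finrank ℝ E + 1
  have hk : ∀ x : E, Real.exp (-q x) ≤
      (2 ^ k * k.factorial * Real.exp 1) * (1 + ‖x‖) ^ (-((2 * k : ℕ) : ℝ)) := by
    intro x
    have hx := norm_nonneg x
    have h1 : (1 + ‖x‖) ^ (2 * k) ≤ 2 ^ k * (1 + ‖x‖ ^ 2) ^ k := by
      rw [pow_mul, ← mul_pow]
      exact pow_le_pow_left₀ (by positivity) (by nlinarith [sq_nonneg (1 - ‖x‖)]) _
    have h2 : (1 + ‖x‖ ^ 2) ^ k ≤ k.factorial * Real.exp (1 + ‖x‖ ^ 2) := by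
      have := Real.pow_div_factorial_le_exp (1 + ‖x‖ ^ 2) (by positivity) k
      rwa [div_le_iff₀' (by positivity)] at this
    have h3 : Real.exp (1 + ‖x‖ ^ 2) * Real.exp (-q x) ≤ Real.exp 1 := by
      rw [← Real.exp_add]; exact Real.exp_le_exp.2 (by linarith [hq x])
    rw [Real.rpow_neg (by positivity), Real.rpow_natCast, ← div_eq_mul_inv,
      le_div_iff₀ (by positivity)]
    calc Real.exp (-q x) * (1 + ‖x‖) ^ (2 * k)
        ≤ Real.exp (-q x) * (2 ^ k * (k.factorial * Real.exp (1 + ‖x‖ ^ 2))) := by gcongr; nlinarith [pow_pos (two_pos : (0:ℝ) < 2) k]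
      _ = 2 ^ k * k.factorial * (Real.exp (1 + ‖x‖ ^ 2) * Real.exp (-q x)) := by ring
      _ ≤ _ := by gcongr
  have hi := (integrable_one_add_norm (μ := μ) (r := ((2 * k : ℕ) : ℝ))
    (by push_cast [k]; linarith [(Nat.cast_nonneg (Module.finrank ℝ E) : (0:ℝ) ≤ _)])).const_mul
    (2 ^ k * k.factorial * Real.exp 1)
  refine (lt_of_le_of_lt (lintegral_mono fun x => ?_) hi.lintegral_lt_top).ne
  exact ENNReal.ofReal_le_ofReal (hk x)

lemma norm_sq_le_hq (x : HermParam W) : ‖x‖ ^ 2 ≤ hq x := by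
  have hn : 0 ≤ Real.sqrt (hq x) := Real.sqrt_nonneg _
  have h0 := hq_nonneg x
  have key : ∀ i j, ‖toHerm x i j‖ ≤ Real.sqrt (hq x) := fun i j =>
    Real.le_sqrt_of_sq_le (norm_sq_le_fsq _ i j)
  have : ‖x‖ ≤ Real.sqrt (hq x) := by
    rw [Prod.norm_def]
    refine max_le ((pi_norm_le_iff_of_nonneg hn).2 fun i => ?_)
      ((pi_norm_le_iff_of_nonneg hn).2 fun p => ?_)
    · have := key i i
      simpa [toHerm] using this
    · have := key p.1.1 p.1.2
      simpa [toHerm, p.2, p.2.ne] using this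
  calc ‖x‖ ^ 2 ≤ Real.sqrt (hq x) ^ 2 := by gcongr
    _ = hq x := Real.sq_sqrt h0

lemma norm_sq_le_mq (T : MatP W) : ‖T‖ ^ 2 ≤ mq T := by
  have hn : 0 ≤ Real.sqrt (mq T) := Real.sqrt_nonneg _
  have : ‖T‖ ≤ Real.sqrt (mq T) :=
    (pi_norm_le_iff_of_nonneg hn).2 fun i => (pi_norm_le_iff_of_nonneg hn).2 fun j =>
      Real.le_sqrt_of_sq_le (norm_sq_le_fsq (Matrix.of T : Mat W) i j)
  calc ‖T‖ ^ 2 ≤ Real.sqrt (mq T) ^ 2 := by gcongr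
    _ = mq T := Real.sq_sqrt (mq_nonneg T)

lemma ZH_ne_top (hW : 0 < W) : ZH W ≠ ∞ := by
  have h1 : (1 : ℝ) ≤ W := by exact_mod_cast hW
  exact lintegral_gw_ne_top volume fun x => (norm_sq_le_hq x).trans
    (by nlinarith [hq_nonneg x])

lemma ZM_ne_top (hW : 0 < W) : ZM W ≠ ∞ := by
  have h1 : (1 : ℝ) ≤ W := by exact_mod_cast hW
  exact lintegral_gw_ne_top volume fun x => (norm_sq_le_mq x).trans
    (by nlinarith [mq_nonneg x])

lemma lintegral_fin_prod {E : Type*} [MeasureSpace E] [SigmaFinite (volume : Measure E)]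
    {f : E → ℝ≥0∞} (hf : Measurable f) (k : ℕ) :
    ∫⁻ x : Fin k → E, ∏ j, f (x j) = (∫⁻ x, f x) ^ k := by
  have hm : ∀ k, Measurable fun x : Fin k → E => ∏ j, f (x j) := fun k =>
    Finset.measurable_prod _ fun j _ => hf.comp (measurable_pi_apply j)
  induction k with
  | zero => simp [volume_pi]
  | succ k ih =>
    rw [lintegral_fin_cons (hm _)]
    simp only [Fin.prod_univ_succ, Fin.cons_zero, Fin.cons_succ]
    have : ∀ g, ∫⁻ x : Fin k → E, f g * ∏ j, f (x j) = f g * (∫⁻ x, f x) ^ k := fun g => by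
      rw [lintegral_const_mul _ (hm k), ih]
    simp only [this]
    rw [lintegral_mul_const _ hf, pow_succ']

lemma lintegral_gw_qtot (m W : ℕ) :
    ∫⁻ ω : ΩW (m + 1) W, gw qtot ω = ZH W ^ (m + 1) * ZM W ^ m := by
  have h1 : ∫⁻ ω : ΩW (m + 1) W, gw qtot ω =
      ∫⁻ ω : ΩW (m + 1) W, (∏ j, gH W (ω.1 j)) * ∏ j, gM W (ω.2 j) :=
    lintegral_congr fun ω => gw_qtot ω
  have hH : Measurable (gH W) := by unfold gH gw; fun_prop
  have hM : Measurable (gM W) := by unfold gM gw; fun_prop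
  rw [h1]
  have e1 : Measurable fun x : Fin (m + 1) → HermParam W => ∏ j, gH W (x j) :=
    Finset.measurable_prod _ fun j _ => hH.comp (measurable_pi_apply j)
  have e2 : Measurable fun x : Fin m → MatP W => ∏ j, gM W (x j) :=
    Finset.measurable_prod _ fun j _ => hM.comp (measurable_pi_apply j)
  have h2 : ∫⁻ ω : ΩW (m + 1) W, (∏ j, gH W (ω.1 j)) * ∏ j, gM W (ω.2 j) =
      (∫⁻ x : Fin (m + 1) → HermParam W, ∏ j, gH W (x j)) *
        ∫⁻ x : Fin m → MatP W, ∏ j, gM W (x j) :=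
    lintegral_prod_mul e1.aemeasurable e2.aemeasurable
  rw [h2]
  have h3 : ∫⁻ x : Fin (m + 1) → HermParam W, ∏ j, gH W (x j) = ZH W ^ (m + 1) := by
    rw [lintegral_fin_prod hH, ZH]
  have h4 : ∫⁻ x : Fin m → MatP W, ∏ j, gM W (x j) = ZM W ^ m := by
    rw [lintegral_fin_prod hM, ZM]
  rw [h3, h4]

/-- Normalization of the whole weight. -/
def Ztot (m W : ℕ) : ℝ≥0∞ := ∫⁻ ω : ΩW (m + 1) W, gw qtot ω

lemma Ztot_ne_zero : Ztot m W ≠ 0 := by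
  rw [Ztot, lintegral_gw_qtot]
  exact mul_ne_zero (pow_ne_zero _ (ZH_ne_zero)) (pow_ne_zero _ (ZM_ne_zero))

lemma Ztot_ne_top (hW : 0 < W) : Ztot m W ≠ ⊤ := by
  rw [Ztot, lintegral_gw_qtot]
  exact ENNReal.mul_ne_top (ENNReal.pow_ne_top (ZH_ne_top hW)) (ENNReal.pow_ne_top (ZM_ne_top hW))

/-- The law of the model in Schur complement coordinates. -/
def Pc (z : ℝ) (m W : ℕ) : Measure (ΩW (m + 1) W) :=
  (Ztot m W)⁻¹ • volume.withDensity fun p => gw qtot (conf z p)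

lemma measurable_gw_conf (z : ℝ) : Measurable fun p : ΩW (m + 1) W => gw qtot (conf z p) :=
  measurable_gw_qtot.comp (measurable_conf z)

lemma lintegral_Pc (z : ℝ) (f : ΩW (m + 1) W → ℝ≥0∞) (hf : Measurable f) :
    ∫⁻ p, f p ∂(Pc z m W) = (Ztot m W)⁻¹ * ∫⁻ p, f p * gw qtot (conf z p) := by
  rw [Pc, lintegral_smul_measure, lintegral_withDensity_eq_lintegral_mul _ (measurable_gw_conf z) hf,
    smul_eq_mul]
  congr 1
  exact lintegral_congr fun p => mul_comm _ _

lemma isProbabilityMeasure_Pc (hW : 0 < W) (z : ℝ) : IsProbabilityMeasure (Pc z m W) := by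
  constructor
  rw [← lintegral_one, lintegral_Pc z _ measurable_const]
  simp only [one_mul]
  rw [lintegral_conf z measurable_gw_qtot]
  exact ENNReal.inv_mul_cancel Ztot_ne_zero (Ztot_ne_top hW)

lemma wegner_eq_map (z : ℝ) : wegner (m + 1) W = (Pc z m W).map (conf z) := by
  have h1 : wegnerRaw (m + 1) W Set.univ = Ztot m W := by
    rw [wegnerRaw, withDensity_apply _ MeasurableSet.univ, Measure.restrict_univ, Ztot,
      wegnerDensity_eq_gw]
  rw [wegner, h1, Pc, Measure.map_smul]
  congr 1
  ext s hs
  rw [wegnerRaw, withDensity_apply _ hs, Measure.map_apply (measurable_conf z) hs,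
    withDensity_apply _ (measurable_conf z hs), ← lintegral_indicator hs,
    ← lintegral_indicator (measurable_conf z hs), wegnerDensity_eq_gw,
    ← lintegral_conf z (measurable_gw_qtot.indicator hs)]
  rfl

lemma tiltProb_map {α β : Type*} [MeasurableSpace α] [MeasurableSpace β] {μ : Measure α}
    {g : α → β} (hg : Measurable g) {X : β → ℝ} (hX : Measurable X) (q : ℝ) {E : Set β}
    (hE : MeasurableSet E) :
    tiltProb (μ.map g) X q E = tiltProb μ (X ∘ g) q (g ⁻¹' E) := by
  have hm : Measurable fun ω => Real.exp (q * X ω) := by fun_prop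
  unfold tiltProb
  rw [setIntegral_map hE hm.aestronglyMeasurable hg.aemeasurable,
    integral_map hg.aemeasurable hm.aestronglyMeasurable]
  rfl

/-- The observable pulled back to Schur complement coordinates. -/
def Yc (z : ℝ) (p : ΩW (m + 1) W) : ℝ := logG z (conf z p)

@[fun_prop] lemma measurable_Yc (z : ℝ) : Measurable (Yc z : ΩW (m + 1) W → ℝ) :=
  (measurable_logG z).comp (measurable_conf z)

lemma measurableSet_regular : MeasurableSet {p : ΩW (m + 1) W | Regular p} := by
  have h1 : ∀ j, MeasurableSet {p : ΩW (m + 1) W | j ≤ m → IsUnit (Vm p j).det} := by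
    intro j
    simp only [isUnit_iff_ne_zero]
    by_cases h : j ≤ m
    · simp only [h, true_imp_iff]
      exact (measurable_matrix_det.comp (measurable_Vm j)) (measurableSet_singleton 0).compl
    · simp [h]
  have h2 : ∀ j, MeasurableSet {p : ΩW (m + 1) W | j < m → IsUnit (Tm p j).det} := by
    intro j
    simp only [isUnit_iff_ne_zero]
    by_cases h : j < m
    · simp only [h, true_imp_iff]
      exact (measurable_matrix_det.comp (measurable_Tm j)) (measurableSet_singleton 0).compl
    · simp [h]
  have : {p : ΩW (m + 1) W | Regular p} =
      (⋂ j, {p : ΩW (m + 1) W | j ≤ m → IsUnit (Vm p j).det}) ∩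
        ⋂ j, {p : ΩW (m + 1) W | j < m → IsUnit (Tm p j).det} := by
    ext p; simp only [Regular, Set.mem_inter_iff, Set.mem_iInter]; rfl
  rw [this]
  exact (MeasurableSet.iInter h1).inter (MeasurableSet.iInter h2)

lemma ae_regular_Pc (z : ℝ) : ∀ᵐ p ∂(Pc z m W), Regular p :=
  (Measure.AbsolutelyContinuous.smul_left (withDensity_absolutelyContinuous _ _) _).ae_le
    (ae_regular m W)

lemma regular_scl {θ : (Fin (m + 1) → HermParam W) → Fin m → ℝ} {σ b : ℝ} {p : ΩW (m + 1) W}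
    (hp : Regular p) : Regular (scl σ b θ p) := by
  have cs : ∀ (r : ℝ) (M : Mat W), r • M = ((r : ℝ) : ℂ) • M := fun r M => by ext; simp
  have hu : ∀ (r : ℝ) (M : Mat W), IsUnit M.det → IsUnit (Real.exp r • M).det := by
    intro r M hM
    rw [cs, det_smul, isUnit_iff_ne_zero]
    exact mul_ne_zero (pow_ne_zero _ (by exact_mod_cast (Real.exp_pos r).ne')) hM.ne_zero
  refine ⟨fun j hj => ?_, fun j hj => ?_⟩
  · have h := hp.1 j hj
    rw [Vm_of_lt _ (show j < m + 1 by omega)] at h ⊢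
    simp only [scl, toHerm_smul]
    exact hu _ _ h
  · have h := hp.2 j hj
    rw [Tm_of_lt _ hj] at h ⊢
    exact hu _ _ h

lemma Yc_eq_lg (z : ℝ) {p : ΩW (m + 1) W} (hp : Regular p) : Yc z p = lg p := logG_conf z hp

/-- Mermin-Wagner inequality for the weighted integrals on the good event. -/
lemma setIntegral_good_le (hW : 0 < W) (z : ℝ) {q μ₀ α β b : ℝ} (hβ : 0 < β)
    {θ : (Fin (m + 1) → HermParam W) → Fin m → ℝ} (hθ : ∀ j, Measurable fun γ => θ γ j)
    {Gd : Set (ΩW (m + 1) W)} (hGd : MeasurableSet Gd)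
    (hintg : Integrable (fun p => Real.exp (q * Yc z p)) (Pc z m W))
    (hcost : ∀ p ∈ Gd, Regular p → qtot (conf z (scl 1 b θ p)) + qtot (conf z (scl (-1) b θ p)) -
      2 * qtot (conf z p) ≤ 2 * Real.log β)
    (hδ : ∀ p ∈ Gd, Regular p → 3 * α ≤ ∑ j, θ p.1 j - b) :
    ∫ p in {p | |Yc z p - μ₀| ≤ α} ∩ Gd, Real.exp (q * Yc z p) ∂(Pc z m W) ≤
      β * Real.sqrt ((∫ p in {p | 2 * α ≤ Yc z p - μ₀}, Real.exp (q * Yc z p) ∂(Pc z m W)) *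
        ∫ p in {p | Yc z p - μ₀ ≤ -(2 * α)}, Real.exp (q * Yc z p) ∂(Pc z m W)) := by
  have hYm : Measurable (Yc z : ΩW (m + 1) W → ℝ) := measurable_Yc z
  have hem : Measurable fun p : ΩW (m + 1) W => ENNReal.ofReal (Real.exp (q * Yc z p)) := by
    fun_prop
  set w : ΩW (m + 1) W → ℝ≥0∞ := fun p =>
    (Ztot m W)⁻¹ * (ENNReal.ofReal (Real.exp (q * Yc z p)) * gw qtot (conf z p)) with hwdef
  have hw : Measurable w := (hem.mul (measurable_gw_conf z)).const_mul _
  have hA0 : MeasurableSet {p : ΩW (m + 1) W | |Yc z p - μ₀| ≤ α} :=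
    measurableSet_le (by fun_prop) measurable_const
  have hUp : MeasurableSet {p : ΩW (m + 1) W | 2 * α ≤ Yc z p - μ₀} :=
    measurableSet_le measurable_const (by fun_prop)
  have hUm : MeasurableSet {p : ΩW (m + 1) W | Yc z p - μ₀ ≤ -(2 * α)} :=
    measurableSet_le (by fun_prop) measurable_const
  have hconv : ∀ E : Set (ΩW (m + 1) W), MeasurableSet E →
      ∫⁻ p in E, w p = ENNReal.ofReal (∫ p in E, Real.exp (q * Yc z p) ∂(Pc z m W)) := by
    intro E hE
    have e1 : ∫⁻ p in E, ENNReal.ofReal (Real.exp (q * Yc z p)) ∂(Pc z m W) =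
        ∫⁻ p, E.indicator (fun p => ENNReal.ofReal (Real.exp (q * Yc z p))) p ∂(Pc z m W) :=
      (lintegral_indicator hE _).symm
    rw [ofReal_integral_eq_lintegral_ofReal hintg.integrableOn
      (ae_of_all _ fun p => (Real.exp_pos _).le), e1,
      lintegral_Pc z _ (hem.indicator hE), ← lintegral_indicator hE]
    have hme : Measurable fun p =>
        E.indicator (fun p => ENNReal.ofReal (Real.exp (q * Yc z p))) p * gw qtot (conf z p) :=
      (hem.indicator hE).mul (measurable_gw_conf z)
    rw [← lintegral_const_mul _ hme]
    refine lintegral_congr fun p => ?_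
    by_cases hp : p ∈ E
    · simp only [Set.indicator_of_mem hp, hwdef]
    · simp only [Set.indicator_of_notMem hp, zero_mul, mul_zero]
  set R : Set (ΩW (m + 1) W) := {p | Regular p}
  have hR : MeasurableSet R := measurableSet_regular
  have key := setLIntegral_le_sqrt_of_deformation (μ := volume) (Sp := scl 1 b θ)
    (Sm := scl (-1) b θ) (Jp := sclJ 1 b θ) (Jm := sclJ (-1) b θ) (w := w)
    (A := ({p | |Yc z p - μ₀| ≤ α} ∩ Gd) ∩ R)
    (Up := {p | 2 * α ≤ Yc z p - μ₀}) (Um := {p | Yc z p - μ₀ ≤ -(2 * α)})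
    (b := ENNReal.ofReal β)
    (measurable_scl hθ 1 b) (measurable_scl hθ (-1) b) (measurable_sclJ hθ 1 b)
    (measurable_sclJ hθ (-1) b) hw hUp hUm (sclJ_mul b)
    (fun g hg => lintegral_scl hθ 1 b hg) (fun g hg => lintegral_scl hθ (-1) b hg)
    ((hA0.inter hGd).inter hR) ?_ ?_ ?_
  · rw [hconv _ ((hA0.inter hGd).inter hR), hconv _ hUp, hconv _ hUm] at key
    have hae : ∫ p in ({p | |Yc z p - μ₀| ≤ α} ∩ Gd) ∩ R, Real.exp (q * Yc z p) ∂(Pc z m W) =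
        ∫ p in ({p | |Yc z p - μ₀| ≤ α} ∩ Gd), Real.exp (q * Yc z p) ∂(Pc z m W) := by
      refine setIntegral_congr_set ?_
      filter_upwards [ae_regular_Pc (m := m) (W := W) z] with p hp
      exact propext ⟨fun h => h.1, fun h => ⟨h, hp⟩⟩
    rw [hae] at key
    have nn : ∀ E : Set (ΩW (m + 1) W), 0 ≤ ∫ p in E, Real.exp (q * Yc z p) ∂(Pc z m W) :=
      fun E => integral_nonneg fun p => (Real.exp_pos _).le
    rw [← ENNReal.ofReal_pow (nn _), ← ENNReal.ofReal_pow hβ.le, ← ENNReal.ofReal_mul (nn _),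
      ← ENNReal.ofReal_mul (by positivity),
      ENNReal.ofReal_le_ofReal_iff (mul_nonneg (by positivity) (mul_nonneg (nn _) (nn _)))] at key
    have := Real.sqrt_le_sqrt key
    rwa [Real.sqrt_sq (nn _), Real.sqrt_mul (by positivity), Real.sqrt_sq hβ.le] at this
  · rintro p ⟨⟨-, hpG⟩, hpR⟩
    have hc := hcost p hpG hpR
    simp only [hwdef]
    rw [Yc_eq_lg z hpR, Yc_eq_lg z (regular_scl hpR), Yc_eq_lg z (regular_scl hpR),
      lg_scl hW 1 b hpR, lg_scl hW (-1) b hpR]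
    simp only [gw, ← ENNReal.ofReal_mul (Real.exp_pos _).le, ← Real.exp_add]
    rw [mul_pow, mul_mul_mul_comm, ← sq, ← ENNReal.ofReal_pow (Real.exp_pos _).le,
      ← ENNReal.ofReal_mul (Real.exp_pos _).le, mul_left_comm, ← ENNReal.ofReal_pow hβ.le,
      ← ENNReal.ofReal_mul (by positivity)]
    refine mul_le_mul_right (ENNReal.ofReal_le_ofReal ?_) _
    have hb2 : β ^ 2 = Real.exp (2 * Real.log β) := by
      rw [two_mul, Real.exp_add, Real.exp_log hβ, sq]
    rw [hb2, ← Real.exp_add, ← Real.exp_add, ← Real.exp_nat_mul]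
    apply Real.exp_le_exp.2
    push_cast
    nlinarith
  · rintro p ⟨⟨hpA, hpG⟩, hpR⟩
    have hd := hδ p hpG hpR
    have h1 := (abs_le.1 (show |Yc z p - μ₀| ≤ α from hpA)).1
    change 2 * α ≤ Yc z (scl 1 b θ p) - μ₀
    rw [Yc_eq_lg z (regular_scl hpR), lg_scl hW 1 b hpR, ← Yc_eq_lg z hpR]
    linarith
  · rintro p ⟨⟨hpA, hpG⟩, hpR⟩
    have hd := hδ p hpG hpR
    have h1 := (abs_le.1 (show |Yc z p - μ₀| ≤ α from hpA)).2
    change Yc z (scl (-1) b θ p) - μ₀ ≤ -(2 * α)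
    rw [Yc_eq_lg z (regular_scl hpR), lg_scl hW (-1) b hpR, ← Yc_eq_lg z hpR]
    linarith

end

section

variable {W m : ℕ}

lemma exp_mul_log_le {x : ℝ} (hx : 0 ≤ x) (r : ℝ) : Real.exp (r * Real.log x) ≤ 1 + x ^ r := by
  rcases hx.eq_or_lt with h | h
  · rw [← h]; simp [Real.rpow_nonneg]
  · rw [Real.rpow_def_of_pos h, mul_comm]; linarith

lemma lintegral_exp_Yc_le {r : ℝ} (hr0 : 0 < r) (hr1 : r < 1) (hW : 0 < W) (z : ℝ) :
    ∫⁻ p, ENNReal.ofReal (Real.exp (r * Yc z p)) ∂(Pc z m W) ≤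
      ENNReal.ofReal ((1 + 3 * (2 + 2 / (1 - r))) * (((m + 1 : ℕ) : ℝ) * W) ^ 4) := by
  have hem : Measurable fun p : ΩW (m + 1) W => ENNReal.ofReal (Real.exp (r * Yc z p)) := by
    fun_prop
  have hfm := measurable_opNorm_Gblock_rpow (W := W) (n := m + 1) r z 0 (Fin.last m)
  have hgm := measurable_gw_qtot (n := m + 1) (W := W)
  have hF : Measurable fun ω : ΩW (m + 1) W =>
      (1 + ENNReal.ofReal (opNorm (Gblock ω z 0 (Fin.last m)) ^ r)) * gw qtot ω :=
    (measurable_const.add hfm).mul hgm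
  have h0 : 0 ≤ 3 * (2 + 2 / (1 - r)) := by
    have : 0 < 1 - r := by linarith
    positivity
  rw [lintegral_Pc z _ hem]
  have h1 : ∫⁻ p : ΩW (m + 1) W, ENNReal.ofReal (Real.exp (r * Yc z p)) * gw qtot (conf z p) ≤
      ∫⁻ ω : ΩW (m + 1) W,
        (1 + ENNReal.ofReal (opNorm (Gblock ω z 0 (Fin.last m)) ^ r)) * gw qtot ω := by
    rw [← lintegral_conf z hF]
    refine lintegral_mono fun p => ?_
    refine mul_le_mul_left ?_ _
    have hn : 0 ≤ opNorm (Gblock (conf z p) z 0 (Fin.last m)) := norm_nonneg _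
    rw [← ENNReal.ofReal_one, ← ENNReal.ofReal_add zero_le_one (Real.rpow_nonneg hn _)]
    exact ENNReal.ofReal_le_ofReal (exp_mul_log_le hn r)
  have h2 : ∫⁻ ω : ΩW (m + 1) W,
        (1 + ENNReal.ofReal (opNorm (Gblock ω z 0 (Fin.last m)) ^ r)) * gw qtot ω ≤
      ENNReal.ofReal (1 + 3 * (2 + 2 / (1 - r)) * (((m + 1 : ℕ) : ℝ) * W) ^ 4) * Ztot m W := by
    simp only [add_mul, one_mul]
    rw [lintegral_add_left hgm, ENNReal.ofReal_add zero_le_one (by positivity), add_mul,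
      ENNReal.ofReal_one, one_mul]
    exact add_le_add le_rfl (lintegral_opNorm_rpow_le hr0 hr1 (Nat.succ_pos m) hW z 0 (Fin.last m))
  have h3 : (1 : ℝ) ≤ (((m + 1 : ℕ) : ℝ) * W) ^ 4 := by
    have : (1 : ℝ) ≤ ((m + 1 : ℕ) : ℝ) := by exact_mod_cast Nat.succ_pos m
    have : (1 : ℝ) ≤ W := by exact_mod_cast hW
    exact one_le_pow₀ (by nlinarith)
  calc (Ztot m W)⁻¹ * ∫⁻ p : ΩW (m + 1) W,
        ENNReal.ofReal (Real.exp (r * Yc z p)) * gw qtot (conf z p)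
      ≤ (Ztot m W)⁻¹ *
        (ENNReal.ofReal (1 + 3 * (2 + 2 / (1 - r)) * (((m + 1 : ℕ) : ℝ) * W) ^ 4) * Ztot m W) :=
        mul_le_mul_right (h1.trans h2) _
    _ = ENNReal.ofReal (1 + 3 * (2 + 2 / (1 - r)) * (((m + 1 : ℕ) : ℝ) * W) ^ 4) := by
        rw [mul_left_comm, ENNReal.inv_mul_cancel Ztot_ne_zero (Ztot_ne_top hW), mul_one]
    _ ≤ _ := ENNReal.ofReal_le_ofReal (by nlinarith)

lemma integrable_exp_Yc {r : ℝ} (hr0 : 0 < r) (hr1 : r < 1) (hW : 0 < W) (z : ℝ) :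
    Integrable (fun p => Real.exp (r * Yc z p)) (Pc z m W) := by
  have hm : Measurable fun p : ΩW (m + 1) W => Real.exp (r * Yc z p) := by fun_prop
  refine ⟨hm.aestronglyMeasurable, ?_⟩
  rw [hasFiniteIntegral_iff_ofReal (ae_of_all _ fun p => (Real.exp_pos _).le)]
  exact (lintegral_exp_Yc_le hr0 hr1 hW z).trans_lt ENNReal.ofReal_lt_top

lemma integral_exp_Yc_le {r : ℝ} (hr0 : 0 < r) (hr1 : r < 1) (hW : 0 < W) (z : ℝ) :
    ∫ p, Real.exp (r * Yc z p) ∂(Pc z m W) ≤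
      (1 + 3 * (2 + 2 / (1 - r))) * (((m + 1 : ℕ) : ℝ) * W) ^ 4 := by
  have hm : Measurable fun p : ΩW (m + 1) W => Real.exp (r * Yc z p) := by fun_prop
  have : 0 < 1 - r := by linarith
  rw [integral_eq_lintegral_of_nonneg_ae (ae_of_all _ fun p => (Real.exp_pos _).le)
    hm.aestronglyMeasurable]
  exact ENNReal.toReal_le_of_le_ofReal (by positivity) (lintegral_exp_Yc_le hr0 hr1 hW z)

/-- The estimate for the tilted law follows from a good event with small complement on which an
infinitesimal symmetry has bounded cost. -/
theorem exists_rate_tiltProb_le {ξ s : ℝ} (hξ : 0 < ξ) (hs0 : 0 < s) (hs1 : s < 1) :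
    ∃ A : ℝ, 0 < A ∧ ∀ m W : ℕ, 0 < W → ∀ z : ℝ,
      Real.exp (-ξ * ((m + 1 : ℕ) : ℝ)) ≤
        ∫ ω, Real.exp ((s / 2) * logG z ω) ∂(wegner (m + 1) W) →
      ∀ q, s / 2 < q → q < s → ∀ (α β b : ℝ) (θ : (Fin (m + 1) → HermParam W) → Fin m → ℝ)
        (Gd : Set (ΩW (m + 1) W)), 0 < β → (∀ j, Measurable fun γ => θ γ j) → MeasurableSet Gd →
      (∀ p ∈ Gd, Regular p → qtot (conf z (scl 1 b θ p)) + qtot (conf z (scl (-1) b θ p)) -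
        2 * qtot (conf z p) ≤ 2 * Real.log β) →
      (∀ p ∈ Gd, Regular p → 3 * α ≤ ∑ j, θ p.1 j - b) →
      (Pc z m W).real Gdᶜ ≤ Real.exp (-A * (((m + 1 : ℕ) : ℝ) + Real.log W)) →
      ∀ μ₀ : ℝ,
      tiltProb (wegner (m + 1) W) (logG z) q {ω | |logG z ω - μ₀| ≤ α} ≤
        β * Real.sqrt (tiltProb (wegner (m + 1) W) (logG z) q {ω | 2 * α ≤ logG z ω - μ₀} *
          tiltProb (wegner (m + 1) W) (logG z) q {ω | logG z ω - μ₀ ≤ -(2 * α)}) + 1 / 2 := by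
  have hr1 : (1 + s) / 2 < 1 := by linarith
  have hr0 : 0 < (1 + s) / 2 := by linarith
  have h1r : 0 < 1 - (1 + s) / 2 := by linarith
  obtain ⟨A, hA, hrate⟩ := exists_tilt_rate (C := 1 + 3 * (2 + 2 / (1 - (1 + s) / 2))) hξ hs0 hs1
    (by have : 0 ≤ 3 * (2 + 2 / (1 - (1 + s) / 2)) := by positivity
        linarith)
  refine ⟨A, hA, ?_⟩
  intro m W hW z hlow q hq1 hq2 α β b θ Gd hβ hθ hGd hcost hδ hbad μ₀
  have := isProbabilityMeasure_Pc (m := m) hW z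
  obtain ⟨l, hl, hnum⟩ := hrate (m + 1) W (Nat.succ_pos m) hW
  have hYm : Measurable (Yc z : ΩW (m + 1) W → ℝ) := measurable_Yc z
  have hr := integrable_exp_Yc (m := m) hr0 hr1 hW z
  have hintg := integrable_exp_mul_of_le (q := q) hYm hr (by linarith) (by linarith)
  have hlow' : Real.exp (-ξ * ((m + 1 : ℕ) : ℝ)) ≤
      ∫ p, Real.exp ((s / 2) * Yc z p) ∂(Pc z m W) := by
    have hm : Measurable fun ω : ΩW (m + 1) W => Real.exp ((s / 2) * logG z ω) := by fun_prop
    rw [wegner_eq_map z, integral_map (measurable_conf z).aemeasurable hm.aestronglyMeasurable]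
      at hlow
    exact hlow
  have hM1 : Real.exp (-ξ * ((m + 1 : ℕ) : ℝ)) ≤ 1 := by
    rw [Real.exp_le_one_iff]
    have : 0 ≤ ξ * ((m + 1 : ℕ) : ℝ) := by positivity
    linarith
  have hhalf := setIntegral_exp_le_half (P := Pc z m W) hYm hr hs0 (by linarith)
    (integral_exp_Yc_le hr0 hr1 hW z) (Real.exp_pos _) hM1 hlow' hq1 hq2 hl hbad hnum
  have hD := sq_div_four_le_integral_exp (P := Pc z m W) hYm hr (by linarith)
    (Real.exp_pos _) hM1 hlow' hq1 hq2
  have hgood := setIntegral_good_le (μ₀ := μ₀) hW z hβ hθ hGd hintg hcost hδ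
  have hA0 : MeasurableSet {ω : ΩW (m + 1) W | |logG z ω - μ₀| ≤ α} :=
    measurableSet_le (by fun_prop) measurable_const
  have hUp : MeasurableSet {ω : ΩW (m + 1) W | 2 * α ≤ logG z ω - μ₀} :=
    measurableSet_le measurable_const (by fun_prop)
  have hUm : MeasurableSet {ω : ΩW (m + 1) W | logG z ω - μ₀ ≤ -(2 * α)} :=
    measurableSet_le (by fun_prop) measurable_const
  have hA0' : MeasurableSet {p : ΩW (m + 1) W | |Yc z p - μ₀| ≤ α} := measurable_conf z hA0
  rw [wegner_eq_map z, tiltProb_map (measurable_conf z) (measurable_logG z) q hA0,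
    tiltProb_map (measurable_conf z) (measurable_logG z) q hUp,
    tiltProb_map (measurable_conf z) (measurable_logG z) q hUm]
  change tiltProb (Pc z m W) (Yc z) q {p | |Yc z p - μ₀| ≤ α} ≤
    β * Real.sqrt (tiltProb (Pc z m W) (Yc z) q {p | 2 * α ≤ Yc z p - μ₀} *
      tiltProb (Pc z m W) (Yc z) q {p | Yc z p - μ₀ ≤ -(2 * α)}) + 1 / 2
  unfold tiltProb
  set D := ∫ p, Real.exp (q * Yc z p) ∂(Pc z m W) with hDdef
  have hDpos : 0 < D := lt_of_lt_of_le (by positivity) hD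
  have hsplit := integral_inter_add_sdiff (μ := Pc z m W) (s := {p | |Yc z p - μ₀| ≤ α}) hGd
    hintg.integrableOn
  have hdiff : ∫ p in {p | |Yc z p - μ₀| ≤ α} \ Gd, Real.exp (q * Yc z p) ∂(Pc z m W) ≤
      ∫ p in Gdᶜ, Real.exp (q * Yc z p) ∂(Pc z m W) :=
    setIntegral_mono_set hintg.integrableOn (ae_of_all _ fun p => (Real.exp_pos _).le)
      (Filter.Eventually.of_forall fun p hp => hp.2)
  rw [div_mul_div_comm, Real.sqrt_div' _ (by positivity), Real.sqrt_mul_self hDpos.le,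
    div_le_iff₀ hDpos, add_mul, mul_assoc, div_mul_cancel₀ _ hDpos.ne']
  linarith

end

section

variable {W m : ℕ}

lemma Pc_le_of_lintegral_le (hW : 0 < W) (z : ℝ) {E : Set (ΩW (m + 1) W)}
    {f : ΩW (m + 1) W → ℝ≥0∞} (hf : Measurable f) {C c : ℝ≥0∞} (hc0 : c ≠ 0) (hc : c ≠ ∞)
    (hintg : ∫⁻ p, f p * gw qtot (conf z p) ≤ C * Ztot m W) (hE : ∀ p ∈ E, c ≤ f p) :
    Pc z m W E ≤ C / c := by
  rw [ENNReal.le_div_iff_mul_le (Or.inl hc0) (Or.inl hc), mul_comm]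
  calc c * Pc z m W E ≤ c * Pc z m W {p | c ≤ f p} := mul_le_mul_right (measure_mono hE) _
    _ ≤ ∫⁻ p, f p ∂(Pc z m W) := mul_meas_ge_le_lintegral hf c
    _ = (Ztot m W)⁻¹ * ∫⁻ p, f p * gw qtot (conf z p) := lintegral_Pc z f hf
    _ ≤ (Ztot m W)⁻¹ * (C * Ztot m W) := mul_le_mul_right hintg _
    _ = C := by rw [mul_left_comm, ENNReal.inv_mul_cancel Ztot_ne_zero (Ztot_ne_top hW), mul_one]

lemma finrank_ΩW_le (hW : 0 < W) : Module.finrank ℝ (ΩW (m + 1) W) ≤ 5 * (m + 1) * W ^ 2 := by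
  have h1 : Fintype.card { p : Fin W × Fin W // p.1 < p.2 } ≤ W * W := by
    refine (Fintype.card_subtype_le _).trans ?_
    simp
  have h2 : Module.finrank ℝ (ΩW (m + 1) W) =
      (m + 1) * (W + Fintype.card { p : Fin W × Fin W // p.1 < p.2 } * 2) + m * (W * (W * 2)) := by
    simp [Module.finrank_prod, Module.finrank_pi_fintype, Complex.finrank_real_complex]
  rw [h2]
  have h3 : W ≤ W * W := Nat.le_mul_of_pos_left _ hW
  calc _ ≤ (m + 1) * (W * W + (W * W) * 2) + (m + 1) * (W * (W * 2)) := by gcongr; omega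
    _ = _ := by ring

lemma qtot_smul (c : ℝ) (ω : ΩW (m + 1) W) : qtot (c • ω) = c ^ 2 * qtot ω := by
  have h : ∀ T : MatP W, mq (c • T) = c ^ 2 * mq T := by
    intro T
    simp only [mq, fsq, Finset.mul_sum]
    refine Finset.sum_congr rfl fun i _ => Finset.sum_congr rfl fun j _ => ?_
    simp [mul_pow]
  simp only [qtot, Prod.smul_fst, Prod.smul_snd, Pi.smul_apply, hq_smul, h, ← Finset.mul_sum]
  ring

lemma Pc_qtot_gt_le (hW : 0 < W) (z L : ℝ) :
    Pc z m W {p | L < qtot (conf z p)} ≤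
      ENNReal.ofReal (Real.exp (5 * ((m + 1 : ℕ) : ℝ) * (W : ℝ) ^ 2 - L / 2)) := by
  have hqm : Measurable (qtot : ΩW (m + 1) W → ℝ) := by fun_prop
  have hF : Measurable fun ω : ΩW (m + 1) W =>
      ENNReal.ofReal (Real.exp (qtot ω / 2)) * gw qtot ω := by
    have := measurable_gw_qtot (n := m + 1) (W := W)
    fun_prop
  have h := Pc_le_of_lintegral_le (m := m) hW z
    (E := {p | L < qtot (conf z p)}) (f := fun p => ENNReal.ofReal (Real.exp (qtot (conf z p) / 2)))
    (C := 2 ^ Module.finrank ℝ (ΩW (m + 1) W)) (c := ENNReal.ofReal (Real.exp (L / 2)))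
    (by have := measurable_conf (W := W) z (m := m); fun_prop) (by positivity)
    ENNReal.ofReal_ne_top
    (by
      rw [lintegral_conf z hF]
      exact lintegral_exp_half_quadratic volume hqm qtot_smul)
    (fun p hp => ENNReal.ofReal_le_ofReal (Real.exp_le_exp.2 (by
      have : L < qtot (conf z p) := hp
      linarith)))
  refine h.trans ?_
  rw [sub_eq_add_neg, Real.exp_add, ENNReal.ofReal_mul (Real.exp_pos _).le, div_eq_mul_inv]
  have e2 : ENNReal.ofReal (Real.exp (-(L / 2))) = (ENNReal.ofReal (Real.exp (L / 2)))⁻¹ := by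
    rw [Real.exp_neg, ENNReal.ofReal_inv_of_pos (Real.exp_pos _)]
  rw [e2]
  refine mul_le_mul_left ?_ _
  have h2 : (2 : ℝ≥0∞) = ENNReal.ofReal 2 := by norm_num
  rw [h2, ← ENNReal.ofReal_pow two_pos.le]
  refine ENNReal.ofReal_le_ofReal ?_
  calc (2 : ℝ) ^ Module.finrank ℝ (ΩW (m + 1) W) ≤ Real.exp 1 ^ Module.finrank ℝ (ΩW (m + 1) W) := by
        gcongr; have := Real.add_one_le_exp 1; linarith
    _ = Real.exp (Module.finrank ℝ (ΩW (m + 1) W)) := by rw [← Real.exp_nat_mul, mul_one]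
    _ ≤ _ := Real.exp_le_exp.2 (by exact_mod_cast finrank_ΩW_le hW)

lemma lintegral_prod_sefr_le (hW : 0 < W) (z : ℝ) :
    ∫⁻ p : ΩW (m + 1) W, (∏ j : Fin m, ENNReal.ofReal (1 + sefr (p.1 j.castSucc, p.2 j))) *
      gw qtot (conf z p) ≤ 111889 ^ m * Ztot m W := by
  have hψ : Measurable fun x : HermParam W × MatP W => ENNReal.ofReal (1 + sefr x) := by
    have := measurable_sefr (W := W); fun_prop
  have h := lintegral_chain_le hψ
    (fun a => lintegral_sefr_le hW (ZH_ne_top hW) (ZM_ne_top hW) a) (m := m) (zpar W z) (zpar W z)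
  have hm := measurable_chain hψ (m := m) (zpar W z) (zpar W z)
  have e := lintegral_prod _ hm.aemeasurable (μ := (volume : Measure (Fin (m + 1) → HermParam W)))
    (ν := (volume : Measure (Fin m → MatP W)))
  simp only [gw_qtot_conf]
  refine (le_of_eq e).trans (h.trans (le_of_eq ?_))
  rw [Ztot, lintegral_gw_qtot]
  ring

open Classical in
/-- The number of sites at which the self-energy is large. -/
def badCount (K : ℝ) (p : ΩW (m + 1) W) : ℕ :=
  (Finset.univ.filter fun j : Fin m => K ≤ sefr (p.1 j.castSucc, p.2 j)).card

lemma Pc_badCount_ge_le (hW : 0 < W) (z : ℝ) {K : ℝ} (hK : 0 ≤ K) :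
    Pc z m W {p | m + 1 ≤ 8 * badCount K p} ≤
      ENNReal.ofReal (Real.exp (((m + 1 : ℕ) : ℝ) * (Real.log 111889 - Real.log (1 + K) / 8))) := by
  have hψ : Measurable fun x : HermParam W × MatP W => ENNReal.ofReal (1 + sefr x) := by
    have := measurable_sefr (W := W); fun_prop
  have hlK : 0 ≤ Real.log (1 + K) := Real.log_nonneg (by linarith)
  have h := Pc_le_of_lintegral_le (m := m) hW z (E := {p | m + 1 ≤ 8 * badCount K p})
    (f := fun p : ΩW (m + 1) W => ∏ j : Fin m, ENNReal.ofReal (1 + sefr (p.1 j.castSucc, p.2 j)))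
    (C := 111889 ^ m)
    (c := ENNReal.ofReal (Real.exp (((m + 1 : ℕ) : ℝ) * (Real.log (1 + K) / 8))))
    (Finset.measurable_prod _ fun j _ => hψ.comp (by fun_prop))
    (by positivity) ENNReal.ofReal_ne_top (lintegral_prod_sefr_le hW z) ?_
  · refine h.trans ?_
    rw [mul_sub, Real.exp_sub, ENNReal.ofReal_div_of_pos (Real.exp_pos _)]
    refine ENNReal.div_le_div_right ?_ _
    rw [Real.exp_nat_mul, Real.exp_log (by norm_num), ENNReal.ofReal_pow (by norm_num)]
    rw [show ENNReal.ofReal 111889 = 111889 by norm_num]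
    exact pow_le_pow_right₀ (by norm_num) (Nat.le_succ m)
  · intro p hp
    have hp' : ((m + 1 : ℕ) : ℝ) ≤ 8 * (badCount K p : ℝ) := by exact_mod_cast hp
    have hs0 : ∀ x : HermParam W × MatP W, 0 ≤ sefr x := fun p => Real.sqrt_nonneg _
    change _ ≤ ∏ j : Fin m, ENNReal.ofReal (1 + sefr (p.1 j.castSucc, p.2 j))
    rw [← ENNReal.ofReal_prod_of_nonneg fun j _ => by linarith [hs0 (p.1 j.castSucc, p.2 j)]]
    refine ENNReal.ofReal_le_ofReal ?_
    have h1 : Real.exp (((m + 1 : ℕ) : ℝ) * (Real.log (1 + K) / 8)) ≤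
        (1 + K) ^ badCount K p := by
      rw [← Real.exp_log (show 0 < 1 + K by linarith), ← Real.exp_nat_mul, Real.log_exp]
      exact Real.exp_le_exp.2 (by nlinarith)
    refine h1.trans ?_
    classical
    unfold badCount
    rw [← Finset.prod_const, Finset.prod_filter]
    refine Finset.prod_le_prod (fun j _ => by split_ifs <;> linarith) fun j _ => ?_
    split_ifs with hj
    · linarith
    · linarith [hs0 (p.1 j.castSucc, p.2 j)]

end

section

variable {W m : ℕ}

/-- There is a deformation of bounded cost `B` on an event whose complement is exponentially rare
with rate `A`, which shifts the observable by at least `3 √(n / W³)`. -/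
def HasGoodDeformation (A B z : ℝ) (m W : ℕ) : Prop :=
  ∃ (b : ℝ) (θ : (Fin (m + 1) → HermParam W) → Fin m → ℝ) (Gd : Set (ΩW (m + 1) W)),
    (∀ j, Measurable fun γ => θ γ j) ∧ MeasurableSet Gd ∧
    (∀ p ∈ Gd, Regular p → qtot (conf z (scl 1 b θ p)) + qtot (conf z (scl (-1) b θ p)) -
        2 * qtot (conf z p) ≤ B) ∧
    (∀ p ∈ Gd, Regular p →
      3 * Real.sqrt (((m + 1 : ℕ) : ℝ) / (W : ℝ) ^ 3) ≤ ∑ j, θ p.1 j - b) ∧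
    (Pc z m W).real Gdᶜ ≤ Real.exp (-A * (((m + 1 : ℕ) : ℝ) + Real.log W))

lemma hq_add_le (x y : HermParam W) : hq (x + y) ≤ 2 * hq x + 2 * hq y := by
  simp only [hq, toHerm_add]; exact fsq_add_le _ _

lemma hq_neg (x : HermParam W) : hq (-x) = hq x := by
  rw [← neg_one_smul ℝ, hq_smul]; norm_num

lemma hq_add_add_le (x y w : HermParam W) : hq (x + (y + w)) ≤ 4 * (hq x + hq y + hq w) := by
  linarith [hq_add_le x (y + w), hq_add_le y w, hq_nonneg x]

lemma hq_zpar (z : ℝ) : hq (zpar W z) = z ^ 2 * W := by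
  rw [hq, toHerm_zpar, fsq]
  have h : ∀ i j : Fin W, ‖((z : ℂ) • (1 : Mat W)) i j‖ ^ 2 = if i = j then z ^ 2 else 0 := by
    intro i j
    by_cases hij : i = j
    · subst hij; simp
    · simp [Matrix.one_apply_ne hij, hij]
  simp only [h]
  simp [mul_comm]

lemma hq_sel_le (z : ℝ) (p : ΩW (m + 1) W) (j : Fin m) :
    hq (sel (p.2 j) (p.1 j.castSucc)) ≤
      4 * (hq ((conf z p).1 j.succ) + hq (p.1 j.succ) + z ^ 2 * W) := by
  have e : sel (p.2 j) (p.1 j.castSucc) =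
      (conf z p).1 j.succ + (-(p.1 j.succ) + -(zpar W z)) := by rw [conf_fst_succ]; abel
  rw [e]
  simpa only [hq_neg, hq_zpar] using
    hq_add_add_le ((conf z p).1 j.succ) (-(p.1 j.succ)) (-(zpar W z))

lemma hq_succ_le (z : ℝ) (p : ΩW (m + 1) W) (j : Fin m) :
    hq (p.1 j.succ) ≤ 4 * (hq ((conf z p).1 j.succ) + hq (sel (p.2 j) (p.1 j.castSucc)) +
      z ^ 2 * W) := by
  have e : p.1 j.succ = (conf z p).1 j.succ + (-(sel (p.2 j) (p.1 j.castSucc)) + -(zpar W z)) := by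
    rw [conf_fst_succ]; abel
  have h := hq_add_add_le ((conf z p).1 j.succ) (-(sel (p.2 j) (p.1 j.castSucc))) (-(zpar W z))
  rw [← e] at h
  simpa only [hq_neg, hq_zpar] using h

lemma hq_zero_le (z : ℝ) (p : ΩW (m + 1) W) :
    hq (p.1 0) ≤ 2 * hq ((conf z p).1 0) + 2 * (z ^ 2 * W) := by
  have e : p.1 0 = (conf z p).1 0 + -(zpar W z) := by rw [conf_fst_zero]; abel
  have h := hq_add_le ((conf z p).1 0) (-(zpar W z))
  rwa [← e, hq_neg, hq_zpar] at h

lemma qtot_succ (ω : ΩW (m + 1) W) : qtot ω =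
    W * (hq (ω.1 0) + ∑ j : Fin m, hq (ω.1 j.succ) + ∑ j : Fin m, mq (ω.2 j)) := by
  unfold qtot
  rw [Fin.sum_univ_succ]
  rfl

lemma sefr_lt_hq_le (hW : 0 < W) {K : ℝ} (γ : HermParam W) (T : MatP W)
    (h : sefr (γ, T) < K) : hq (sel T γ) ≤ K ^ 4 * (W : ℝ) ^ 2 := by
  have hW' : (0 : ℝ) < W := by exact_mod_cast hW
  have h0 : 0 ≤ sefr (γ, T) := Real.sqrt_nonneg _
  have h1 : sefr (γ, T) ^ 2 = Real.sqrt (hq (sel T γ)) / W :=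
    Real.sq_sqrt (div_nonneg (Real.sqrt_nonneg _) hW'.le)
  have h2 : Real.sqrt (hq (sel T γ)) = sefr (γ, T) ^ 2 * W := by
    rw [h1]; field_simp
  have h3 : hq (sel T γ) = (sefr (γ, T) ^ 2 * W) ^ 2 := by
    rw [← h2, Real.sq_sqrt (hq_nonneg _)]
  rw [h3, mul_pow, ← pow_mul]
  gcongr

lemma Pc_real_le_of_subset_union {z A : ℝ} {E E₁ E₂ : Set (ΩW (m + 1) W)} {ε x₁ x₂ : ℝ}
    (hE : E ⊆ E₁ ∪ E₂)
    (h₁ : Pc z m W E₁ ≤ ENNReal.ofReal (Real.exp x₁))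
    (h₂ : Pc z m W E₂ ≤ ENNReal.ofReal (Real.exp x₂)) (hx₁ : x₁ ≤ -A * ε - 1)
    (hx₂ : x₂ ≤ -A * ε - 1) : (Pc z m W).real E ≤ Real.exp (-A * ε) := by
  have h : Pc z m W E ≤ ENNReal.ofReal (Real.exp x₁ + Real.exp x₂) := by
    rw [ENNReal.ofReal_add (Real.exp_pos _).le (Real.exp_pos _).le]
    exact (measure_mono hE).trans ((measure_union_le _ _).trans (add_le_add h₁ h₂))
  have h3 : Real.exp (-A * ε - 1) ≤ Real.exp (-A * ε) / 2 := by
    rw [Real.exp_sub]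
    have : (2 : ℝ) ≤ Real.exp 1 := by linarith [Real.add_one_le_exp 1]
    gcongr
  have h1 := Real.exp_le_exp.2 hx₁
  have h2 := Real.exp_le_exp.2 hx₂
  refine (ENNReal.toReal_le_of_le_ofReal (by positivity) h).trans (by linarith)

lemma card_good_ge {K K' : ℝ} (hW : 0 < W) (hK' : 0 < K') {z : ℝ} (hz : z ^ 2 ≤ W)
    {p : ΩW (m + 1) W}
    (hq1 : qtot (conf z p) ≤ K' * ((m + 1 : ℕ) : ℝ) * (W : ℝ) ^ 2)
    (hbad : 8 * badCount K p < m + 1) :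
    3 / 4 * ((m + 1 : ℕ) : ℝ) - 1 ≤
      ∑ j : Fin m, if hq (p.1 j.succ) ≤ 4 * (8 * K' + K ^ 4 + 1) * (W : ℝ) ^ 2 then (1 : ℝ) else 0
      := by
  classical
  have hW' : (1 : ℝ) ≤ W := by exact_mod_cast hW
  have key : ∀ j : Fin m, (1 : ℝ) ≤
      (if hq (p.1 j.succ) ≤ 4 * (8 * K' + K ^ 4 + 1) * (W : ℝ) ^ 2 then (1 : ℝ) else 0) +
      (if K ≤ sefr (p.1 j.castSucc, p.2 j) then (1 : ℝ) else 0) +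
      hq ((conf z p).1 j.succ) / (8 * K' * W) := by
    intro j
    have hd : 0 ≤ hq ((conf z p).1 j.succ) / (8 * K' * W) := by
      have := hq_nonneg ((conf z p).1 j.succ); positivity
    by_cases h1 : hq (p.1 j.succ) ≤ 4 * (8 * K' + K ^ 4 + 1) * (W : ℝ) ^ 2
    · rw [if_pos h1]; split_ifs <;> linarith
    by_cases h2 : K ≤ sefr (p.1 j.castSucc, p.2 j)
    · rw [if_pos h2, if_neg h1]; linarith
    rw [if_neg h1, if_neg h2, zero_add, zero_add, le_div_iff₀ (by positivity), one_mul]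
    have h3 := sefr_lt_hq_le hW _ _ (not_le.1 h2)
    have h4 := hq_succ_le z p j
    push Not at h1
    nlinarith [mul_le_mul_of_nonneg_left hW' (show 0 ≤ K' * W by positivity)]
  have hs := Finset.sum_le_sum fun j (_ : j ∈ Finset.univ) => key j
  rw [Finset.sum_add_distrib, Finset.sum_add_distrib, ← Finset.sum_div] at hs
  have hb : (∑ j : Fin m, if K ≤ sefr (p.1 j.castSucc, p.2 j) then (1 : ℝ) else 0) =
      badCount K p := by
    simp [badCount]
  rw [hb] at hs
  have hbr : 8 * (badCount K p : ℝ) ≤ ((m + 1 : ℕ) : ℝ) := by exact_mod_cast hbad.le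
  have hv : (∑ j : Fin m, hq ((conf z p).1 j.succ)) / (8 * K' * W) ≤ ((m + 1 : ℕ) : ℝ) / 8 := by
    rw [div_le_iff₀ (by positivity)]
    rw [qtot_succ] at hq1
    have h0 := hq_nonneg ((conf z p).1 0)
    have hm0 : 0 ≤ ∑ j : Fin m, mq ((conf z p).2 j) := Finset.sum_nonneg fun _ _ => mq_nonneg _
    have hq2 : hq ((conf z p).1 0) + ∑ j : Fin m, hq ((conf z p).1 j.succ) +
        ∑ j : Fin m, mq ((conf z p).2 j) ≤ K' * ((m + 1 : ℕ) : ℝ) * W :=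
      le_of_mul_le_mul_left (by linarith) (show (0 : ℝ) < W by linarith)
    nlinarith
  have hc : ∑ _j : Fin m, (1 : ℝ) = ((m + 1 : ℕ) : ℝ) - 1 := by simp
  rw [hc] at hs
  linarith

end

section

variable {W m : ℕ}

/-- The deformation rescaling every hopping block next to a site whose Schur complement is not
too large. -/
def bulkθ (κ t : ℝ) (W : ℕ) {m : ℕ} (γ : Fin (m + 1) → HermParam W) (j : Fin m) : ℝ :=
  if hq (γ j.succ) ≤ κ * (W : ℝ) ^ 2 then t else 0

lemma measurable_bulkθ (κ t : ℝ) (j : Fin m) :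
    Measurable fun γ : Fin (m + 1) → HermParam W => bulkθ κ t W γ j := by
  have hs : MeasurableSet {γ : Fin (m + 1) → HermParam W | hq (γ j.succ) ≤ κ * (W : ℝ) ^ 2} :=
    measurableSet_le (measurable_hq.comp (measurable_pi_apply _)) measurable_const
  exact Measurable.ite hs measurable_const measurable_const

lemma bulk_cost_le (hW : 0 < W) {z κ K' t : ℝ} (hz : z ^ 2 ≤ W) (hκ : 0 ≤ κ) (ht0 : 0 ≤ t)
    (ht1 : 2 * t ≤ 1) (htt : t ^ 2 * (((m + 1 : ℕ) : ℝ) * (W : ℝ) ^ 3) = 144)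
    {p : ΩW (m + 1) W} (hp : Regular p)
    (hq1 : qtot (conf z p) ≤ K' * ((m + 1 : ℕ) : ℝ) * (W : ℝ) ^ 2) :
    qtot (conf z (scl 1 0 (bulkθ κ t W) p)) + qtot (conf z (scl (-1) 0 (bulkθ κ t W) p)) -
      2 * qtot (conf z p) ≤ 1152 * (21 * K' + 20 * (κ + 1)) := by
  have hW' : (1 : ℝ) ≤ W := by exact_mod_cast hW
  have hθ0 : ∀ j, 0 ≤ bulkθ κ t W p.1 j ∧ bulkθ κ t W p.1 j ≤ t := by
    intro j; unfold bulkθ; split_ifs <;> constructor <;> linarith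
  have hκj : ∀ j : Fin m, kap 0 (bulkθ κ t W) p.1 j = 2 * bulkθ κ t W p.1 j := by
    intro j; simp [kap]
  have hle : ∀ j, |2 * bulkθ κ t W p.1 j| ≤ 1 := fun j => by
    rw [abs_of_nonneg (by linarith [(hθ0 j).1])]; linarith [(hθ0 j).2]
  have h := qtot_scale_cost z (θ := bulkθ κ t W) (b := 0) hp (by simp)
    (fun j => by rw [hκj]; exact hle j) hle
  refine h.trans ?_
  have hterm : ∀ j : Fin m, 2 * (kap 0 (bulkθ κ t W) p.1 j) ^ 2 *
          (hq ((conf z p).1 j.succ) + 5 * hq (sel (p.2 j) (p.1 j.castSucc))) +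
          8 * (bulkθ κ t W p.1 j) ^ 2 * mq (p.2 j) ≤
        8 * t ^ 2 * (21 * hq ((conf z p).1 j.succ) + mq (p.2 j) + 20 * (κ + 1) * (W : ℝ) ^ 2) := by
    intro j
    have hv := hq_nonneg ((conf z p).1 j.succ)
    have hm := mq_nonneg (p.2 j)
    rw [hκj]
    by_cases hj : hq (p.1 j.succ) ≤ κ * (W : ℝ) ^ 2
    · have e : bulkθ κ t W p.1 j = t := if_pos hj
      rw [e]
      have hB := hq_sel_le z p j
      have hzW : z ^ 2 * W ≤ (W : ℝ) ^ 2 := by nlinarith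
      have : hq ((conf z p).1 j.succ) + 5 * hq (sel (p.2 j) (p.1 j.castSucc)) ≤
          21 * hq ((conf z p).1 j.succ) + 20 * (κ + 1) * (W : ℝ) ^ 2 := by linarith
      nlinarith [mul_le_mul_of_nonneg_left this (show 0 ≤ 8 * t ^ 2 by positivity)]
    · have e : bulkθ κ t W p.1 j = 0 := if_neg hj
      rw [e]
      have : 0 ≤ 8 * t ^ 2 *
        (21 * hq ((conf z p).1 j.succ) + mq (p.2 j) + 20 * (κ + 1) * (W : ℝ) ^ 2) := by positivity
      simpa using this
  have hs := Finset.sum_le_sum fun j (_ : j ∈ Finset.univ) => hterm j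
  have hsum : ∑ j : Fin m, (21 * hq ((conf z p).1 j.succ) + mq (p.2 j) +
        20 * (κ + 1) * (W : ℝ) ^ 2) = 21 * ∑ j : Fin m, hq ((conf z p).1 j.succ) +
      ∑ j : Fin m, mq (p.2 j) + ∑ _j : Fin m, 20 * (κ + 1) * (W : ℝ) ^ 2 := by
    rw [Finset.sum_add_distrib, Finset.sum_add_distrib, Finset.mul_sum]
  rw [← Finset.mul_sum, hsum] at hs
  have h0 := hq_nonneg ((conf z p).1 0)
  have hm0 : 0 ≤ ∑ j : Fin m, mq (p.2 j) := Finset.sum_nonneg fun _ _ => mq_nonneg _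
  have hv0 : 0 ≤ ∑ j : Fin m, hq ((conf z p).1 j.succ) := Finset.sum_nonneg fun _ _ => hq_nonneg _
  rw [qtot_succ] at hq1
  have hq2 : hq ((conf z p).1 0) + ∑ j : Fin m, hq ((conf z p).1 j.succ) +
      ∑ j : Fin m, mq (p.2 j) ≤ K' * ((m + 1 : ℕ) : ℝ) * W :=
    le_of_mul_le_mul_left (hq1.trans (by ring_nf; rfl)) (show (0 : ℝ) < W by linarith)
  have hn : (1 : ℝ) ≤ ((m + 1 : ℕ) : ℝ) := by exact_mod_cast Nat.succ_pos m
  have hK' : 0 ≤ K' := by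
    by_contra hneg
    push Not at hneg
    have : K' * ((m + 1 : ℕ) : ℝ) * W < 0 := by
      have : 0 < ((m + 1 : ℕ) : ℝ) * W := by positivity
      nlinarith
    linarith
  have hc : ∑ _j : Fin m, 20 * (κ + 1) * (W : ℝ) ^ 2 ≤
      ((m + 1 : ℕ) : ℝ) * (20 * (κ + 1) * (W : ℝ) ^ 2) := by
    rw [Finset.sum_const, Finset.card_univ, Fintype.card_fin, nsmul_eq_mul]
    gcongr
    omega
  have hbr : 21 * ∑ j : Fin m, hq ((conf z p).1 j.succ) + ∑ j : Fin m, mq (p.2 j) +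
      ∑ _j : Fin m, 20 * (κ + 1) * (W : ℝ) ^ 2 ≤
      (21 * K' + 20 * (κ + 1)) * (((m + 1 : ℕ) : ℝ) * (W : ℝ) ^ 2) := by
    have : K' * ((m + 1 : ℕ) : ℝ) * W ≤ K' * ((m + 1 : ℕ) : ℝ) * (W : ℝ) ^ 2 := by
      gcongr; nlinarith
    nlinarith
  have hz0 : 2 * (0 : ℝ) ^ 2 * (hq ((conf z p).1 0) + 5 * hq (p.1 0)) = 0 := by ring
  rw [hz0, zero_add]
  calc _ ≤ (W : ℝ) * (8 * t ^ 2 *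
        ((21 * K' + 20 * (κ + 1)) * (((m + 1 : ℕ) : ℝ) * (W : ℝ) ^ 2))) := by
        gcongr
        exact hs.trans (mul_le_mul_of_nonneg_left hbr (by positivity))
    _ = 8 * (21 * K' + 20 * (κ + 1)) * (t ^ 2 * (((m + 1 : ℕ) : ℝ) * (W : ℝ) ^ 3)) := by ring
    _ = _ := by rw [htt]; ring

/-- Good deformations when the bandwidth is polynomially bounded in the length. -/
lemma exists_hasGoodDeformation_bulk {A : ℝ} (hA : 0 < A) : ∃ B : ℝ, ∀ m W : ℕ, 24 < m + 1 →
    24 < W → W ≤ (m + 1) ^ 6 → ∀ z : ℝ, z ^ 2 ≤ W → HasGoodDeformation A B z m W := by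
  obtain ⟨K, hK⟩ : ∃ K : ℝ, K = Real.exp (8 * (Real.log 111889 + 7 * A + 1)) - 1 := ⟨_, rfl⟩
  have hl0 : 0 ≤ Real.log 111889 := Real.log_nonneg (by norm_num)
  have hK0 : 0 ≤ K := by
    rw [hK, sub_nonneg]; exact Real.one_le_exp (by positivity)
  have hlK : Real.log (1 + K) = 8 * (Real.log 111889 + 7 * A + 1) := by
    rw [hK, add_sub_cancel, Real.log_exp]
  obtain ⟨K', hK'⟩ : ∃ K' : ℝ, K' = 12 + 4 * A := ⟨_, rfl⟩
  obtain ⟨κ, hκ⟩ : ∃ κ : ℝ, κ = 4 * (8 * K' + K ^ 4 + 1) := ⟨_, rfl⟩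
  have hK'0 : 0 < K' := by rw [hK']; positivity
  have hκ0 : 0 ≤ κ := by rw [hκ]; positivity
  refine ⟨1152 * (21 * K' + 20 * (κ + 1)), ?_⟩
  intro m W hm hW hWm z hz
  have hn : (25 : ℝ) ≤ ((m + 1 : ℕ) : ℝ) := by exact_mod_cast hm
  have hW' : (25 : ℝ) ≤ W := by exact_mod_cast hW
  have hW0 : 0 < W := by omega
  set n : ℝ := ((m + 1 : ℕ) : ℝ) with hndef
  have hq0 : 0 ≤ n / (W : ℝ) ^ 3 := by positivity
  obtain ⟨t, ht⟩ : ∃ t : ℝ, t = 12 * Real.sqrt (n / (W : ℝ) ^ 3) / n := ⟨_, rfl⟩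
  have ht0 : 0 ≤ t := by rw [ht]; positivity
  have htt : t ^ 2 * (n * (W : ℝ) ^ 3) = 144 := by
    rw [ht, div_pow, mul_pow, Real.sq_sqrt hq0]; field_simp; norm_num
  have ht1 : 2 * t ≤ 1 := by
    have hW2 : (25 : ℝ) ^ 2 ≤ (W : ℝ) ^ 2 := by gcongr
    have : (576 : ℝ) ≤ n * (W : ℝ) ^ 3 := by
      have h3 : (25 : ℝ) ^ 3 ≤ (W : ℝ) ^ 3 := by gcongr
      nlinarith
    nlinarith [sq_nonneg t, sq_nonneg (2 * t - 1)]
  have hlogW : Real.log W ≤ 6 * n := by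
    have h1 : (W : ℝ) ≤ n ^ 6 := by rw [hndef]; exact_mod_cast hWm
    calc Real.log W ≤ Real.log (n ^ 6) := Real.log_le_log (by positivity) h1
      _ = 6 * Real.log n := by rw [Real.log_pow]; norm_num
      _ ≤ 6 * n := by have := Real.log_le_self (show 0 ≤ n by linarith); linarith
  refine ⟨0, bulkθ κ t W, {p | qtot (conf z p) ≤ K' * n * (W : ℝ) ^ 2} ∩
    {p | 3 * Real.sqrt (n / (W : ℝ) ^ 3) ≤ ∑ j, bulkθ κ t W p.1 j}, measurable_bulkθ κ t, ?_, ?_,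
    ?_, ?_⟩
  · refine MeasurableSet.inter (measurableSet_le ?_ measurable_const)
      (measurableSet_le measurable_const ?_)
    · have := measurable_conf (W := W) z (m := m); fun_prop
    · exact Finset.measurable_sum _ fun j _ => (measurable_bulkθ κ t j).comp measurable_fst
  · rintro p ⟨hp1, -⟩ hpR
    exact bulk_cost_le hW0 hz hκ0 ht0 ht1 htt hpR hp1
  · rintro p ⟨-, hp2⟩ -
    rw [sub_zero]; exact hp2
  · have hcov : ({p : ΩW (m + 1) W | qtot (conf z p) ≤ K' * n * (W : ℝ) ^ 2} ∩
        {p | 3 * Real.sqrt (n / (W : ℝ) ^ 3) ≤ ∑ j, bulkθ κ t W p.1 j})ᶜ ⊆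
        {p | K' * n * (W : ℝ) ^ 2 < qtot (conf z p)} ∪ {p | m + 1 ≤ 8 * badCount K p} := by
      intro p hp
      by_contra hcon
      rw [Set.mem_union, not_or] at hcon
      obtain ⟨hc1, hc2⟩ := hcon
      have hc1' : qtot (conf z p) ≤ K' * n * (W : ℝ) ^ 2 := not_lt.1 hc1
      have hc2' : 8 * badCount K p < m + 1 := not_le.1 hc2
      refine hp ⟨hc1', ?_⟩
      have hg := card_good_ge hW0 hK'0 hz hc1' hc2'
      rw [← hκ] at hg
      have e : ∑ j, bulkθ κ t W p.1 j =
          t * ∑ j : Fin m, if hq (p.1 j.succ) ≤ κ * (W : ℝ) ^ 2 then (1 : ℝ) else 0 := by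
        rw [Finset.mul_sum]
        exact Finset.sum_congr rfl fun j _ => by unfold bulkθ; split_ifs <;> simp
      change 3 * Real.sqrt (n / (W : ℝ) ^ 3) ≤ ∑ j, bulkθ κ t W p.1 j
      rw [e]
      have e2 : 3 * Real.sqrt (n / (W : ℝ) ^ 3) = t * (n / 4) := by
        rw [ht]; field_simp; norm_num
      rw [e2]
      refine mul_le_mul_of_nonneg_left (le_trans ?_ hg) ht0
      linarith
    refine Pc_real_le_of_subset_union hcov (Pc_qtot_gt_le hW0 z _) (Pc_badCount_ge_le hW0 z hK0)
      ?_ ?_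
    · rw [← hndef]
      have hlW : Real.log W ≤ W := Real.log_le_self (by linarith)
      have h1 : n ≤ n * (W : ℝ) ^ 2 :=
        le_mul_of_one_le_right (by linarith) (one_le_pow₀ (by linarith))
      have h2 : (W : ℝ) ≤ n * (W : ℝ) ^ 2 := by
        have : (W : ℝ) ≤ (W : ℝ) ^ 2 := by nlinarith
        exact this.trans (le_mul_of_one_le_left (by positivity) (by linarith))
      have h3 : A * (n + Real.log W) ≤ A * (2 * (n * (W : ℝ) ^ 2)) := by gcongr; linarith
      rw [hK']
      nlinarith
    · rw [← hndef, hlK]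
      have h3 : A * (n + Real.log W) ≤ A * (7 * n) := by gcongr; linarith
      nlinarith

end

section

variable {W m : ℕ}

/-- The quadratic form of a matrix. -/
def nf (x : EuclideanSpace ℂ (Fin W)) (V : Mat W) : ℝ :=
  ∑ i, ∑ j, (x i * star (x j) * star (V i j)).re

lemma continuous_nf (V : Mat W) : Continuous fun x => nf x V := by
  unfold nf; fun_prop

lemma nf_add_add_nf_sub (x y : EuclideanSpace ℂ (Fin W)) (V : Mat W) :
    nf (x + y) V + nf (x - y) V = 2 * nf x V + 2 * nf y V := by
  simp only [nf, Finset.mul_sum, ← Finset.sum_add_distrib]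
  refine Finset.sum_congr rfl fun i _ => Finset.sum_congr rfl fun j _ => ?_
  have h : ((x + y) i * star ((x + y) j) * star (V i j)) +
      ((x - y) i * star ((x - y) j) * star (V i j)) =
      ((2 : ℝ) : ℂ) * (x i * star (x j) * star (V i j)) +
        ((2 : ℝ) : ℂ) * (y i * star (y j) * star (V i j)) := by
    simp only [PiLp.add_apply, PiLp.sub_apply, star_add, star_sub, Complex.ofReal_ofNat]; ring
  have h2 := congrArg Complex.re h
  simpa only [Complex.add_re, Complex.re_ofReal_mul] using h2

lemma nf_smul (c : ℝ) (x : EuclideanSpace ℂ (Fin W)) (V : Mat W) :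
    nf ((c : ℂ) • x) V = c ^ 2 * nf x V := by
  simp only [nf, Finset.mul_sum]
  refine Finset.sum_congr rfl fun i _ => Finset.sum_congr rfl fun j _ => ?_
  have h : (((c : ℂ) • x) i * star (((c : ℂ) • x) j) * star (V i j)) =
      ((c ^ 2 : ℝ) : ℂ) * (x i * star (x j) * star (V i j)) := by
    simp only [PiLp.smul_apply, smul_eq_mul, star_mul', Complex.ofReal_pow, RCLike.star_def,
      Complex.conj_ofReal]
    ring
  rw [h, Complex.re_ofReal_mul]

/-- A Hermitian form that is large somewhere is large on a ball. -/
lemma exists_ball_le_nf {V : Mat W} {L : ℝ} (hL : 0 ≤ L)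
    (h : ∃ x, L * ‖x‖ ^ 2 < |nf x V|) :
    ∃ u : EuclideanSpace ℂ (Fin W), ‖u‖ = 1 ∧ ∀ y ∈ Metric.ball u (1 / 8), L / 2 ≤ |nf y V| := by
  obtain ⟨x, hx⟩ := h
  have hx0 : x ≠ 0 := by
    rintro rfl
    simp [nf] at hx
  have hscale : ∀ y : EuclideanSpace ℂ (Fin W), y ≠ 0 →
      |nf y V| = ‖y‖ ^ 2 * |nf (((‖y‖⁻¹ : ℝ) : ℂ) • y) V| ∧ ‖((‖y‖⁻¹ : ℝ) : ℂ) • y‖ = 1 := by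
    intro y hy
    have hy' : ‖y‖ ≠ 0 := norm_ne_zero_iff.2 hy
    constructor
    · rw [nf_smul, abs_mul, abs_of_nonneg (sq_nonneg (‖y‖⁻¹))]
      field_simp
    · rw [norm_smul, Complex.norm_real, norm_inv, norm_norm, inv_mul_cancel₀ hy']
  have hcpt : IsCompact (Metric.sphere (0 : EuclideanSpace ℂ (Fin W)) 1) := isCompact_sphere _ _
  obtain ⟨u, hu, hmax⟩ := hcpt.exists_isMaxOn
    ⟨((‖x‖⁻¹ : ℝ) : ℂ) • x, by rw [mem_sphere_zero_iff_norm]; exact (hscale x hx0).2⟩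
    (continuous_nf V).abs.continuousOn
  have hu1 : ‖u‖ = 1 := by simpa using hu
  have hle : ∀ y, |nf y V| ≤ ‖y‖ ^ 2 * |nf u V| := by
    intro y
    by_cases hy : y = 0
    · subst hy; simp [nf]
    obtain ⟨h1, h2⟩ := hscale y hy
    rw [h1]
    exact mul_le_mul_of_nonneg_left (hmax (by rw [mem_sphere_zero_iff_norm]; exact h2))
      (sq_nonneg _)
  have hML : L ≤ |nf u V| := by
    by_contra hcon
    have h1 := hle x
    have h2 : 0 < ‖x‖ ^ 2 := by have := norm_pos_iff.2 hx0; positivity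
    nlinarith
  refine ⟨u, hu1, fun y hy => ?_⟩
  set M := |nf u V|
  have hd : ‖y - u‖ ≤ 1 / 8 := by rw [← dist_eq_norm]; exact (Metric.mem_ball.1 hy).le
  have h1 := nf_add_add_nf_sub u (y - u) V
  rw [add_sub_cancel] at h1
  have h2 := hle (y - u)
  have h3 := hle (u - (y - u))
  have h4 : ‖u - (y - u)‖ ≤ 9 / 8 := (norm_sub_le _ _).trans (by linarith)
  have h5 : ‖y - u‖ ^ 2 ≤ 1 / 64 := by nlinarith [norm_nonneg (y - u)]
  have h6 : ‖u - (y - u)‖ ^ 2 ≤ 81 / 64 := by nlinarith [norm_nonneg (u - (y - u))]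
  have hM : 0 ≤ M := abs_nonneg _
  have h7 : |nf (y - u) V| ≤ M / 64 := by nlinarith
  have h8 : |nf (u - (y - u)) V| ≤ 81 / 64 * M := by nlinarith
  have h9 : 2 * M ≤ |nf y V| + |nf (u - (y - u)) V| + 2 * |nf (y - u) V| := by
    have e : 2 * nf u V = nf y V + nf (u - (y - u)) V - 2 * nf (y - u) V := by linarith
    have := abs_sub (nf y V + nf (u - (y - u)) V) (2 * nf (y - u) V)
    have h' := abs_add_le (nf y V) (nf (u - (y - u)) V)
    rw [← e, abs_mul, abs_mul, abs_two] at this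
    linarith
  linarith

lemma sum_nf_eq_finr {k : ℕ} (M : Matrix (Fin W) (Fin k) ℂ) (V : Mat W) :
    ∑ c, nf (WithLp.toLp 2 fun i => M i c) V = finr M (V * M) := by
  simp only [nf, finr]
  rw [Finset.sum_comm]
  refine Finset.sum_congr rfl fun i _ => Finset.sum_congr rfl fun c _ => ?_
  rw [← Complex.re_sum, Matrix.mul_apply, star_sum, Finset.mul_sum]
  congr 1
  refine Finset.sum_congr rfl fun j _ => ?_
  rw [star_mul']; ring

lemma sum_norm_sq_col {k : ℕ} (M : Matrix (Fin W) (Fin k) ℂ) :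
    ∑ c, ‖(WithLp.toLp 2 fun i => M i c : EuclideanSpace ℂ (Fin W))‖ ^ 2 = fsq M := by
  simp only [EuclideanSpace.norm_sq_eq, fsq]
  rw [Finset.sum_comm]

/-- If the Hermitian form of `V` is at most `|z| / 2` then `V - z` is bounded below. -/
lemma fsq_le_fsq_sub_mul {k : ℕ} {V : Mat W} {z : ℝ}
    (h : ∀ x, |nf x V| ≤ |z| / 2 * ‖x‖ ^ 2) (M : Matrix (Fin W) (Fin k) ℂ) :
    z ^ 2 * fsq M ≤ 4 * fsq (V * M - z • M) := by
  have h1 : |finr M (V * M)| ≤ |z| / 2 * fsq M := by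
    rw [← sum_nf_eq_finr, ← sum_norm_sq_col, Finset.mul_sum]
    exact (Finset.abs_sum_le_sum_abs _ _).trans (Finset.sum_le_sum fun c _ => h _)
  have h2 : finr M (V * M - z • M) = finr M (V * M) - z * fsq M := by
    rw [finr_comm, finr_sub_left, finr_smul_left, finr_comm, finr_self]
  have h4 := two_finr_le (-((z / 2) • M)) (V * M - z • M)
  rw [fsq_neg] at h4
  rw [finr_neg_left] at h4
  rw [finr_smul_left, fsq_real_smul, h2] at h4
  have h5 : z * finr M (V * M) ≤ z ^ 2 / 2 * fsq M := by
    have h6 : |z * finr M (V * M)| ≤ |z| * (|z| / 2 * fsq M) := by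
      rw [abs_mul]; gcongr
    have h7 : |z| * (|z| / 2 * fsq M) = z ^ 2 / 2 * fsq M := by rw [← sq_abs z]; ring
    linarith [le_abs_self (z * finr M (V * M))]
  nlinarith

end

section

variable {W m : ℕ}

/-- The parameters of the rank one matrix `x x*`. -/
def rk (x : EuclideanSpace ℂ (Fin W)) : HermParam W :=
  fromHerm (vecMulVec (fun i => x i) fun i => star (x i))

lemma toHerm_rk (x : EuclideanSpace ℂ (Fin W)) :
    toHerm (rk x) = vecMulVec (fun i => x i) fun i => star (x i) := by
  refine toHerm_fromHerm ?_
  ext i j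
  simp [vecMulVec_apply, mul_comm]

lemma hin_rk (x : EuclideanSpace ℂ (Fin W)) (v : HermParam W) :
    hin (rk x) v = nf x (toHerm v) := by
  simp only [hin, finr, toHerm_rk, nf, vecMulVec_apply]

lemma hq_rk (x : EuclideanSpace ℂ (Fin W)) : hq (rk x) = ‖x‖ ^ 4 := by
  have h : ‖x‖ ^ 4 = (∑ i, ‖x i‖ ^ 2) * ∑ j, ‖x j‖ ^ 2 := by
    rw [← EuclideanSpace.norm_sq_eq]; ring
  rw [h, Finset.sum_mul_sum]
  simp only [hq, fsq, toHerm_rk, vecMulVec_apply, norm_mul, norm_star, mul_pow]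

lemma lintegral_exp_hin (hW : 0 < W) (u : HermParam W) (t : ℝ) :
    ∫⁻ ω : ΩW (m + 1) W, ENNReal.ofReal (Real.exp (t * hin u (ω.1 0))) * gw qtot ω =
      ENNReal.ofReal (Real.exp (t ^ 2 * hq u / (4 * W))) * Ztot m W := by
  have hW' : (W : ℝ) ≠ 0 := by exact_mod_cast hW.ne'
  obtain ⟨e, he⟩ : ∃ e : ΩW (m + 1) W, e = (Pi.single 0 ((t / (2 * W)) • u), 0) := ⟨_, rfl⟩
  have h : ∀ ω : ΩW (m + 1) W, ENNReal.ofReal (Real.exp (t * hin u (ω.1 0))) * gw qtot ω =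
      ENNReal.ofReal (Real.exp (t ^ 2 * hq u / (4 * W))) * gw qtot (ω - e) := by
    intro ω
    unfold gw
    rw [← ENNReal.ofReal_mul (Real.exp_pos _).le, ← ENNReal.ofReal_mul (Real.exp_pos _).le,
      ← Real.exp_add, ← Real.exp_add]
    have h0 : (ω - e).1 0 = ω.1 0 - (t / (2 * W)) • u := by simp [he]
    have h1 : ∀ j : Fin m, (ω - e).1 j.succ = ω.1 j.succ := fun j => by
      simp [he]
    have h2 : (ω - e).2 = ω.2 := by simp [he]
    rw [qtot_succ ω, qtot_succ (ω - e), h0, h2, hq_sub, hq_smul, hin_smul_right, hin_comm]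
    simp only [h1]
    congr 2
    field_simp
    ring
  simp only [h]
  have hm : Measurable fun ω : ΩW (m + 1) W => gw qtot (ω - e) :=
    measurable_gw_qtot.comp (measurable_sub_const e)
  rw [lintegral_const_mul _ hm, lintegral_sub_right_eq_self (fun ω : ΩW (m + 1) W => gw qtot ω) e,
    Ztot]

lemma measurable_nf_prod : Measurable fun p : HermParam W × EuclideanSpace ℂ (Fin W) =>
    nf p.2 (toHerm p.1) := by
  have h1 : ∀ i j, Measurable fun p : HermParam W × EuclideanSpace ℂ (Fin W) =>
      toHerm p.1 i j := fun i j =>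
    (((measurable_pi_apply j).comp ((measurable_pi_apply i).comp measurable_toHerm))).comp
      measurable_fst
  have h2 : ∀ i, Measurable fun p : HermParam W × EuclideanSpace ℂ (Fin W) => p.2 i := fun i =>
    (Continuous.measurable (by fun_prop : Continuous fun x : EuclideanSpace ℂ (Fin W) => x i)).comp
      measurable_snd
  unfold nf
  refine Finset.measurable_sum _ fun i _ => Finset.measurable_sum _ fun j _ => ?_
  exact Complex.measurable_re.comp (((h2 i).mul (continuous_star.measurable.comp (h2 j))).mul
    (continuous_star.measurable.comp (h1 i j)))

lemma lintegral_exp_nf_le (hW : 0 < W) {x : EuclideanSpace ℂ (Fin W)} (hx : ‖x‖ ≤ 2) (t : ℝ) :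
    ∫⁻ ω : ΩW (m + 1) W, (ENNReal.ofReal (Real.exp (t * nf x (toHerm (ω.1 0)))) +
        ENNReal.ofReal (Real.exp (-t * nf x (toHerm (ω.1 0))))) * gw qtot ω ≤
      2 * ENNReal.ofReal (Real.exp (4 * t ^ 2 / W)) * Ztot m W := by
  have hW' : (0 : ℝ) < W := by exact_mod_cast hW
  have hq4 : hq (rk x) ≤ 16 := by
    rw [hq_rk]
    calc ‖x‖ ^ 4 ≤ 2 ^ 4 := by gcongr
      _ = 16 := by norm_num
  have hle : ∀ s : ℝ, s ^ 2 = t ^ 2 →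
      ∫⁻ ω : ΩW (m + 1) W, ENNReal.ofReal (Real.exp (s * nf x (toHerm (ω.1 0)))) * gw qtot ω ≤
        ENNReal.ofReal (Real.exp (4 * t ^ 2 / W)) * Ztot m W := by
    intro s hs
    simp only [← hin_rk]
    rw [lintegral_exp_hin hW, hs]
    have : t ^ 2 * hq (rk x) / (4 * W) ≤ 4 * t ^ 2 / W := by
      rw [div_le_div_iff₀ (by positivity) hW']
      nlinarith [mul_le_mul_of_nonneg_left hq4 (show 0 ≤ t ^ 2 * W by positivity)]
    exact mul_le_mul_left (ENNReal.ofReal_le_ofReal (Real.exp_le_exp.2 this)) _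
  have hm1 : Measurable fun ω : ΩW (m + 1) W =>
      ENNReal.ofReal (Real.exp (t * nf x (toHerm (ω.1 0)))) * gw qtot ω := by
    have hc1 : Measurable fun ω : ΩW (m + 1) W => ω.1 0 := by fun_prop
    have hp : Measurable fun ω : ΩW (m + 1) W => (ω.1 0, x) := hc1.prodMk measurable_const
    have h1 := measurable_nf_prod.comp hp
    simp only [Function.comp_def] at h1
    have h2 : Measurable fun ω : ΩW (m + 1) W =>
        ENNReal.ofReal (Real.exp (t * nf x (toHerm (ω.1 0)))) := by fun_prop
    have h3 := measurable_gw_qtot (n := m + 1) (W := W)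
    fun_prop
  simp only [add_mul]
  rw [lintegral_add_left hm1]
  calc _ ≤ _ := add_le_add (hle t rfl) (hle (-t) (by ring))
    _ = _ := by rw [← two_mul, mul_assoc]

lemma sixteen_pow_le (k : ℕ) : (16 : ℝ) ^ (2 * k) ≤ Real.exp (6 * k) := by
  have h3 : (16 : ℝ) ≤ Real.exp 3 := by
    have h := Real.exp_one_gt_d9
    have e : Real.exp 3 = Real.exp 1 ^ 3 := by rw [← Real.exp_nat_mul]; norm_num
    rw [e]
    calc (16 : ℝ) ≤ 2.7 ^ 3 := by norm_num
      _ ≤ _ := by gcongr; linarith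
  calc (16 : ℝ) ^ (2 * k) ≤ Real.exp 3 ^ (2 * k) := by gcongr
    _ = _ := by rw [← Real.exp_nat_mul]; push_cast; congr 1; ring

/-- Exponential tail of the numerical radius of the first diagonal block. -/
lemma Pc_nf_gt_le (hW : 0 < W) (z : ℝ) {L : ℝ} (hL : 0 ≤ L) :
    Pc z m W {p | ∃ x, L * ‖x‖ ^ 2 < |nf x (toHerm ((conf z p).1 0))|} ≤
      ENNReal.ofReal (Real.exp (1 + 6 * W - W * L ^ 2 / 64)) := by
  have : Nonempty (Fin W) := ⟨⟨0, hW⟩⟩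
  have hW' : (0 : ℝ) < W := by exact_mod_cast hW
  obtain ⟨t, ht⟩ : ∃ t : ℝ, t = W * L / 16 := ⟨_, rfl⟩
  have ht0 : 0 ≤ t := by rw [ht]; positivity
  set E := EuclideanSpace ℂ (Fin W)
  let g : HermParam W × E → ℝ≥0∞ := fun p =>
    ENNReal.ofReal (Real.exp (t * nf p.2 (toHerm p.1))) +
      ENNReal.ofReal (Real.exp (-t * nf p.2 (toHerm p.1)))
  have hnf := measurable_nf_prod (W := W)
  have hg : Measurable g := by
    have h1 : Measurable fun p : HermParam W × E => t * nf p.2 (toHerm p.1) := hnf.const_mul t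
    have h2 : Measurable fun p : HermParam W × E => -t * nf p.2 (toHerm p.1) := hnf.const_mul (-t)
    exact h1.exp.ennreal_ofReal.add h2.exp.ennreal_ofReal
  let f : HermParam W → ℝ≥0∞ := fun v => ∫⁻ x in Metric.ball (0 : E) 2, g (v, x)
  have hf : Measurable f := hg.lintegral_prod_right'
  have hc1 : Measurable fun ω : ΩW (m + 1) W => ω.1 0 := by fun_prop
  have hfF : Measurable fun ω : ΩW (m + 1) W => f (ω.1 0) * gw qtot ω :=
    (hf.comp hc1).mul measurable_gw_qtot
  have hball : ∀ x : E, volume (Metric.ball x (1 / 8)) ≠ 0 := fun x =>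
    (Metric.measure_ball_pos _ _ (by norm_num)).ne'
  have hballt : ∀ x : E, ∀ r, volume (Metric.ball x r) ≠ ∞ := fun x r =>
    measure_ball_lt_top.ne
  have hvol : volume (Metric.ball (0 : E) 2) =
      ENNReal.ofReal (16 ^ (2 * W)) * volume (Metric.ball (0 : E) (1 / 8)) := by
    have h := Measure.addHaar_ball_mul (volume : Measure E) 0 (r := 16) (by norm_num) (1 / 8)
    rw [finrank_real_of_complex, finrank_euclideanSpace_fin] at h
    rw [← h]; norm_num
  have hint1 : ∀ ω : ΩW (m + 1) W, f (ω.1 0) * gw qtot ω =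
      ∫⁻ x in Metric.ball (0 : E) 2, g (ω.1 0, x) * gw qtot ω := by
    intro ω
    have : Measurable fun x : E => g (ω.1 0, x) := hg.comp measurable_prodMk_left
    exact (lintegral_mul_const _ this).symm
  have hx : ∀ x ∈ Metric.ball (0 : E) 2, ∫⁻ ω : ΩW (m + 1) W, g (ω.1 0, x) * gw qtot ω ≤
      2 * ENNReal.ofReal (Real.exp (4 * t ^ 2 / W)) * Ztot m W := fun x hx =>
    lintegral_exp_nf_le hW (mem_ball_zero_iff.1 hx).le t
  have hintg : ∫⁻ p : ΩW (m + 1) W, f ((conf z p).1 0) * gw qtot (conf z p) ≤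
      (2 * ENNReal.ofReal (Real.exp (4 * t ^ 2 / W)) * volume (Metric.ball (0 : E) 2)) *
        Ztot m W := by
    rw [lintegral_conf z (F := fun ω : ΩW (m + 1) W => f (ω.1 0) * gw qtot ω) hfF]
    simp only [hint1]
    have hgm : Measurable (Function.uncurry fun (ω : ΩW (m + 1) W) (x : E) =>
        g (ω.1 0, x) * gw qtot ω) :=
      (hg.comp ((hc1.comp measurable_fst).prodMk measurable_snd)).mul
        (measurable_gw_qtot.comp measurable_fst)
    rw [lintegral_lintegral_swap hgm.aemeasurable]
    calc _ ≤ ∫⁻ x in Metric.ball (0 : E) 2,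
          2 * ENNReal.ofReal (Real.exp (4 * t ^ 2 / W)) * Ztot m W :=
          setLIntegral_mono measurable_const hx
      _ = _ := by rw [setLIntegral_const]; ring
  refine (Pc_le_of_lintegral_le hW z (f := fun p => f ((conf z p).1 0))
    (c := ENNReal.ofReal (Real.exp (t * (L / 2))) * volume (Metric.ball (0 : E) (1 / 8)))
    (hf.comp (hc1.comp (measurable_conf z))) ?_ ?_ hintg ?_).trans ?_
  · exact mul_ne_zero (by simp [Real.exp_pos]) (hball 0)
  · exact ENNReal.mul_ne_top ENNReal.ofReal_ne_top (hballt _ _)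
  · rintro p hp
    obtain ⟨u, hu, hy⟩ := exists_ball_le_nf hL hp
    have hsub : Metric.ball u (1 / 8) ⊆ Metric.ball (0 : E) 2 := by
      refine Metric.ball_subset_ball' ?_
      rw [dist_zero_right, hu]; norm_num
    calc _ = ∫⁻ x in Metric.ball u (1 / 8), ENNReal.ofReal (Real.exp (t * (L / 2))) := by
          rw [setLIntegral_const]
          congr 1
          exact (Measure.addHaar_ball_center volume u (1 / 8)).symm
      _ ≤ ∫⁻ x in Metric.ball u (1 / 8), g ((conf z p).1 0, x) := by
          refine setLIntegral_mono (hg.comp measurable_prodMk_left) fun y hyb => ?_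
          have h1 := hy y hyb
          rcases le_abs.1 h1 with h2 | h2
          · refine le_trans ?_ le_self_add
            gcongr
          · refine le_trans ?_ le_add_self
            rw [neg_mul, ← mul_neg]
            gcongr
      _ ≤ _ := lintegral_mono_set hsub
  · rw [hvol]
    have h16 := sixteen_pow_le W
    have h2 : (2 : ℝ≥0∞) ≤ ENNReal.ofReal (Real.exp 1) := by
      rw [show (2 : ℝ≥0∞) = ENNReal.ofReal 2 by simp]
      exact ENNReal.ofReal_le_ofReal (by linarith [Real.add_one_le_exp 1])
    rw [← mul_assoc, ENNReal.mul_div_mul_right _ _ (hball 0) (hballt _ _)]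
    refine ENNReal.div_le_of_le_mul ?_
    calc _ ≤ ENNReal.ofReal (Real.exp 1) * ENNReal.ofReal (Real.exp (4 * t ^ 2 / W)) *
          ENNReal.ofReal (Real.exp (6 * W)) := by gcongr
      _ = ENNReal.ofReal (Real.exp (1 + 6 * W - W * L ^ 2 / 64)) *
          ENNReal.ofReal (Real.exp (t * (L / 2))) := by
        rw [← ENNReal.ofReal_mul (Real.exp_pos _).le, ← ENNReal.ofReal_mul (by positivity),
          ← ENNReal.ofReal_mul (Real.exp_pos _).le, ← Real.exp_add, ← Real.exp_add,
          ← Real.exp_add]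
        congr 2
        rw [ht]; field_simp; ring

end

section

variable {W m : ℕ}

lemma qtot_tail_exponent_le {A n w : ℝ} (hA : 0 < A) (hn : 1 ≤ n) (hw : 1 ≤ w) :
    5 * n * w ^ 2 - (12 + 4 * A) * n * w ^ 2 / 2 ≤ -A * (n + Real.log w) - 1 := by
  have hlW : Real.log w ≤ w := Real.log_le_self (by linarith)
  have h1 : n ≤ n * w ^ 2 := le_mul_of_one_le_right (by linarith) (one_le_pow₀ hw)
  have h2 : w ≤ n * w ^ 2 := by
    have : w ≤ w ^ 2 := by nlinarith
    exact this.trans (le_mul_of_one_le_left (by positivity) hn)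
  have h3 : A * (n + Real.log w) ≤ A * (2 * (n * w ^ 2)) := by gcongr; linarith
  nlinarith

/-- The deformation rescaling the first hopping block only. -/
def endθ (t : ℝ) (W : ℕ) {m : ℕ} (_ : Fin (m + 1) → HermParam W) (j : Fin m) : ℝ :=
  if (j : ℕ) = 0 then t else 0

lemma sum_endθ (hm : 0 < m) (t : ℝ) (γ : Fin (m + 1) → HermParam W) :
    ∑ j, endθ t W γ j = t := by
  rw [Finset.sum_eq_single_of_mem (⟨0, hm⟩ : Fin m) (Finset.mem_univ _)]
  · simp [endθ]
  · intro j _ hj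
    exact if_neg fun h => hj (Fin.ext h)

lemma sum_endθ_sq_mul (hm : 0 < m) (t : ℝ) (γ : Fin (m + 1) → HermParam W) (f : Fin m → ℝ) :
    ∑ j, endθ t W γ j ^ 2 * f j = t ^ 2 * f ⟨0, hm⟩ := by
  rw [Finset.sum_eq_single_of_mem (⟨0, hm⟩ : Fin m) (Finset.mem_univ _)]
  · simp [endθ]
  · intro j _ hj
    have : endθ t W γ j = 0 := if_neg fun h => hj (Fin.ext h)
    rw [this]; ring

lemma abs_two_mul_endθ_le {t : ℝ} (ht : |2 * t| ≤ 1) (γ : Fin (m + 1) → HermParam W) (j : Fin m) :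
    |2 * endθ t W γ j| ≤ 1 := by
  unfold endθ; split_ifs <;> simp_all

lemma blocks_le_of_qtot_le (hW : 0 < W) (hm : 0 < m) {K' z : ℝ} {p : ΩW (m + 1) W}
    (h : qtot (conf z p) ≤ K' * ((m + 1 : ℕ) : ℝ) * (W : ℝ) ^ 2) :
    hq ((conf z p).1 0) + hq ((conf z p).1 (Fin.succ ⟨0, hm⟩)) + mq (p.2 ⟨0, hm⟩) ≤
      K' * ((m + 1 : ℕ) : ℝ) * W := by
  have hW' : (0 : ℝ) < W := by exact_mod_cast hW
  rw [qtot_succ] at h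
  have h1 : hq ((conf z p).1 (Fin.succ ⟨0, hm⟩)) ≤ ∑ j : Fin m, hq ((conf z p).1 j.succ) :=
    Finset.single_le_sum (f := fun j : Fin m => hq ((conf z p).1 j.succ))
      (fun _ _ => hq_nonneg _) (Finset.mem_univ _)
  have h2 : mq (p.2 ⟨0, hm⟩) ≤ ∑ j : Fin m, mq ((conf z p).2 j) :=
    Finset.single_le_sum (f := fun j : Fin m => mq ((conf z p).2 j))
      (fun _ _ => mq_nonneg _) (Finset.mem_univ _)
  have h3 : hq ((conf z p).1 0) + ∑ j : Fin m, hq ((conf z p).1 j.succ) +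
      ∑ j : Fin m, mq ((conf z p).2 j) ≤ K' * ((m + 1 : ℕ) : ℝ) * W :=
    le_of_mul_le_mul_left (h.trans (by ring_nf; rfl)) hW'
  linarith

/-- Good deformations for energies near the center when the bandwidth dominates the length. -/
lemma exists_hasGoodDeformation_center {A : ℝ} (hA : 0 < A) : ∃ B : ℝ, ∀ m W : ℕ, 24 < m + 1 →
    24 < W → (m + 1) ^ 6 ≤ W → ∀ z : ℝ, z ^ 2 * ((m + 1 : ℕ) : ℝ) ^ 2 ≤ W →
      HasGoodDeformation A B z m W := by
  obtain ⟨K', hK'⟩ : ∃ K' : ℝ, K' = 12 + 4 * A := ⟨_, rfl⟩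
  have hK'0 : 0 < K' := by rw [hK']; positivity
  refine ⟨72 * (11 * K' + 10), ?_⟩
  intro m W hm hW hWm z hz
  have hm0 : 0 < m := by omega
  have hn : (25 : ℝ) ≤ ((m + 1 : ℕ) : ℝ) := by exact_mod_cast hm
  have hW' : (25 : ℝ) ≤ W := by exact_mod_cast hW
  have hW0 : 0 < W := by omega
  set n : ℝ := ((m + 1 : ℕ) : ℝ) with hndef
  have hnW : n ^ 6 ≤ W := by rw [hndef]; exact_mod_cast hWm
  have hn2 : n ^ 2 ≤ W := (pow_le_pow_right₀ (by linarith) (by norm_num)).trans hnW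
  have hzn : z ^ 2 * n ≤ W := by
    refine le_trans ?_ hz
    gcongr
    nlinarith
  have hq0 : 0 ≤ n / (W : ℝ) ^ 3 := by positivity
  obtain ⟨α, hα⟩ : ∃ α : ℝ, α = Real.sqrt (n / (W : ℝ) ^ 3) := ⟨_, rfl⟩
  have hα0 : 0 ≤ α := by rw [hα]; positivity
  have hα2 : α ^ 2 * (W : ℝ) ^ 3 = n := by rw [hα, Real.sq_sqrt hq0]; field_simp
  have hα1 : 6 * α ≤ 1 := by
    have h1 : (36 : ℝ) * n ≤ (W : ℝ) ^ 3 := by nlinarith [sq_nonneg (W : ℝ)]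
    have h2 : 36 * α ^ 2 ≤ 1 := by
      have : (0 : ℝ) < (W : ℝ) ^ 3 := by positivity
      nlinarith
    nlinarith
  have hkap : ∀ (γ : Fin (m + 1) → HermParam W) (j : Fin m),
      kap (-(6 * α)) (endθ (-(3 * α)) W) γ j = 0 := by
    intro γ j
    by_cases hj : (j : ℕ) = 0
    · have : j.castSucc = 0 := Fin.ext hj
      simp only [kap, endθ, if_pos hj, if_pos this]; ring
    · have : j.castSucc ≠ 0 := fun h => hj (congrArg Fin.val h)
      simp only [kap, endθ, if_neg hj, if_neg this]; ring
  refine ⟨-(6 * α), endθ (-(3 * α)) W, {p | qtot (conf z p) ≤ K' * n * (W : ℝ) ^ 2},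
    fun j => measurable_const, ?_, ?_, ?_, ?_⟩
  · refine measurableSet_le ?_ measurable_const
    have := measurable_conf (W := W) z (m := m); fun_prop
  · intro p hp hpR
    have h := qtot_scale_cost z (θ := endθ (-(3 * α)) W) (b := -(6 * α)) hpR
      (by rw [abs_neg, abs_of_nonneg (by positivity)]; exact hα1)
      (fun j => by rw [hkap]; simp)
      (abs_two_mul_endθ_le (by rw [abs_le]; constructor <;> linarith) _)
    refine h.trans ?_
    have hbl := blocks_le_of_qtot_le hW0 hm0 hp
    have e : ∀ j : Fin m, 2 * (kap (-(6 * α)) (endθ (-(3 * α)) W) p.1 j) ^ 2 *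
        (hq ((conf z p).1 j.succ) + 5 * hq (sel (p.2 j) (p.1 j.castSucc))) +
        8 * (endθ (-(3 * α)) W p.1 j) ^ 2 * mq (p.2 j) =
        (endθ (-(3 * α)) W p.1 j) ^ 2 * (8 * mq (p.2 j)) := fun j => by rw [hkap]; ring
    simp only [e]
    rw [sum_endθ_sq_mul hm0]
    have hz0 := hq_zero_le z p
    have hv0 := hq_nonneg ((conf z p).1 0)
    have hv1 := hq_nonneg ((conf z p).1 (Fin.succ ⟨0, hm0⟩))
    have hm1 := mq_nonneg (p.2 ⟨0, hm0⟩)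
    have hsum : hq ((conf z p).1 0) + 5 * hq (p.1 0) + mq (p.2 ⟨0, hm0⟩) ≤
        11 * (K' * n * W) + 10 * (z ^ 2 * W) := by linarith
    have hfin : (W : ℝ) ^ 2 * (11 * (K' * n * W) + 10 * (z ^ 2 * W)) * n ≤
        (W : ℝ) ^ 2 * ((11 * K' + 10) * (W : ℝ) ^ 2) := by
      have h1 : K' * n ^ 2 * W ≤ K' * W * W := by gcongr
      have h2 : z ^ 2 * n * W ≤ W * W := by gcongr
      rw [mul_assoc]
      exact mul_le_mul_of_nonneg_left (by nlinarith) (by positivity)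
    have hcost : (W : ℝ) * (72 * α ^ 2 * (11 * (K' * n * W) + 10 * (z ^ 2 * W))) ≤
        72 * (11 * K' + 10) := by
      have hW4 : (0 : ℝ) < (W : ℝ) ^ 4 := by positivity
      refine le_of_mul_le_mul_left ?_ hW4
      calc (W : ℝ) ^ 4 * (W * (72 * α ^ 2 * (11 * (K' * n * W) + 10 * (z ^ 2 * W)))) =
          72 * ((W : ℝ) ^ 2 * (11 * (K' * n * W) + 10 * (z ^ 2 * W)) * (α ^ 2 * (W : ℝ) ^ 3)) := by
            ring
        _ ≤ 72 * ((W : ℝ) ^ 2 * ((11 * K' + 10) * (W : ℝ) ^ 2)) := by rw [hα2]; linarith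
        _ = _ := by ring
    refine le_trans ?_ hcost
    refine mul_le_mul_of_nonneg_left ?_ (by positivity)
    nlinarith [mul_le_mul_of_nonneg_left hsum (show 0 ≤ 72 * α ^ 2 by positivity)]
  · intro p _ _
    rw [sum_endθ hm0, ← hα]; linarith
  · have htail := qtot_tail_exponent_le (A := A) hA (show (1 : ℝ) ≤ n by linarith)
      (show (1 : ℝ) ≤ W by linarith)
    rw [← hK'] at htail
    have hP := Pc_qtot_gt_le (m := m) hW0 z (K' * n * (W : ℝ) ^ 2)
    refine Pc_real_le_of_subset_union (E₂ := {p | K' * n * (W : ℝ) ^ 2 < qtot (conf z p)})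
      ?_ hP hP htail htail
    intro p hp
    have hp' : ¬ qtot (conf z p) ≤ K' * n * (W : ℝ) ^ 2 := hp
    exact Or.inl (not_le.1 hp')

/-- A bound on the self-energy away from the numerical range of the block. -/
lemma hq_sel_zero_le {z : ℝ} (hz : z ≠ 0) {v : HermParam W} {γ : HermParam W}
    (hγ : v = γ + zpar W z) (h : ∀ x, |nf x (toHerm v)| ≤ |z| / 2 * ‖x‖ ^ 2) (T : MatP W) :
    hq (sel T γ) ≤ 4 * mq T ^ 2 / z ^ 2 := by
  have hz2 : 0 < z ^ 2 := by positivity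
  have hm := mq_nonneg T
  rw [hq, toHerm_sel]
  by_cases hu : IsUnit (toHerm γ).det
  · have h1 := fsq_le_fsq_sub_mul h ((toHerm γ)⁻¹ * (Matrix.of T : Mat W)ᴴ)
    have e : toHerm v * ((toHerm γ)⁻¹ * (Matrix.of T : Mat W)ᴴ) -
        z • ((toHerm γ)⁻¹ * (Matrix.of T : Mat W)ᴴ) = (Matrix.of T : Mat W)ᴴ := by
      have hs : z • ((toHerm γ)⁻¹ * (Matrix.of T : Mat W)ᴴ) =
          (z : ℂ) • ((toHerm γ)⁻¹ * (Matrix.of T : Mat W)ᴴ) := by ext; simp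
      rw [hγ, toHerm_add, toHerm_zpar, add_mul, smul_mul_assoc, one_mul, hs, add_sub_cancel_right,
        ← mul_assoc, Matrix.mul_nonsing_inv _ hu, one_mul]
    rw [e, fsq_conjTranspose] at h1
    have h2 := fsq_mul_le (Matrix.of T : Mat W) ((toHerm γ)⁻¹ * (Matrix.of T : Mat W)ᴴ)
    rw [mul_assoc, le_div_iff₀ hz2]
    change z ^ 2 * _ ≤ 4 * mq T at h1
    change _ ≤ mq T * _ at h2
    nlinarith [mul_le_mul_of_nonneg_left h1 hm, mul_le_mul_of_nonneg_right h2 hz2.le]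
  · rw [Matrix.nonsing_inv_apply_not_isUnit _ hu, mul_zero, zero_mul, fsq_zero]
    positivity

/-- Good deformations for energies away from the center when the bandwidth dominates the
length. -/
lemma exists_hasGoodDeformation_edge {A : ℝ} (hA : 0 < A) : ∃ (B : ℝ) (N : ℕ), ∀ m W : ℕ,
    24 < m + 1 → N < m + 1 → 24 < W → (m + 1) ^ 6 ≤ W → ∀ z : ℝ,
      (W : ℝ) ≤ z ^ 2 * ((m + 1 : ℕ) : ℝ) ^ 2 → HasGoodDeformation A B z m W := by
  obtain ⟨K', hK'⟩ : ∃ K' : ℝ, K' = 12 + 4 * A := ⟨_, rfl⟩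
  have hK'0 : 0 < K' := by rw [hK']; positivity
  obtain ⟨N, hN⟩ := exists_nat_ge (max (4 * K' ^ 2) (256 * (8 + 2 * A)))
  refine ⟨360 * (K' + 1), N, ?_⟩
  intro m W hm hNm hW hWm z hz
  have hm0 : 0 < m := by omega
  have hn : (25 : ℝ) ≤ ((m + 1 : ℕ) : ℝ) := by exact_mod_cast hm
  have hW' : (25 : ℝ) ≤ W := by exact_mod_cast hW
  have hW0 : 0 < W := by omega
  have hNn : (N : ℝ) ≤ ((m + 1 : ℕ) : ℝ) := by exact_mod_cast hNm.le
  set n : ℝ := ((m + 1 : ℕ) : ℝ) with hndef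
  have hnK : 4 * K' ^ 2 ≤ n := (le_max_left _ _).trans (hN.trans hNn)
  have hnA : 256 * (8 + 2 * A) ≤ n := (le_max_right _ _).trans (hN.trans hNn)
  have hnW : n ^ 6 ≤ W := by rw [hndef]; exact_mod_cast hWm
  have hn2 : n ^ 2 ≤ W := (pow_le_pow_right₀ (by linarith) (by norm_num)).trans hnW
  have hz4 : n ≤ z ^ 2 := by
    have h1 : n ^ 2 * n ^ 4 ≤ n ^ 2 * z ^ 2 := by
      calc n ^ 2 * n ^ 4 = n ^ 6 := by ring
        _ ≤ z ^ 2 * n ^ 2 := hnW.trans hz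
        _ = _ := by ring
    have h2 : n ^ 4 ≤ z ^ 2 := le_of_mul_le_mul_left h1 (by positivity)
    exact (le_self_pow₀ (by linarith) (by norm_num)).trans h2
  have hz0 : z ≠ 0 := by rintro rfl; norm_num at hz4; linarith
  have hq0 : 0 ≤ n / (W : ℝ) ^ 3 := by positivity
  obtain ⟨α, hα⟩ : ∃ α : ℝ, α = Real.sqrt (n / (W : ℝ) ^ 3) := ⟨_, rfl⟩
  have hα0 : 0 ≤ α := by rw [hα]; positivity
  have hα2 : α ^ 2 * (W : ℝ) ^ 3 = n := by rw [hα, Real.sq_sqrt hq0]; field_simp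
  have hα1 : 6 * α ≤ 1 := by
    have h1 : (36 : ℝ) * n ≤ (W : ℝ) ^ 3 := by nlinarith [sq_nonneg (W : ℝ)]
    have h2 : 36 * α ^ 2 ≤ 1 := by
      have : (0 : ℝ) < (W : ℝ) ^ 3 := by positivity
      nlinarith
    nlinarith
  have hkap : ∀ (γ : Fin (m + 1) → HermParam W) (j : Fin m),
      kap 0 (endθ (3 * α) W) γ j = 2 * endθ (3 * α) W γ j := by
    intro γ j; simp [kap]
  have hθ1 : ∀ (γ : Fin (m + 1) → HermParam W) (j : Fin m), |2 * endθ (3 * α) W γ j| ≤ 1 :=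
    abs_two_mul_endθ_le (by rw [abs_le]; constructor <;> linarith)
  refine ⟨0, endθ (3 * α) W, {p | qtot (conf z p) ≤ K' * n * (W : ℝ) ^ 2} ∩
    {p | n * hq (sel (p.2 ⟨0, hm0⟩) (p.1 0)) ≤ (W : ℝ) ^ 2}, fun j => measurable_const,
    ?_, ?_, ?_, ?_⟩
  · refine MeasurableSet.inter (measurableSet_le ?_ measurable_const)
      (measurableSet_le ?_ measurable_const)
    · have := measurable_conf (W := W) z (m := m); fun_prop
    · have h1 : Measurable fun p : ΩW (m + 1) W => (p.1 0, p.2 ⟨0, hm0⟩) :=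
        ((measurable_pi_apply 0).comp measurable_fst).prodMk
          ((measurable_pi_apply _).comp measurable_snd)
      have h2 := measurable_hq.comp (measurable_sel.comp h1)
      simp only [Function.comp_def] at h2
      exact h2.const_mul n
  · rintro p ⟨hp, hpB⟩ hpR
    have h := qtot_scale_cost z (θ := endθ (3 * α) W) (b := 0) hpR (by simp)
      (fun j => by rw [hkap]; exact hθ1 _ j) (hθ1 _)
    refine h.trans ?_
    have hbl := blocks_le_of_qtot_le hW0 hm0 hp
    have e : ∀ j : Fin m, 2 * (kap 0 (endθ (3 * α) W) p.1 j) ^ 2 *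
        (hq ((conf z p).1 j.succ) + 5 * hq (sel (p.2 j) (p.1 j.castSucc))) +
        8 * (endθ (3 * α) W p.1 j) ^ 2 * mq (p.2 j) =
        (endθ (3 * α) W p.1 j) ^ 2 * (8 * (hq ((conf z p).1 j.succ) +
          5 * hq (sel (p.2 j) (p.1 j.castSucc)) + mq (p.2 j))) := fun j => by rw [hkap]; ring
    simp only [e]
    rw [sum_endθ_sq_mul hm0]
    have hv0 := hq_nonneg ((conf z p).1 0)
    change n * hq (sel (p.2 ⟨0, hm0⟩) (p.1 (Fin.castSucc ⟨0, hm0⟩))) ≤ (W : ℝ) ^ 2 at hpB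
    obtain ⟨S, hS⟩ : ∃ S : ℝ, S = hq ((conf z p).1 (Fin.succ ⟨0, hm0⟩)) +
      5 * hq (sel (p.2 ⟨0, hm0⟩) (p.1 (Fin.castSucc ⟨0, hm0⟩))) + mq (p.2 ⟨0, hm0⟩) := ⟨_, rfl⟩
    rw [← hS]
    have hsum : n * S ≤ 5 * (K' + 1) * (W : ℝ) ^ 2 := by
      have h1 : K' * n ^ 2 * W ≤ K' * W * W := by gcongr
      have h2 : n * (hq ((conf z p).1 (Fin.succ ⟨0, hm0⟩)) + mq (p.2 ⟨0, hm0⟩)) ≤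
          n * (K' * n * W) := by gcongr; linarith
      rw [hS]
      nlinarith [mul_nonneg hK'0.le (sq_nonneg (W : ℝ))]
    have hW2 : (0 : ℝ) < (W : ℝ) ^ 2 := by positivity
    refine le_of_mul_le_mul_left ?_ hW2
    calc (W : ℝ) ^ 2 * (W * (2 * (0 : ℝ) ^ 2 * (hq ((conf z p).1 0) + 5 * hq (p.1 0)) +
          (3 * α) ^ 2 * (8 * S))) = 72 * ((α ^ 2 * (W : ℝ) ^ 3) * S) := by ring
      _ ≤ 72 * (5 * (K' + 1) * (W : ℝ) ^ 2) := by rw [hα2]; linarith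
      _ = _ := by ring
  · intro p _ _
    rw [sum_endθ hm0, ← hα]; linarith
  · have htail := qtot_tail_exponent_le (A := A) hA (show (1 : ℝ) ≤ n by linarith)
      (show (1 : ℝ) ≤ W by linarith)
    rw [← hK'] at htail
    refine Pc_real_le_of_subset_union ?_ (Pc_qtot_gt_le (m := m) hW0 z (K' * n * (W : ℝ) ^ 2))
      (Pc_nf_gt_le (m := m) hW0 z (L := |z| / 2) (by positivity)) htail ?_
    · intro p hp
      by_contra hcon
      rw [Set.mem_union, not_or] at hcon
      obtain ⟨hc1, hc2⟩ := hcon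
      have hc1' : qtot (conf z p) ≤ K' * n * (W : ℝ) ^ 2 := not_lt.1 hc1
      refine hp ⟨hc1', ?_⟩
      have hc2' : ∀ x, |nf x (toHerm ((conf z p).1 0))| ≤ |z| / 2 * ‖x‖ ^ 2 := fun x =>
        not_lt.1 fun hx => hc2 ⟨x, hx⟩
      have hs := hq_sel_zero_le hz0 (conf_fst_zero z p) hc2' (p.2 ⟨0, hm0⟩)
      have hbl := blocks_le_of_qtot_le hW0 hm0 hc1'
      have hv0 := hq_nonneg ((conf z p).1 0)
      have hv1 := hq_nonneg ((conf z p).1 (Fin.succ ⟨0, hm0⟩))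
      have hm1 := mq_nonneg (p.2 ⟨0, hm0⟩)
      have hmq : mq (p.2 ⟨0, hm0⟩) ^ 2 ≤ (K' * n * W) ^ 2 := by gcongr; linarith
      change n * hq (sel (p.2 ⟨0, hm0⟩) (p.1 0)) ≤ (W : ℝ) ^ 2
      rw [le_div_iff₀ (by positivity)] at hs
      have hz2 : 0 < z ^ 2 := by positivity
      refine le_of_mul_le_mul_right ?_ hz2
      have h5 : 4 * K' ^ 2 * n ^ 5 ≤ W := by
        calc 4 * K' ^ 2 * n ^ 5 ≤ n * n ^ 5 := by gcongr
          _ = n ^ 6 := by ring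
          _ ≤ W := hnW
      have hn0 : 0 < n ^ 2 := by positivity
      refine le_of_mul_le_mul_left ?_ hn0
      calc n ^ 2 * (n * hq (sel (p.2 ⟨0, hm0⟩) (p.1 0)) * z ^ 2) =
          n ^ 3 * (hq (sel (p.2 ⟨0, hm0⟩) (p.1 0)) * z ^ 2) := by ring
        _ ≤ n ^ 3 * (4 * (K' * n * W) ^ 2) :=
          mul_le_mul_of_nonneg_left (by linarith) (by positivity)
        _ = (4 * K' ^ 2 * n ^ 5) * (W : ℝ) ^ 2 := by ring
        _ ≤ W * (W : ℝ) ^ 2 := by gcongr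
        _ ≤ (z ^ 2 * n ^ 2) * (W : ℝ) ^ 2 := by gcongr
        _ = _ := by ring
    · rw [div_pow, sq_abs]
      have hlW : Real.log W ≤ W := Real.log_le_self (by linarith)
      have hnW1 : n ≤ W := by nlinarith
      have h3 : A * (n + Real.log W) ≤ A * (2 * W) := by gcongr; linarith
      have h4 : (W : ℝ) * (256 * (8 + 2 * A)) ≤ W * z ^ 2 := by gcongr; linarith
      nlinarith

lemma HasGoodDeformation.mono {A B B' z : ℝ} (h : HasGoodDeformation A B z m W) (hB : B ≤ B') :
    HasGoodDeformation A B' z m W := by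
  obtain ⟨b, θ, Gd, h1, h2, h3, h4, h5⟩ := h
  exact ⟨b, θ, Gd, h1, h2, fun p hp hr => (h3 p hp hr).trans hB, h4, h5⟩

lemma exists_hasGoodDeformation {A : ℝ} (hA : 0 < A) : ∃ (B : ℝ) (N : ℕ), ∀ m W : ℕ,
    N < m + 1 → N < W → ∀ z : ℝ, z ^ 2 ≤ W → HasGoodDeformation A B z m W := by
  obtain ⟨B₁, h₁⟩ := exists_hasGoodDeformation_bulk hA
  obtain ⟨B₂, h₂⟩ := exists_hasGoodDeformation_center hA
  obtain ⟨B₃, N, h₃⟩ := exists_hasGoodDeformation_edge hA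
  refine ⟨max B₁ (max B₂ B₃), max 24 N, ?_⟩
  intro m W hm hW z hz
  obtain ⟨hm24, hmN⟩ := max_lt_iff.1 hm
  have hW24 := (max_lt_iff.1 hW).1
  rcases le_total W ((m + 1) ^ 6) with h | h
  · exact (h₁ m W hm24 hW24 h z hz).mono (le_max_left _ _)
  rcases le_total (z ^ 2 * ((m + 1 : ℕ) : ℝ) ^ 2) W with hz' | hz'
  · exact (h₂ m W hm24 hW24 h z hz').mono ((le_max_left _ _).trans (le_max_right _ _))
  · exact (h₃ m W hm24 hmN hW24 h z hz').mono ((le_max_right _ _).trans (le_max_right _ _))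

end

theorem main_mermin_wagner_estimate (ξ s : ℝ) (hξ : 0 < ξ) (hs : s ∈ Set.Ioo (0:ℝ) 1) :
    ∃ c₁ > (0:ℝ), ∃ β₀ : ℝ, ∃ N₀ : ℕ, ∀ n W : ℕ, ∀ hn : N₀ < n, ∀ hW : N₀ < W,
    ∀ z : ℝ, |z| ≤ Real.sqrt W →
    Real.exp (-ξ * n) ≤
        (∫ ω, Real.exp ((s / 2) *
          Real.log (opNorm (Gblock ω (z : ℂ) ⟨0, by omega⟩ ⟨n - 1, by omega⟩)))
          ∂(wegner n W)) →
    ∀ q ∈ Set.Ioo (s / 2) s,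
      (tiltProb (wegner n W)
          (fun ω => Real.log (opNorm (Gblock ω (z : ℂ) ⟨0, by omega⟩ ⟨n - 1, by omega⟩))) q
          {ω | |Real.log (opNorm (Gblock ω (z : ℂ) ⟨0, by omega⟩ ⟨n - 1, by omega⟩)) -
              tiltExp (wegner n W)
                (fun ω' => Real.log (opNorm (Gblock ω' (z : ℂ) ⟨0, by omega⟩ ⟨n - 1, by omega⟩))) q
                (fun ω' => Real.log (opNorm (Gblock ω' (z : ℂ) ⟨0, by omega⟩ ⟨n - 1, by omega⟩)))| ≤
            c₁ * Real.sqrt ((n : ℝ) / (W : ℝ) ^ 3)}) ≤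
      β₀ * Real.sqrt
        ((tiltProb (wegner n W)
            (fun ω => Real.log (opNorm (Gblock ω (z : ℂ) ⟨0, by omega⟩ ⟨n - 1, by omega⟩))) q
            {ω | 2 * (c₁ * Real.sqrt ((n : ℝ) / (W : ℝ) ^ 3)) ≤
                Real.log (opNorm (Gblock ω (z : ℂ) ⟨0, by omega⟩ ⟨n - 1, by omega⟩)) -
                tiltExp (wegner n W)
                  (fun ω' => Real.log (opNorm (Gblock ω' (z : ℂ) ⟨0, by omega⟩ ⟨n - 1, by omega⟩))) q
                  (fun ω' => Real.log (opNorm (Gblock ω' (z : ℂ) ⟨0, by omega⟩ ⟨n - 1, by omega⟩)))}) *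
         (tiltProb (wegner n W)
            (fun ω => Real.log (opNorm (Gblock ω (z : ℂ) ⟨0, by omega⟩ ⟨n - 1, by omega⟩))) q
            {ω | Real.log (opNorm (Gblock ω (z : ℂ) ⟨0, by omega⟩ ⟨n - 1, by omega⟩)) -
                tiltExp (wegner n W)
                  (fun ω' => Real.log (opNorm (Gblock ω' (z : ℂ) ⟨0, by omega⟩ ⟨n - 1, by omega⟩))) q
                  (fun ω' => Real.log (opNorm (Gblock ω' (z : ℂ) ⟨0, by omega⟩ ⟨n - 1, by omega⟩))) ≤
                -(2 * (c₁ * Real.sqrt ((n : ℝ) / (W : ℝ) ^ 3)))})) + 1 / 2 := by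
  have hs0 := hs.1
  have hs1 := hs.2
  obtain ⟨A, hA, h⟩ := exists_rate_tiltProb_le hξ hs0 hs1
  obtain ⟨B, N, hB⟩ := exists_hasGoodDeformation hA
  refine ⟨1, one_pos, Real.exp (B / 2), N, ?_⟩
  intro n W hn hW z hz hlow q hq
  obtain ⟨m, rfl⟩ : ∃ m, n = m + 1 := ⟨n - 1, by omega⟩
  have hz2 : z ^ 2 ≤ W := by
    rw [← sq_abs, ← Real.sq_sqrt (Nat.cast_nonneg W)]
    gcongr
  obtain ⟨b, θ, Gd, hθ, hGd, hcost, hshift, hsmall⟩ := hB m W hn hW z hz2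
  rw [one_mul]
  exact h m W (by omega) z hlow q hq.1 hq.2 (Real.sqrt (((m + 1 : ℕ) : ℝ) / (W : ℝ) ^ 3))
    (Real.exp (B / 2)) b θ Gd (Real.exp_pos _) hθ hGd
    (fun p hp hr => (hcost p hp hr).trans (by rw [Real.log_exp]; linarith)) hshift hsmall _

end RBM
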